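/- arXiv:math/0504391 — 4 statements merged into one kernel-verified Lean document; each statement's English description precedes it below -/
import Mathlib

section
/- Let d ≥ 3 and m > 2. Then there exists a bounded, nonnegative, not identically zero function v : ℝ^d × [0,∞) → ℝ, continuous on ℝ^d × [0,∞), twice continuously differentiable in x and once in t on ℝ^d × (0,∞), satisfying ∂v/∂t = (1+|x|)^m Δv on ℝ^d × (0,∞) and v(x,0) = 0 for all x ∈ ℝ^d. -/
open Set
/-- The `i`-th partial derivative of a function on `ℝ^d`. -/
noncomputable def pd {d : ℕ} (i : Fin d) (f : EuclideanSpace ℝ (Fin d) → ℝ)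
    (x : EuclideanSpace ℝ (Fin d)) : ℝ :=
  fderiv ℝ f x (EuclideanSpace.single i 1)

open Set Filter Topology MeasureTheory

section Averages

variable {E : Type*} [NormedAddCommGroup E] [NormedSpace ℝ E]

/-- The weighted average `∫₀¹ θ^ν h(aθ) dθ`. -/
noncomputable def wavg (ν : ℝ) (h : ℝ → E) (a : ℝ) : E :=
  ∫ θ in (0 : ℝ)..1, θ ^ ν • h (a * θ)

/-- The radial inverse Laplacian in the variable `a = |x|²`, vanishing at the origin. -/
noncomputable def radInv (ν : ℝ) (h : ℝ → E) (a : ℝ) : E :=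
  (1 / 4 : ℝ) • ∫ b in (0 : ℝ)..a, wavg ν h b

variable {ν : ℝ} {h : ℝ → E}

lemma continuous_wavg (hν : 0 ≤ ν) (hh : Continuous h) : Continuous (wavg ν h) := by
  unfold wavg
  apply intervalIntegral.continuous_parametric_intervalIntegral_of_continuous (s := fun _ => 1)
  · have : Continuous fun θ : ℝ => θ ^ ν := Real.continuous_rpow_const hν
    simp only [Function.uncurry_def]
    fun_prop
  · exact continuous_const

lemma rpow_smul_wavg {a : ℝ} (ha : 0 < a) :
    a ^ (ν + 1) • wavg ν h a = ∫ b in (0 : ℝ)..a, b ^ ν • h b := by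
  have key := intervalIntegral.smul_integral_comp_mul_left (a := 0) (b := 1)
    (fun b => b ^ ν • h b) a
  simp only [mul_zero, mul_one] at key
  rw [← key, wavg, Real.rpow_add_one ha.ne', mul_comm, mul_smul, ← intervalIntegral.integral_smul]
  congr 1
  refine intervalIntegral.integral_congr fun θ hθ => ?_
  rw [uIcc_of_le zero_le_one] at hθ
  simp only [Real.mul_rpow ha.le hθ.1, mul_smul]

lemma rpow_smul_wavg' {a : ℝ} (hν : 0 ≤ ν) (ha : 0 ≤ a) :
    a ^ (ν + 1) • wavg ν h a = ∫ b in (0 : ℝ)..a, b ^ ν • h b := by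
  rcases ha.eq_or_lt with rfl | ha
  · simp [Real.zero_rpow (by positivity : ν + 1 ≠ 0)]
  · exact rpow_smul_wavg ha

lemma wavg_zero [CompleteSpace E] (hν : 0 ≤ ν) : wavg ν h 0 = (1 / (ν + 1)) • h 0 := by
  simp only [wavg, zero_mul]
  rw [intervalIntegral.integral_smul_const, integral_rpow (Or.inl (by linarith)), Real.one_rpow,
    Real.zero_rpow (by positivity : ν + 1 ≠ 0), sub_zero]

lemma radInv_zero : radInv ν h 0 = 0 := by simp [radInv]

lemma norm_wavg_le {e c a : ℝ} (hν : 1 / 2 ≤ ν) (he : 0 ≤ e) (he' : e < 3 / 2) (ha : 0 ≤ a)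
    (hc : 0 ≤ c) (hb : ∀ b ∈ Icc 0 a, ‖h b‖ ≤ c * (1 + b) ^ (-e)) :
    ‖wavg ν h a‖ ≤ c * (1 / (3 / 2 - e)) * (1 + a) ^ (-e) := by
  have h1 : ‖wavg ν h a‖ ≤ ∫ θ in (0 : ℝ)..1, c * (1 + a) ^ (-e) * θ ^ (1 / 2 - e) := by
    refine intervalIntegral.norm_integral_le_of_norm_le zero_le_one
      (ae_of_all _ fun θ hθ => ?_)
      ((intervalIntegral.intervalIntegrable_rpow' (by linarith)).const_mul _)
    have hθ0 := hθ.1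
    have hθ1 := hθ.2
    have h2 : (1 + a * θ) ^ (-e) ≤ (θ * (1 + a)) ^ (-e) :=
      Real.rpow_le_rpow_of_nonpos (by positivity) (by nlinarith) (by linarith)
    have h3 : θ ^ ν ≤ θ ^ (1 / 2 : ℝ) := Real.rpow_le_rpow_of_exponent_ge hθ0 hθ1 hν
    rw [norm_smul, Real.norm_of_nonneg (by positivity)]
    calc θ ^ ν * ‖h (a * θ)‖
        ≤ θ ^ (1 / 2 : ℝ) * (c * (θ * (1 + a)) ^ (-e)) := by
          gcongr
          exact (hb _ ⟨by positivity, by nlinarith⟩).trans (by gcongr)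
      _ = c * (1 + a) ^ (-e) * θ ^ (1 / 2 - e) := by
          rw [Real.mul_rpow hθ0.le (by positivity), sub_eq_add_neg, Real.rpow_add hθ0]
          ring
  refine h1.trans_eq ?_
  rw [intervalIntegral.integral_const_mul, integral_rpow (Or.inl (by linarith)), Real.one_rpow,
    Real.zero_rpow (by linarith)]
  rw [show (1 / 2 - e + 1) = 3 / 2 - e by ring]
  ring

variable [CompleteSpace E]

lemma hasDerivAt_radInv (hν : 0 ≤ ν) (hh : Continuous h) (a : ℝ) :
    HasDerivAt (radInv ν h) ((1 / 4 : ℝ) • wavg ν h a) a :=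
  ((continuous_wavg hν hh).integral_hasStrictDerivAt 0 a).hasDerivAt.const_smul _

lemma continuous_radInv (hν : 0 ≤ ν) (hh : Continuous h) : Continuous (radInv ν h) :=
  continuous_iff_continuousAt.2 fun a => (hasDerivAt_radInv hν hh a).continuousAt

lemma hasDerivAt_integral_rpow_smul (hν : 0 ≤ ν) (hh : Continuous h) (a : ℝ) :
    HasDerivAt (fun a => ∫ b in (0 : ℝ)..a, b ^ ν • h b) (a ^ ν • h a) a := by
  have : Continuous fun b => b ^ ν • h b := (Real.continuous_rpow_const hν).smul hh
  exact (this.integral_hasStrictDerivAt 0 a).hasDerivAt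

lemma hasDerivAt_wavg (hν : 0 ≤ ν) (hh : Continuous h) {a : ℝ} (ha : 0 < a) :
    HasDerivAt (wavg ν h) (a⁻¹ • (h a - (ν + 1) • wavg ν h a)) a := by
  have h1 := hasDerivAt_integral_rpow_smul hν hh a
  have h2 : HasDerivAt (fun a : ℝ => a ^ (-(ν + 1))) _ a :=
    Real.hasDerivAt_rpow_const (Or.inl ha.ne')
  have h3 := h2.smul h1
  have h4 : wavg ν h =ᶠ[𝓝 a]
      ((fun a : ℝ => a ^ (-(ν + 1))) • fun a => ∫ b in (0 : ℝ)..a, b ^ ν • h b) := by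
    filter_upwards [lt_mem_nhds ha] with b hb
    simp only [Pi.smul_apply', ← rpow_smul_wavg hb, smul_smul]
    rw [← Real.rpow_add hb]; simp
  refine (h3.congr_of_eventuallyEq h4).congr_deriv ?_
  rw [← rpow_smul_wavg ha, smul_smul, smul_smul, mul_assoc, ← Real.rpow_add ha,
    ← Real.rpow_add ha, smul_sub, smul_smul,
    show -(ν + 1) + ν = -1 by ring, show -(ν + 1) - 1 + (ν + 1) = -1 by ring,
    Real.rpow_neg_one]
  simp only [neg_mul, neg_smul, sub_eq_add_neg]
  congr 3
  ring

end Averages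

lemma continuous_smul_add_inv_norm_sq_smul {V W : Type*} [NormedAddCommGroup V] [NormedAddCommGroup W] [NormedSpace ℝ W]
    {α δ : V → ℝ} {A : W} {B : V → W} (hα : Continuous α) (hδ : Continuous δ) (hδ0 : δ 0 = 0)
    (hB : Continuous B) (hB' : ∀ x, ‖B x‖ = ‖x‖ ^ 2) :
    Continuous fun x => α x • A + ((‖x‖ ^ 2)⁻¹ * δ x) • B x := by
  refine (hα.smul continuous_const).add (continuous_iff_continuousAt.2 fun x => ?_)
  by_cases hx : x = 0
  · subst hx
    have h0 : Tendsto (fun x => ‖δ x‖) (𝓝 0) (𝓝 0) := by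
      simpa [hδ0] using hδ.norm.tendsto 0
    simp only [ContinuousAt, hδ0, mul_zero, zero_smul]
    refine squeeze_zero_norm (fun x => ?_) h0
    rw [norm_smul, hB', norm_mul, norm_inv, norm_pow, norm_norm]
    by_cases hx : x = 0
    · simp [hx]
    · have : ‖x‖ ≠ 0 := by simpa using hx
      apply le_of_eq
      field_simp
  · refine ContinuousAt.smul (ContinuousAt.mul (ContinuousAt.inv₀ (by fun_prop) ?_)
      hδ.continuousAt) hB.continuousAt
    simpa using hx

section Laplacian

variable {V : Type*} [NormedAddCommGroup V] [InnerProductSpace ℝ V] {ν : ℝ} {q : ℝ → ℝ}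

/-- The inner product as a continuous bilinear map. -/
noncomputable def innerL : V →L[ℝ] V →L[ℝ] ℝ :=
  innerSL ℝ

lemma innerL_apply_apply (x y : V) : innerL x y = inner ℝ x y := rfl

lemma norm_innerL_apply (x : V) : ‖innerL x‖ = ‖x‖ :=
  innerSL_apply_norm ℝ x

lemma hasFDerivAt_norm_sq (x : V) :
    HasFDerivAt (fun x => ‖x‖ ^ 2) ((2 : ℝ) • innerL x) x := by
  refine (hasStrictFDerivAt_norm_sq x).hasFDerivAt.congr_fderiv ?_
  rw [two_smul, two_smul]
  rfl

lemma hasFDerivAt_radInv_norm_sq (hν : 0 ≤ ν) (hq : Continuous q) (c : ℝ)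
    (x : V) :
    HasFDerivAt (fun x : V => c + radInv ν q (‖x‖ ^ 2))
      ((1 / 2 * wavg ν q (‖x‖ ^ 2)) • innerL x) x := by
  have h := ((hasDerivAt_radInv hν hq (‖x‖ ^ 2)).comp_hasFDerivAt x
    (hasFDerivAt_norm_sq x)).const_add c
  refine h.congr_fderiv ?_
  rw [smul_smul, smul_eq_mul]
  congr 1
  ring

lemma hasFDerivAt_smul_apply_zero {F G : Type*} [NormedAddCommGroup F] [NormedSpace ℝ F]
    [NormedAddCommGroup G] [NormedSpace ℝ G] {c : F → ℝ} (hc : ContinuousAt c 0) (L : F →L[ℝ] G) :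
    HasFDerivAt (fun x => c x • L x) (c 0 • L) 0 := by
  rw [hasFDerivAt_iff_isLittleO]
  have h1 : (fun x => c x - c 0) =o[𝓝 0] (fun _ => (1 : ℝ)) := by
    rw [Asymptotics.isLittleO_one_iff]
    simpa using hc.sub_const (c 0)
  have h2 := h1.smul_isBigO (L.isBigO_id (𝓝 0))
  simpa [sub_smul] using h2

/-- The Hessian of a radial function with Laplacian `q (‖x‖ ^ 2)`. -/
noncomputable def radHess (ν : ℝ) (q : ℝ → ℝ) (x : V) :
    V →L[ℝ] V →L[ℝ] ℝ :=
  (1 / 2 * wavg ν q (‖x‖ ^ 2)) • innerL +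
    ((‖x‖ ^ 2)⁻¹ * (q (‖x‖ ^ 2) - (ν + 1) * wavg ν q (‖x‖ ^ 2))) •
      (innerL x).smulRight (innerL x)

lemma hasFDerivAt_radGrad (hν : 0 ≤ ν) (hq : Continuous q) (x : V) :
    HasFDerivAt (fun x : V =>
      (1 / 2 * wavg ν q (‖x‖ ^ 2)) • innerL x) (radHess ν q x) x := by
  by_cases hx : x = 0
  · subst hx
    have hc : Continuous fun x : V => 1 / 2 * wavg ν q (‖x‖ ^ 2) := by
      have := continuous_wavg hν hq
      fun_prop
    refine (hasFDerivAt_smul_apply_zero hc.continuousAt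
      (innerL (V := V))).congr_fderiv ?_
    ext y z
    simp [radHess]
  · have hx' : 0 < ‖x‖ ^ 2 := by positivity
    have h1 := ((hasDerivAt_wavg hν hq hx').comp_hasFDerivAt x
      (hasFDerivAt_norm_sq x)).const_mul (1 / 2)
    have h2 := h1.smul (innerL (V := V)).hasFDerivAt (x := x)
    refine h2.congr_fderiv ?_
    ext y z
    simp [radHess]
    ring

lemma continuous_radHess (hν : 0 ≤ ν) (hq : Continuous q) :
    Continuous (radHess ν q : V → V →L[ℝ] V →L[ℝ] ℝ) := by
  have hk := continuous_wavg hν hq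
  have hα : Continuous fun x : V => 1 / 2 * wavg ν q (‖x‖ ^ 2) := by fun_prop
  have hδ : Continuous fun x : V => q (‖x‖ ^ 2) - (ν + 1) * wavg ν q (‖x‖ ^ 2) := by fun_prop
  refine continuous_smul_add_inv_norm_sq_smul (W := V →L[ℝ] V →L[ℝ] ℝ) (A := innerL)
    (B := fun x => (innerL x).smulRight (innerL x)) hα hδ ?_ ?_ fun x => ?_
  · simp only [norm_zero, ne_eq, OfNat.ofNat_ne_zero, not_false_eq_true, zero_pow, wavg_zero hν,
      smul_eq_mul]
    field_simp
    ring
  · exact ((ContinuousLinearMap.smulRightL ℝ V (V →L[ℝ] ℝ)).continuous.comp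
      innerL.continuous).clm_apply innerL.continuous
  · rw [ContinuousLinearMap.norm_smulRight_apply, norm_innerL_apply, sq]

lemma fderiv_radInv_norm_sq (hν : 0 ≤ ν) (hq : Continuous q) (c : ℝ) :
    fderiv ℝ (fun x : V => c + radInv ν q (‖x‖ ^ 2)) =
      fun x => (1 / 2 * wavg ν q (‖x‖ ^ 2)) • innerL x :=
  funext fun x => (hasFDerivAt_radInv_norm_sq hν hq c x).fderiv

lemma contDiff_radInv_norm_sq (hν : 0 ≤ ν) (hq : Continuous q) (c : ℝ) :
    ContDiff ℝ 2 (fun x : V => c + radInv ν q (‖x‖ ^ 2)) := by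
  rw [show (2 : WithTop ℕ∞) = 1 + 1 from one_add_one_eq_two.symm, contDiff_succ_iff_fderiv]
  refine ⟨fun x => (hasFDerivAt_radInv_norm_sq hν hq c x).differentiableAt, by simp, ?_⟩
  rw [fderiv_radInv_norm_sq hν hq, contDiff_one_iff_hasFDerivAt]
  exact ⟨_, continuous_radHess hν hq, hasFDerivAt_radGrad hν hq⟩

lemma sum_pd_pd_radInv_norm_sq {d : ℕ} (hν : 0 ≤ ν) (hd : (d : ℝ) / 2 = ν + 1) (hq : Continuous q) (c : ℝ)
    (x : EuclideanSpace ℝ (Fin d)) :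
    ∑ i, pd i (pd i (fun x : EuclideanSpace ℝ (Fin d) => c + radInv ν q (‖x‖ ^ 2))) x =
      q (‖x‖ ^ 2) := by
  have h1 (i : Fin d) : pd i (pd i (fun x : EuclideanSpace ℝ (Fin d) =>
      c + radInv ν q (‖x‖ ^ 2))) x =
      radHess ν q x (EuclideanSpace.single i 1) (EuclideanSpace.single i 1) := by
    unfold pd
    rw [fderiv_radInv_norm_sq hν hq]
    rw [((hasFDerivAt_radGrad hν hq x).clm_apply
      (hasFDerivAt_const (EuclideanSpace.single i 1) x)).fderiv]
    simp
  have h2 : ∑ i, x i * x i = ‖x‖ ^ 2 := by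
    simp [EuclideanSpace.norm_sq_eq, pow_two (x _)]
  simp only [h1, radHess]
  simp only [add_apply, smul_apply, innerL_apply_apply,
    ContinuousLinearMap.smulRight_apply, EuclideanSpace.inner_single_right, smul_eq_mul]
  simp [Finset.sum_add_distrib, ← Finset.mul_sum, h2]
  by_cases hx : x = 0
  · subst hx
    simp only [norm_zero]
    norm_num
    rw [wavg_zero hν, smul_eq_mul]
    field_simp
    linear_combination 2 * q 0 * hd
  · have : ‖x‖ ≠ 0 := by simpa using hx
    field_simp
    linear_combination 2 * wavg ν q (‖x‖ ^ 2) * hd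

end Laplacian

lemma isUnit_one_sub_smul_of_norm_pow_le {R : Type*} [NormedRing R] [NormedAlgebra ℂ R]
    [CompleteSpace R] {T : R} {A : ℝ} (hT : ∀ n : ℕ, ‖T ^ n‖ ≤ A ^ n / n.factorial) (z : ℂ) :
    IsUnit (1 - z • T) := by
  have h := FloorSemiring.tendsto_pow_div_factorial_atTop (‖z‖ * A)
  obtain ⟨n, hn⟩ := (h.eventually (gt_mem_nhds zero_lt_one)).exists
  have h1 : ‖(z • T) ^ n‖ < 1 := by
    refine lt_of_le_of_lt ?_ hn
    rw [smul_pow, norm_smul, norm_pow, mul_pow, mul_div_assoc]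
    have := hT n
    gcongr
  have h2 := isUnit_one_sub_of_norm_lt_one h1
  have h3 : Commute (1 - z • T) (∑ i ∈ Finset.range n, (z • T) ^ i) := by
    rw [Commute, SemiconjBy, mul_neg_geom_sum, geom_sum_mul_neg]
  rw [← mul_neg_geom_sum] at h2
  exact (h3.isUnit_mul_iff.1 h2).1

lemma continuous_inverse_one_sub_smul {R : Type*} [NormedRing R] [NormedAlgebra ℂ R]
    [CompleteSpace R] {T : R} (hT : ∀ z : ℂ, IsUnit (1 - z • T)) :
    Continuous fun z : ℂ => Ring.inverse (1 - z • T) := by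
  refine continuous_iff_continuousAt.2 fun z => ?_
  have h1 := NormedRing.inverse_continuousAt (hT z).unit
  have h2 : Continuous fun z : ℂ => 1 - z • T := by fun_prop
  exact ContinuousAt.comp (f := fun z : ℂ => 1 - z • T) (g := Ring.inverse) h1 h2.continuousAt

/-- The resolvent of a quasinilpotent operator `T` applied to a vector `w`. -/
lemma exists_resolvent {Y : Type*} [NormedAddCommGroup Y] [NormedSpace ℂ Y] [CompleteSpace Y]
    {T : Y →L[ℂ] Y} {A : ℝ} (hT : ∀ n : ℕ, ‖T ^ n‖ ≤ A ^ n / n.factorial) (w : Y) :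
    ∃ u : ℂ → Y, Continuous u ∧ ∀ z, u z = w + z • T (u z) := by
  have hu := isUnit_one_sub_smul_of_norm_pow_le hT
  refine ⟨fun z => Ring.inverse (1 - z • T) w,
    (continuous_inverse_one_sub_smul hu).clm_apply continuous_const, fun z => ?_⟩
  have h := congrArg (fun L : Y →L[ℂ] Y => L w) (Ring.mul_inverse_cancel _ (hu z))
  simp only [mul_apply_eq_comp, one_apply_eq_self] at h
  rw [sub_apply] at h
  simpa [sub_eq_iff_eq_add] using h

section Operator

open scoped NNReal BoundedContinuousFunction

variable {ν m : ℝ}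

/-- The reciprocal of the diffusion coefficient, as a function of `a = |x|²`. -/
noncomputable def rho (m a : ℝ) : ℝ := (1 + √a) ^ (-m)

/-- A decay exponent in `(1, 3/2)` for `rho m`, when `m > 2`. -/
noncomputable def decayExp (m : ℝ) : ℝ := min (m / 2) (5 / 4)

/-- An upper bound for the radial inverse Laplacian of `rho m`. -/
noncomputable def totalMass (m : ℝ) : ℝ := 1 / (4 * (3 / 2 - decayExp m) * (decayExp m - 1))

/-- A bounded increasing majorant for the radial inverse Laplacian of `rho m`. -/
noncomputable def majorant (m a : ℝ) : ℝ := totalMass m * (1 - (1 + a) ^ (1 - decayExp m))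

lemma one_lt_decayExp (hm : 2 < m) : 1 < decayExp m := by
  unfold decayExp
  rw [lt_min_iff]
  constructor <;> linarith

lemma decayExp_lt : decayExp m < 3 / 2 := (min_le_right _ _).trans_lt (by norm_num)

lemma totalMass_pos (hm : 2 < m) : 0 < totalMass m := by
  have := one_lt_decayExp hm
  have := decayExp_lt (m := m)
  unfold totalMass
  have : 0 < 3 / 2 - decayExp m := by linarith
  have : 0 < decayExp m - 1 := by linarith
  positivity

lemma continuous_rho : Continuous (rho m) := by
  unfold rho
  exact Continuous.rpow_const (by fun_prop) fun a => Or.inl (by positivity)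

lemma rho_pos (a : ℝ) : 0 < rho m a := by unfold rho; positivity

lemma rho_le (hm : 2 < m) {a : ℝ} (ha : 0 ≤ a) : rho m a ≤ (1 + a) ^ (-decayExp m) := by
  have hs := Real.sq_sqrt ha
  have hs0 := Real.sqrt_nonneg a
  have he : 2 * decayExp m ≤ m := by
    have : decayExp m ≤ m / 2 := min_le_left _ _
    linarith
  have he0 := one_lt_decayExp hm
  calc rho m a ≤ (1 + √a) ^ (2 * -decayExp m) :=
        Real.rpow_le_rpow_of_exponent_le (by linarith) (by linarith)
    _ = ((1 + √a) ^ (2 : ℝ)) ^ (-decayExp m) := Real.rpow_mul (by positivity) _ _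
    _ ≤ (1 + a) ^ (-decayExp m) := by
        refine Real.rpow_le_rpow_of_nonpos (by positivity) ?_ (by linarith)
        rw [Real.rpow_two]
        nlinarith

lemma hasDerivAt_majorant (hm : 2 < m) {a : ℝ} (ha : 0 ≤ a) :
    HasDerivAt (majorant m)
      (1 / 4 * (1 / (3 / 2 - decayExp m)) * (1 + a) ^ (-decayExp m)) a := by
  have h1 : HasDerivAt (fun a : ℝ => 1 + a) 1 a := (hasDerivAt_id a).const_add 1
  have h2 := ((h1.rpow_const (p := 1 - decayExp m) (Or.inl (by positivity))).const_sub 1).const_mul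
    (totalMass m)
  refine h2.congr_deriv ?_
  have := one_lt_decayExp hm
  have := decayExp_lt (m := m)
  have : 3 / 2 - decayExp m ≠ 0 := by linarith
  have : decayExp m - 1 ≠ 0 := by linarith
  rw [show 1 - decayExp m - 1 = -decayExp m by ring, totalMass]
  have : 3 - 2 * decayExp m ≠ 0 := by linarith
  field_simp
  ring

lemma majorant_zero : majorant m 0 = 0 := by simp [majorant]

lemma monotoneOn_majorant (hm : 2 < m) : MonotoneOn (majorant m) (Ici 0) := by
  intro a ha b hb hab
  have := one_lt_decayExp hm
  have := totalMass_pos hm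
  have ha : 0 ≤ a := ha
  have h : (1 + b) ^ (1 - decayExp m) ≤ (1 + a) ^ (1 - decayExp m) :=
    Real.rpow_le_rpow_of_nonpos (by positivity) (by linarith) (by linarith)
  unfold majorant
  gcongr

lemma majorant_nonneg (hm : 2 < m) {a : ℝ} (ha : 0 ≤ a) : 0 ≤ majorant m a :=
  majorant_zero.symm.trans_le (monotoneOn_majorant hm self_mem_Ici ha ha)

lemma majorant_le (hm : 2 < m) {a : ℝ} (ha : 0 ≤ a) : majorant m a ≤ totalMass m := by
  have h1 := totalMass_pos hm
  have h2 : 0 ≤ (1 + a) ^ (1 - decayExp m) := by positivity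
  unfold majorant
  nlinarith

lemma norm_radInv_le {h : ℝ → ℂ} (hν : 1 / 2 ≤ ν) (hm : 2 < m) (hh : Continuous h) {c : ℝ}
    (hc : 0 ≤ c) (n : ℕ)
    (hb : ∀ b, 0 ≤ b → ‖h b‖ ≤ c * (majorant m b ^ n / n.factorial) * (1 + b) ^ (-decayExp m))
    {a : ℝ} (ha : 0 ≤ a) :
    ‖radInv ν h a‖ ≤ c * (majorant m a ^ (n + 1) / (n + 1).factorial) := by
  have he0 := one_lt_decayExp hm
  have he1 := decayExp_lt (m := m)
  have hν0 : 0 ≤ ν := by linarith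
  have hB (b : ℝ) (hb : b ∈ Icc 0 a) := (((hasDerivAt_majorant hm hb.1).pow (n + 1)).div_const
    ((n + 1).factorial : ℝ)).const_mul c
  refine image_norm_le_of_norm_deriv_right_le_deriv_boundary' (a := 0) (b := a)
    (f' := fun b => (1 / 4 : ℝ) • wavg ν h b)
    (continuous_radInv hν0 hh).continuousOn
    (fun b _ => (hasDerivAt_radInv hν0 hh b).hasDerivWithinAt) (by simp [radInv_zero, majorant_zero])
    (fun b hb => (hB b hb).continuousAt.continuousWithinAt)
    (fun b hb => (hB b (Ico_subset_Icc_self hb)).hasDerivWithinAt) ?_ ⟨ha, le_rfl⟩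
  intro b hb0
  have h1 := norm_wavg_le hν (by linarith) he1 hb0.1
    (c := c * (majorant m b ^ n / n.factorial)) (by have := majorant_nonneg hm hb0.1; positivity)
    (fun s hs => (hb s hs.1).trans (by
      have h1 := monotoneOn_majorant hm hs.1 hb0.1 hs.2
      have h2 := majorant_nonneg hm hs.1
      have h3 : 0 ≤ 1 + s := by linarith [hs.1]
      gcongr))
  rw [norm_smul, Real.norm_of_nonneg (by norm_num)]
  refine (mul_le_mul_of_nonneg_left h1 (by norm_num)).trans_eq ?_
  rw [Nat.factorial_succ, Nat.add_sub_cancel]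
  push_cast
  field_simp

lemma norm_radInv_sub_le {h : ℝ → ℂ} (hν : 1 / 2 ≤ ν) (hm : 2 < m) (hh : Continuous h) {c : ℝ}
    (hc : 0 ≤ c) (hb : ∀ b, 0 ≤ b → ‖h b‖ ≤ c * (1 + b) ^ (-decayExp m)) {a b : ℝ} (ha : 0 ≤ a)
    (hab : a ≤ b) :
    ‖radInv ν h b - radInv ν h a‖ ≤ c * (majorant m b - majorant m a) := by
  have he0 := one_lt_decayExp hm
  have he1 := decayExp_lt (m := m)
  have hν0 : 0 ≤ ν := by linarith
  have hB (s : ℝ) (hs : s ∈ Icc a b) := ((hasDerivAt_majorant hm (ha.trans hs.1)).sub_const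
    (majorant m a)).const_mul c
  refine image_norm_le_of_norm_deriv_right_le_deriv_boundary' (a := a) (b := b)
    (f := fun s => radInv ν h s - radInv ν h a)
    (f' := fun b => (1 / 4 : ℝ) • wavg ν h b)
    ((continuous_radInv hν0 hh).sub continuous_const).continuousOn
    (fun b _ => ((hasDerivAt_radInv hν0 hh b).sub_const _).hasDerivWithinAt) (by simp)
    (fun b hb => (hB b hb).continuousAt.continuousWithinAt)
    (fun b hb => (hB b (Ico_subset_Icc_self hb)).hasDerivWithinAt) ?_ ⟨hab, le_rfl⟩
  intro s hs
  have h1 := norm_wavg_le hν (by linarith) he1 (ha.trans hs.1) hc (fun s hs => hb s hs.1)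
  rw [norm_smul, Real.norm_of_nonneg (by norm_num)]
  refine (mul_le_mul_of_nonneg_left h1 (by norm_num)).trans_eq ?_
  ring

/-- The function `rho m * q`, with `q` extended to the real line by a constant. -/
noncomputable def weighted (m : ℝ) (q : ℝ≥0 →ᵇ ℂ) (a : ℝ) : ℂ := rho m a • q a.toNNReal

lemma continuous_weighted (q : ℝ≥0 →ᵇ ℂ) : Continuous (weighted m q) :=
  continuous_rho.smul (q.continuous.comp continuous_real_toNNReal)

lemma norm_weighted_le (hm : 2 < m) (q : ℝ≥0 →ᵇ ℂ) {a c : ℝ} (ha : 0 ≤ a)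
    (hc : ‖q a.toNNReal‖ ≤ c) : ‖weighted m q a‖ ≤ c * (1 + a) ^ (-decayExp m) := by
  rw [weighted, norm_smul, Real.norm_of_nonneg (rho_pos a).le, mul_comm]
  exact mul_le_mul hc (rho_le hm ha) (rho_pos a).le ((norm_nonneg _).trans hc)

lemma wavg_weighted_add (hν : 0 ≤ ν) (q r : ℝ≥0 →ᵇ ℂ) (a : ℝ) :
    wavg ν (weighted m (q + r)) a = wavg ν (weighted m q) a + wavg ν (weighted m r) a := by
  have hi (q : ℝ≥0 →ᵇ ℂ) :
      IntervalIntegrable (fun θ => θ ^ ν • weighted m q (a * θ)) volume 0 1 :=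
    ((Real.continuous_rpow_const hν).smul
      ((continuous_weighted q).comp (continuous_const.mul continuous_id))).intervalIntegrable _ _
  simp only [wavg]
  rw [← intervalIntegral.integral_add (hi q) (hi r)]
  simp [weighted, smul_add]

lemma wavg_weighted_smul (c : ℂ) (q : ℝ≥0 →ᵇ ℂ) (a : ℝ) :
    wavg ν (weighted m (c • q)) a = c • wavg ν (weighted m q) a := by
  simp only [wavg]
  rw [← intervalIntegral.integral_smul]
  refine intervalIntegral.integral_congr fun θ _ => ?_
  simp only [weighted, BoundedContinuousFunction.coe_smul, smul_comm c]

lemma norm_radInv_weighted_le (hν : 1 / 2 ≤ ν) (hm : 2 < m) (q : ℝ≥0 →ᵇ ℂ) {c : ℝ} (hc : 0 ≤ c)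
    (n : ℕ) (hb : ∀ a : ℝ≥0, ‖q a‖ ≤ c * (majorant m a ^ n / n.factorial)) {a : ℝ} (ha : 0 ≤ a) :
    ‖radInv ν (weighted m q) a‖ ≤ c * (majorant m a ^ (n + 1) / (n + 1).factorial) :=
  norm_radInv_le hν hm (continuous_weighted q) hc n
    (fun b hb0 => norm_weighted_le hm q hb0 (by simpa [hb0] using hb b.toNNReal)) ha

lemma norm_radInv_weighted_le_totalMass (hν : 1 / 2 ≤ ν) (hm : 2 < m) (q : ℝ≥0 →ᵇ ℂ) (a : ℝ≥0) :
    ‖radInv ν (weighted m q) a‖ ≤ ‖q‖ * totalMass m := by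
  refine (norm_radInv_weighted_le hν hm q (norm_nonneg q) 0
    (fun a => by simpa using q.norm_coe_le_norm a) a.2).trans ?_
  have := majorant_le hm a.2
  simp only [zero_add, pow_one, Nat.factorial_one, Nat.cast_one, div_one]
  gcongr

/-- The inverse of `(1 + |x|) ^ m Δ` on radial functions, vanishing at the origin. -/
noncomputable def greenOp (hν : 1 / 2 ≤ ν) (hm : 2 < m) : (ℝ≥0 →ᵇ ℂ) →L[ℂ] (ℝ≥0 →ᵇ ℂ) :=
  LinearMap.mkContinuous
    { toFun := fun q => BoundedContinuousFunction.ofNormedAddCommGroup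
        (fun a : ℝ≥0 => radInv ν (weighted m q) a)
        ((continuous_radInv (by linarith) (continuous_weighted q)).comp NNReal.continuous_coe)
        (‖q‖ * totalMass m) (norm_radInv_weighted_le_totalMass hν hm q)
      map_add' := fun q r => by
        have hν0 : 0 ≤ ν := by linarith
        ext a
        have hi (q : ℝ≥0 →ᵇ ℂ) : IntervalIntegrable (wavg ν (weighted m q)) volume 0 a :=
          (continuous_wavg hν0 (continuous_weighted q)).intervalIntegrable _ _
        change radInv ν (weighted m (q + r)) a =
          radInv ν (weighted m q) a + radInv ν (weighted m r) a
        simp only [radInv, wavg_weighted_add hν0]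
        rw [intervalIntegral.integral_add (hi q) (hi r), smul_add]
      map_smul' := fun c q => by
        ext a
        change radInv ν (weighted m (c • q)) a = c • radInv ν (weighted m q) a
        simp only [radInv, wavg_weighted_smul]
        rw [intervalIntegral.integral_smul, smul_comm] }
    (totalMass m) (fun q => (BoundedContinuousFunction.norm_ofNormedAddCommGroup_le _
      (mul_nonneg (norm_nonneg _) (totalMass_pos hm).le)
      (norm_radInv_weighted_le_totalMass hν hm q)).trans_eq (mul_comm _ _))

lemma greenOp_apply (hν : 1 / 2 ≤ ν) (hm : 2 < m) (q : ℝ≥0 →ᵇ ℂ) (a : ℝ≥0) :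
    greenOp hν hm q a = radInv ν (weighted m q) a := rfl

lemma norm_greenOp_pow_apply_le (hν : 1 / 2 ≤ ν) (hm : 2 < m) (q : ℝ≥0 →ᵇ ℂ) (n : ℕ) (a : ℝ≥0) :
    ‖((greenOp hν hm) ^ n) q a‖ ≤ ‖q‖ * (majorant m a ^ n / n.factorial) := by
  induction n generalizing a with
  | zero => simpa using q.norm_coe_le_norm a
  | succ n ih =>
    rw [pow_succ', mul_apply_eq_comp, greenOp_apply]
    exact norm_radInv_weighted_le hν hm _ (norm_nonneg q) n ih a.2

lemma norm_greenOp_pow_le (hν : 1 / 2 ≤ ν) (hm : 2 < m) (n : ℕ) :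
    ‖(greenOp hν hm) ^ n‖ ≤ totalMass m ^ n / n.factorial := by
  have h0 := totalMass_pos hm
  refine ContinuousLinearMap.opNorm_le_bound _ (by positivity) fun q => ?_
  refine (BoundedContinuousFunction.norm_le (by positivity)).2 fun a => ?_
  refine (norm_greenOp_pow_apply_le hν hm q n a).trans ?_
  rw [mul_comm]
  have := majorant_nonneg hm a.2
  have := majorant_le hm a.2
  gcongr
  exact this

lemma norm_greenOp_sub_le (hν : 1 / 2 ≤ ν) (hm : 2 < m) (q : ℝ≥0 →ᵇ ℂ) {a b : ℝ≥0} (hab : a ≤ b) :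
    ‖greenOp hν hm q b - greenOp hν hm q a‖ ≤ ‖q‖ * (totalMass m - majorant m a) := by
  refine (norm_radInv_sub_le hν hm (continuous_weighted q) (norm_nonneg q)
    (fun b hb => norm_weighted_le hm q hb (q.norm_coe_le_norm _)) a.2 hab).trans ?_
  exact mul_le_mul_of_nonneg_left (sub_le_sub_right (majorant_le hm b.2) _) (norm_nonneg q)

lemma tendsto_totalMass_sub_majorant (hm : 2 < m) :
    Tendsto (fun a => totalMass m - majorant m a) atTop (𝓝 0) := by
  have h1 := one_lt_decayExp hm
  have h2 := (tendsto_rpow_neg_atTop (y := decayExp m - 1) (by linarith)).comp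
    (tendsto_atTop_add_const_left atTop (1 : ℝ) tendsto_id)
  have h3 := h2.const_mul (totalMass m)
  rw [mul_zero] at h3
  refine h3.congr fun a => ?_
  simp only [Function.comp, id, majorant, neg_sub]
  ring

lemma exists_greenLim (hν : 1 / 2 ≤ ν) (hm : 2 < m) :
    ∃ L : (ℝ≥0 →ᵇ ℂ) →L[ℂ] ℂ,
      ∀ q, Tendsto (fun n : ℕ => greenOp hν hm q n) atTop (𝓝 (L q)) := by
  have h1 (q : ℝ≥0 →ᵇ ℂ) : ∃ l, Tendsto (fun n : ℕ => greenOp hν hm q n) atTop (𝓝 l) := by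
    refine cauchySeq_tendsto_of_complete (cauchySeq_of_le_tendsto_0'
      (fun n : ℕ => ‖q‖ * (totalMass m - majorant m n)) (fun n k hnk => ?_) ?_)
    · rw [dist_comm, dist_eq_norm]
      exact norm_greenOp_sub_le hν hm q (Nat.cast_le.2 hnk)
    · simpa using ((tendsto_totalMass_sub_majorant hm).comp tendsto_natCast_atTop_atTop).const_mul ‖q‖
  choose L hL using h1
  exact ⟨continuousLinearMapOfTendsto (fun n : ℕ =>
    (BoundedContinuousFunction.evalCLM ℂ (n : ℝ≥0)).comp (greenOp hν hm)) (f := L)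
    (tendsto_pi_nhds.2 hL), hL⟩

/-- The limit at infinity of `greenOp`. -/
noncomputable def greenLim (hν : 1 / 2 ≤ ν) (hm : 2 < m) : (ℝ≥0 →ᵇ ℂ) →L[ℂ] ℂ :=
  (exists_greenLim hν hm).choose

lemma tendsto_greenLim (hν : 1 / 2 ≤ ν) (hm : 2 < m) (q : ℝ≥0 →ᵇ ℂ) :
    Tendsto (fun n : ℕ => greenOp hν hm q n) atTop (𝓝 (greenLim hν hm q)) :=
  (exists_greenLim hν hm).choose_spec q

lemma norm_greenLim_sub_le (hν : 1 / 2 ≤ ν) (hm : 2 < m) (q : ℝ≥0 →ᵇ ℂ) (a : ℝ≥0) :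
    ‖greenLim hν hm q - greenOp hν hm q a‖ ≤ ‖q‖ * (totalMass m - majorant m a) := by
  refine le_of_tendsto ((tendsto_greenLim hν hm q).sub_const _).norm ?_
  filter_upwards [eventually_ge_atTop ⌈a⌉₊] with n hn
  exact norm_greenOp_sub_le hν hm q ((Nat.le_ceil a).trans (Nat.cast_le.2 hn))

end Operator

section Resolvent

open scoped NNReal BoundedContinuousFunction ComplexConjugate

variable {ν : ℝ}

/-- A radial solution of `Δu = z p u` with `Re z ≥ 0` and `p ≥ 0` has increasing modulus. -/
lemma monotoneOn_norm_of_eq_radInv (hν : 0 ≤ ν) {z : ℂ} (hz : 0 ≤ z.re) {p : ℝ → ℝ} {U : ℝ → ℂ}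
    (hp0 : ∀ a, 0 ≤ p a) (hp : Continuous p) (hU : Continuous U)
    (h : ∀ a, 0 ≤ a → U a = 1 + z * radInv ν (fun b => p b • U b) a) :
    MonotoneOn (fun a => ‖U a‖ ^ 2) (Ici 0) := by
  set w : ℝ → ℂ := fun b => p b • U b with hw
  have hwc : Continuous w := hp.smul hU
  have hU' (a : ℝ) (ha : 0 < a) : HasDerivAt U (z * ((1 / 4 : ℝ) • wavg ν w a)) a := by
    refine (((hasDerivAt_radInv hν hwc a).const_mul z).const_add 1).congr_of_eventuallyEq ?_
    filter_upwards [lt_mem_nhds ha] with b hb using h b hb.le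
  set P : ℝ → ℂ := fun a => ∫ b in (0 : ℝ)..a, b ^ ν • w b with hPdef
  have hP (a : ℝ) : HasDerivAt P (a ^ ν • w a) a := hasDerivAt_integral_rpow_smul hν hwc a
  have hPa (a : ℝ) (ha : 0 ≤ a) : a ^ (ν + 1) • wavg ν w a = P a := rpow_smul_wavg' hν ha
  have hJ : MonotoneOn (fun a => (conj (U a) * (z * P a)).re) (Ici 0) := by
    have hPc : Continuous P := continuous_iff_continuousAt.2 fun a => (hP a).continuousAt
    refine monotoneOn_of_hasDerivWithinAt_nonneg (convex_Ici 0)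
      (Continuous.continuousOn (by fun_prop))
      (f' := fun a => (conj (z * ((1 / 4 : ℝ) • wavg ν w a)) * (z * P a) +
        conj (U a) * (z * (a ^ ν • w a))).re) (fun a ha => ?_) (fun a ha => ?_)
    · rw [interior_Ici] at ha
      have h1 : HasDerivAt (fun a => conj (U a)) (conj (z * ((1 / 4 : ℝ) • wavg ν w a))) a :=
        (hU' a ha).star
      have h2 := h1.mul ((hP a).const_mul z)
      exact (Complex.reCLM.hasFDerivAt.comp_hasDerivAt a h2).hasDerivWithinAt
    · rw [interior_Ici] at ha
      have ha : 0 < a := ha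
      rw [← hPa a ha.le]
      have e1 : conj (z * ((1 / 4 : ℝ) • wavg ν w a)) * (z * (a ^ (ν + 1) • wavg ν w a)) =
          ((1 / 4 * a ^ (ν + 1) * (Complex.normSq z * Complex.normSq (wavg ν w a)) : ℝ) : ℂ) := by
        simp only [Complex.real_smul, map_mul, Complex.conj_ofReal]
        push_cast
        rw [Complex.normSq_eq_conj_mul_self, Complex.normSq_eq_conj_mul_self]
        ring
      have e2 : conj (U a) * (z * (a ^ ν • w a)) =
          ((a ^ ν * p a * Complex.normSq (U a) : ℝ) : ℂ) * z := by
        simp only [hw, Complex.real_smul]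
        push_cast
        rw [Complex.normSq_eq_conj_mul_self]
        ring
      rw [e1, e2, Complex.add_re, Complex.ofReal_re, Complex.re_ofReal_mul]
      have := Complex.normSq_nonneg z
      have := Complex.normSq_nonneg (U a)
      have := Complex.normSq_nonneg (wavg ν w a)
      have := hp0 a
      positivity
  have hJ0 (a : ℝ) (ha : 0 ≤ a) : 0 ≤ (conj (U a) * (z * P a)).re := by
    simpa [hPdef] using hJ self_mem_Ici ha ha
  refine monotoneOn_of_hasDerivWithinAt_nonneg (convex_Ici 0)
    (Continuous.continuousOn (by fun_prop))
    (f' := fun a => 2 * inner ℝ (U a) (z * ((1 / 4 : ℝ) • wavg ν w a)))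
    (fun a ha => ?_) (fun a ha => ?_)
  · rw [interior_Ici] at ha
    exact (hU' a ha).norm_sq.hasDerivWithinAt
  · rw [interior_Ici] at ha
    have ha : 0 < a := ha
    have h1 := hJ0 a ha.le
    have h2 : 0 < a ^ (ν + 1) := by positivity
    rw [← hPa a ha.le] at h1
    have e : conj (U a) * (z * (a ^ (ν + 1) • wavg ν w a)) =
        ((4 * a ^ (ν + 1) : ℝ) : ℂ) * ((z * ((1 / 4 : ℝ) • wavg ν w a)) * conj (U a)) := by
      simp only [Complex.real_smul]
      push_cast
      ring
    rw [e, Complex.re_ofReal_mul] at h1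
    rw [Complex.inner]
    have := nonneg_of_mul_nonneg_right h1 (by positivity)
    linarith

variable {m : ℝ}

lemma norm_le_and_one_le_of_eq_greenOp (hν : 1 / 2 ≤ ν) (hm : 2 < m) {z : ℂ} (hz : 0 ≤ z.re)
    {u : ℝ≥0 →ᵇ ℂ} (h : u = 1 + z • greenOp hν hm u) :
    ‖u‖ ≤ ‖1 + z * greenLim hν hm u‖ ∧ 1 ≤ ‖1 + z * greenLim hν hm u‖ := by
  have hu (a : ℝ≥0) : u a = 1 + z * greenOp hν hm u a := by
    conv_lhs => rw [h]
    rfl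
  have hmono : MonotoneOn (fun a : ℝ => ‖u a.toNNReal‖ ^ 2) (Ici 0) := by
    refine monotoneOn_norm_of_eq_radInv (by linarith : 0 ≤ ν) hz (p := rho m) (fun a => (rho_pos a).le)
      continuous_rho (u.continuous.comp continuous_real_toNNReal) fun a ha => ?_
    rw [hu, greenOp_apply, Real.coe_toNNReal a ha]
    rfl
  have hmono' (a b : ℝ≥0) (hab : a ≤ b) : ‖u a‖ ≤ ‖u b‖ := by
    have := hmono a.2 b.2 hab
    simpa using (sq_le_sq₀ (norm_nonneg _) (norm_nonneg _)).1 this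
  have hlim : Tendsto (fun n : ℕ => u n) atTop (𝓝 (1 + z * greenLim hν hm u)) := by
    simp only [hu]
    exact ((tendsto_greenLim hν hm u).const_mul z).const_add 1
  have hle (a : ℝ≥0) : ‖u a‖ ≤ ‖1 + z * greenLim hν hm u‖ := by
    refine ge_of_tendsto hlim.norm ?_
    filter_upwards [eventually_ge_atTop ⌈a⌉₊] with n hn
    exact hmono' _ _ ((Nat.le_ceil a).trans (Nat.cast_le.2 hn))
  refine ⟨(BoundedContinuousFunction.norm_le (norm_nonneg _)).2 hle, ?_⟩
  have h0 := hle 0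
  rwa [hu, greenOp_apply, NNReal.coe_zero, radInv_zero, mul_zero, add_zero, norm_one] at h0

end Resolvent

section Fourier

open scoped NNReal BoundedContinuousFunction FourierTransform SchwartzMap

lemma map_fourier {Y Z : Type*} [NormedAddCommGroup Y] [NormedSpace ℂ Y] [CompleteSpace Y]
    [NormedAddCommGroup Z] [NormedSpace ℂ Z] [CompleteSpace Z] (L : Y →L[ℂ] Z) {f : ℝ → Y}
    (hf : Integrable f) (t : ℝ) : L (𝓕 f t) = 𝓕 (fun y => L (f y)) t := by
  have h : Integrable fun v : ℝ => Real.fourierChar (-(v * t)) • f v := by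
    simpa [mul_comm] using (Real.fourierIntegral_convergent_iff (μ := volume) (f := f) t).2 hf
  rw [Real.fourier_real_eq, Real.fourier_real_eq, ← L.integral_comp_comm h]
  simp only [Circle.smul_def, map_smul]

lemma fourier_add_apply {Y : Type*} [NormedAddCommGroup Y] [NormedSpace ℂ Y] {f g : ℝ → Y}
    (hf : Integrable f) (hg : Integrable g) (t : ℝ) :
    𝓕 (fun y => f y + g y) t = 𝓕 f t + 𝓕 g t := by
  have h (f : ℝ → Y) (hf : Integrable f) :
      Integrable fun v : ℝ => Real.fourierChar (-(v * t)) • f v := by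
    simpa [mul_comm] using (Real.fourierIntegral_convergent_iff (μ := volume) (f := f) t).2 hf
  simp only [Real.fourier_real_eq, smul_add]
  exact integral_add (h f hf) (h g hg)

lemma norm_fourier_le {Y : Type*} [NormedAddCommGroup Y] [NormedSpace ℂ Y] (f : ℝ → Y) (t : ℝ) :
    ‖𝓕 f t‖ ≤ ∫ y, ‖f y‖ :=
  VectorFourier.norm_fourierIntegral_le_integral_norm _ _ _ _ _

lemma continuous_fourier_of_integrable {Y : Type*} [NormedAddCommGroup Y] [NormedSpace ℂ Y]
    {f : ℝ → Y} (hf : Integrable f) : Continuous (𝓕 f) :=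
  VectorFourier.fourierIntegral_continuous Real.continuous_fourierChar
    (innerSL ℝ : ℝ →L[ℝ] ℝ →L[ℝ] ℝ).continuous₂ hf

variable {ν m : ℝ}

/-- Solution of the parabolic equation with lateral data `g` at infinity, vanishing as
`t → -∞`, as a curve `F` of bounded functions of `a = |x|²` with derivative `G`. -/
lemma exists_solution (hν : 1 / 2 ≤ ν) (hm : 2 < m) (g : 𝓢(ℝ, ℂ)) :
    ∃ (F G : ℝ → ℝ≥0 →ᵇ ℂ) (C : ℝ), (∀ t, HasDerivAt F (G t) t) ∧ Continuous G ∧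
      Tendsto F (cocompact ℝ) (𝓝 0) ∧ (∀ t, ‖F t‖ ≤ C) ∧ (∀ t, ‖G t‖ ≤ C) ∧
      (∀ t a, F t a = F t 0 + greenOp hν hm (G t) a) ∧
      ∀ t, g t = F t 0 + greenLim hν hm (G t) := by
  obtain ⟨u, hu, hue⟩ := exists_resolvent (norm_greenOp_pow_le hν hm) 1
  set z : ℝ → ℂ := fun y => -2 * Real.pi * Complex.I * y with hz
  have hzc : Continuous z := by fun_prop
  have hzre (y : ℝ) : 0 ≤ (z y).re := by simp [hz]
  set B : ℝ → ℂ := fun y => 1 + z y * greenLim hν hm (u (z y)) with hB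
  have hBc : Continuous B :=
    continuous_const.add (hzc.mul ((greenLim hν hm).continuous.comp (hu.comp hzc)))
  have hBu (y : ℝ) := norm_le_and_one_le_of_eq_greenOp hν hm (hzre y) (hue (z y))
  have hB0 (y : ℝ) : B y ≠ 0 := norm_pos_iff.1 (zero_lt_one.trans_le (hBu y).2)
  set f : ℝ → ℝ≥0 →ᵇ ℂ := fun y => (𝓕⁻ g y / B y) • u (z y) with hf
  have hfc : Continuous f := ((𝓕⁻ g).continuous.div₀ hBc hB0).smul (hu.comp hzc)
  have hfn (y : ℝ) : ‖f y‖ ≤ ‖𝓕⁻ g y‖ := by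
    rw [hf]
    simp only
    rw [norm_smul, norm_div, div_mul_eq_mul_div]
    exact div_le_of_le_mul₀ (norm_nonneg _) (norm_nonneg _)
      (mul_le_mul_of_nonneg_left (hBu y).1 (norm_nonneg _))
  have hfi : Integrable f := (𝓕⁻ g).integrable.mono hfc.aestronglyMeasurable (ae_of_all _ hfn)
  have hyi : Integrable fun y : ℝ => y • f y := by
    refine ((𝓕⁻ g).integrable_pow_mul volume 1).mono
      (continuous_id.smul hfc).aestronglyMeasurable (ae_of_all _ fun y => ?_)
    rw [norm_smul, pow_one, norm_mul, norm_norm, norm_norm]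
    exact mul_le_mul_of_nonneg_left (hfn y) (norm_nonneg _)
  have hzi : Integrable fun y : ℝ => z y • f y := by
    convert hyi.smul (-2 * Real.pi * Complex.I) using 2 with y
    rw [hz]
    simp only
    rw [mul_smul, Complex.coe_smul]
    rfl
  have hf0 (y : ℝ) : f y 0 = 𝓕⁻ g y / B y := by
    have : u (z y) 0 = 1 := by
      rw [hue]
      change 1 + z y * greenOp hν hm (u (z y)) 0 = 1
      rw [greenOp_apply, NNReal.coe_zero, radInv_zero, mul_zero, add_zero]
    change (𝓕⁻ g y / B y) * u (z y) 0 = _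
    rw [this, mul_one]
  refine ⟨𝓕 f, 𝓕 (fun y => z y • f y), max (∫ y, ‖f y‖) (∫ y, ‖z y • f y‖),
    fun t => Real.hasDerivAt_fourier hfi hyi t, continuous_fourier_of_integrable hzi,
    Real.zero_at_infty_fourier f, fun t => (norm_fourier_le f t).trans (le_max_left _ _),
    fun t => (norm_fourier_le _ t).trans (le_max_right _ _), fun t a => ?_, fun t => ?_⟩
  · let ev (a : ℝ≥0) : (ℝ≥0 →ᵇ ℂ) →L[ℂ] ℂ := BoundedContinuousFunction.evalCLM ℂ a
    have h1 := map_fourier (ev a - ev 0) hfi t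
    have h2 := map_fourier ((ev a).comp (greenOp hν hm)) hzi t
    have h3 : (fun y => (ev a - ev 0) (f y)) =
        fun y => ((ev a).comp (greenOp hν hm)) (z y • f y) := by
      funext y
      change f y a - f y 0 = greenOp hν hm (z y • f y) a
      have h4 : u (z y) a = 1 + z y * greenOp hν hm (u (z y)) a := by
        conv_lhs => rw [hue]
        rfl
      have h5 : f y a = (𝓕⁻ g y / B y) * u (z y) a := rfl
      have h6 : greenOp hν hm (z y • f y) a =
          z y * ((𝓕⁻ g y / B y) * greenOp hν hm (u (z y)) a) := by
        rw [hf]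
        simp only [map_smul]
        rfl
      rw [hf0, h5, h6, h4]
      ring
    rw [h3, ← h2] at h1
    exact sub_eq_iff_eq_add'.1 h1
  · have h1 := map_fourier (BoundedContinuousFunction.evalCLM ℂ (0 : ℝ≥0)) hfi t
    have h2 := map_fourier (greenLim hν hm) hzi t
    have h3 : (fun y => BoundedContinuousFunction.evalCLM ℂ (0 : ℝ≥0) (f y) +
        greenLim hν hm (z y • f y)) = 𝓕⁻ g := by
      funext y
      change f y 0 + greenLim hν hm (z y • f y) = 𝓕⁻ g y
      rw [hf0, hf]
      simp only [map_smul, smul_eq_mul]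
      have := hB0 y
      have h4 : z y * greenLim hν hm (u (z y)) = B y - 1 := by simp [hB]
      rw [mul_left_comm, h4]
      field_simp
      ring
    have h4 := fourier_add_apply ((BoundedContinuousFunction.evalCLM ℂ (0 : ℝ≥0)).integrable_comp hfi)
      ((greenLim hν hm).integrable_comp hzi) t
    rw [h3, ← SchwartzMap.fourier_coe, FourierTransform.fourier_fourierInv_eq, ← h1, ← h2] at h4
    exact h4

end Fourier

section MaximumPrinciple

open scoped NNReal BoundedContinuousFunction

variable {ν m : ℝ}

/-- Second derivative test for radial functions at a minimum. -/
lemma nonneg_of_radInv_le (hν : 0 ≤ ν) {q : ℝ → ℝ} (hq : Continuous q) {a R : ℝ} (ha : 0 ≤ a)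
    (haR : a < R) (h : ∀ b ∈ Icc 0 R, radInv ν q a ≤ radInv ν q b) : 0 ≤ q a := by
  by_contra! hneg
  set P : ℝ → ℝ := fun a => ∫ b in (0 : ℝ)..a, b ^ ν • q b with hPdef
  have hP (a : ℝ) : HasDerivAt P (a ^ ν • q a) a := hasDerivAt_integral_rpow_smul hν hq a
  have hPa (b : ℝ) (hb : 0 ≤ b) : b ^ (ν + 1) • wavg ν q b = P b := rpow_smul_wavg' hν hb
  have hPc : Continuous P := continuous_iff_continuousAt.2 fun a => (hP a).continuousAt
  have hP0 : P a = 0 := by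
    rcases ha.eq_or_lt with rfl | ha
    · simp [hPdef]
    · have hmin : IsLocalMin (radInv ν q) a := by
        filter_upwards [Icc_mem_nhds ha haR] with b hb using h b hb
      have := hmin.hasDerivAt_eq_zero (hasDerivAt_radInv hν hq a)
      rw [smul_eq_zero] at this
      rw [← hPa a ha.le, this.resolve_left (by norm_num), smul_zero]
  obtain ⟨e, he, hqe⟩ : ∃ e > a, ∀ b ∈ Ico a e, q b < 0 :=
    (mem_nhdsGE_iff_exists_Ico_subset.1
      (mem_nhdsWithin_of_mem_nhds (hq.continuousAt.eventually (gt_mem_nhds hneg))))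
  set r := min e R with hr
  have har : a < r := lt_min he haR
  have hPneg (b : ℝ) (hb : b ∈ Ioo a r) : P b < 0 := by
    have hanti : StrictAntiOn P (Icc a b) := by
      refine strictAntiOn_of_deriv_neg (convex_Icc a b) hPc.continuousOn fun s hs => ?_
      rw [interior_Icc] at hs
      rw [(hP s).deriv]
      have hs0 : 0 < s := ha.trans_lt hs.1
      exact mul_neg_of_pos_of_neg (by positivity)
        (hqe s ⟨hs.1.le, (hs.2.trans hb.2).trans_le (min_le_left _ _)⟩)
    rw [← hP0]
    exact hanti (left_mem_Icc.2 hb.1.le) (right_mem_Icc.2 hb.1.le) hb.1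
  have hanti : StrictAntiOn (radInv ν q) (Icc a r) := by
    refine strictAntiOn_of_deriv_neg (convex_Icc a r) (continuous_radInv hν hq).continuousOn
      fun s hs => ?_
    rw [interior_Icc] at hs
    rw [(hasDerivAt_radInv hν hq s).deriv]
    have hs0 : 0 < s := ha.trans_lt hs.1
    have h1 := hPneg s hs
    rw [← hPa s hs0.le] at h1
    have h2 : 0 < s ^ (ν + 1) := by positivity
    exact mul_neg_of_pos_of_neg (by norm_num) ((pos_iff_neg_of_mul_neg h1).1 h2)
  exact (hanti (left_mem_Icc.2 har.le) (right_mem_Icc.2 har.le) har).not_ge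
    (h r ⟨ha.trans har.le, min_le_right _ _⟩)

lemma nonpos_of_hasDerivAt_of_le {f : ℝ → ℝ} {f' s t : ℝ} (hst : s < t) (hf : HasDerivAt f f' t)
    (h : ∀ r ∈ Ioo s t, f t ≤ f r) : f' ≤ 0 := by
  have h1 := (hasDerivWithinAt_iff_tendsto_slope' self_notMem_Iio).1
    (hf.hasDerivWithinAt (s := Iio t))
  refine le_of_tendsto h1 ?_
  filter_upwards [Ioo_mem_nhdsLT hst] with r hr
  rw [slope_def_field]
  exact div_nonpos_of_nonneg_of_nonpos (sub_nonneg.2 (h r hr)) (sub_nonpos.2 hr.2.le)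

/-- The real part of `weighted m q`. -/
noncomputable def reWeighted (m : ℝ) (q : ℝ≥0 →ᵇ ℂ) (a : ℝ) : ℝ := rho m a * (q a.toNNReal).re

lemma continuous_reWeighted (q : ℝ≥0 →ᵇ ℂ) : Continuous (reWeighted m q) :=
  continuous_rho.mul (Complex.continuous_re.comp (q.continuous.comp continuous_real_toNNReal))

lemma re_radInv_weighted (hν : 0 ≤ ν) (q : ℝ≥0 →ᵇ ℂ) (a : ℝ) :
    (radInv ν (weighted m q) a).re = radInv ν (reWeighted m q) a := by
  have h1 (b : ℝ) : (wavg ν (weighted m q) b).re = wavg ν (reWeighted m q) b := by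
    have hi : IntervalIntegrable (fun θ => θ ^ ν • weighted m q (b * θ)) volume 0 1 :=
      ((Real.continuous_rpow_const hν).smul
        ((continuous_weighted q).comp (continuous_const.mul continuous_id))).intervalIntegrable _ _
    have := Complex.reCLM.intervalIntegral_comp_comm hi
    rw [wavg, ← Complex.reCLM_apply, ← this]
    simp [wavg, weighted, reWeighted]
  have := Complex.reCLM.intervalIntegral_comp_comm
    ((continuous_wavg hν (continuous_weighted (m := m) q)).intervalIntegrable (μ := volume) 0 a)
  rw [radInv, radInv, Complex.smul_re, ← Complex.reCLM_apply, ← this]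
  simp only [Complex.reCLM_apply, h1]

lemma hasDerivAt_re_apply {F : ℝ → ℝ≥0 →ᵇ ℂ} {F' : ℝ≥0 →ᵇ ℂ} {t : ℝ} (hF : HasDerivAt F F' t)
    (a : ℝ≥0) : HasDerivAt (fun s => (F s a).re) (F' a).re t := by
  have h := (BoundedContinuousFunction.evalCLM ℝ a).hasFDerivAt.comp_hasDerivAt t hF
  exact Complex.reCLM.hasFDerivAt.comp_hasDerivAt t h

lemma re_nonneg_of_lateral_nonneg (hν : 1 / 2 ≤ ν) (hm : 2 < m) {F G : ℝ → ℝ≥0 →ᵇ ℂ} {C : ℝ}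
    {g : ℝ → ℂ} (hF : ∀ t, HasDerivAt F (G t) t) (h0 : Tendsto F (cocompact ℝ) (𝓝 0))
    (hC : ∀ t, ‖G t‖ ≤ C) (h1 : ∀ t a, F t a = F t 0 + greenOp hν hm (G t) a)
    (h2 : ∀ t, g t = F t 0 + greenLim hν hm (G t)) {t₁ : ℝ} (hg : ∀ t ≤ t₁, 0 ≤ (g t).re)
    (a₁ : ℝ≥0) : 0 ≤ (F t₁ a₁).re := by
  by_contra! hneg
  obtain ⟨c, hc⟩ : ∃ c, (F t₁ a₁).re = -(2 * c) := ⟨-(F t₁ a₁).re / 2, by ring⟩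
  have hc0 : 0 < c := by linarith
  obtain ⟨t₀, ht₀, ht₀'⟩ : ∃ t₀, ‖F t₀‖ < c / 2 ∧ t₀ < t₁ := by
    have h3 := (h0.mono_left atBot_le_cocompact).norm
    rw [norm_zero] at h3
    exact ((h3.eventually (gt_mem_nhds (half_pos hc0))).and (eventually_lt_atBot t₁)).exists
  obtain ⟨R, hR, hR'⟩ : ∃ R : ℝ≥0, C * (totalMass m - majorant m R) < c / 2 ∧ a₁ < R := by
    have h3 := ((tendsto_totalMass_sub_majorant hm).comp (NNReal.tendsto_coe_atTop.2 tendsto_id)).const_mul C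
    rw [mul_zero] at h3
    exact ((h3.eventually (gt_mem_nhds (half_pos hc0))).and (eventually_gt_atTop a₁)).exists
  have hFc : Continuous F := continuous_iff_continuousAt.2 fun t => (hF t).continuousAt
  set z : ℝ≥0 × ℝ → ℝ := fun p => (F p.2 p.1).re + c / (t₁ - t₀) * (p.2 - t₀) with hz
  have hzc : Continuous z := by
    have : Continuous fun p : ℝ≥0 × ℝ => F p.2 p.1 :=
      (hFc.comp continuous_snd).eval continuous_fst
    fun_prop
  have hk : 0 < c / (t₁ - t₀) := div_pos hc0 (sub_pos.2 ht₀')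
  have hmem : (a₁, t₁) ∈ Icc 0 R ×ˢ Icc t₀ t₁ :=
    ⟨⟨zero_le, hR'.le⟩, ⟨ht₀'.le, le_rfl⟩⟩
  obtain ⟨⟨a, t⟩, ⟨ha, ht⟩, hmin⟩ :=
    (isCompact_Icc.prod isCompact_Icc).exists_isMinOn ⟨_, hmem⟩ hzc.continuousOn
  simp only at ha ht
  have hle (b : ℝ≥0) (s : ℝ) (hb : b ∈ Icc 0 R) (hs : s ∈ Icc t₀ t₁) : z (a, t) ≤ z (b, s) :=
    hmin (mk_mem_prod hb hs)
  have hzle : z (a, t) ≤ -c := by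
    refine (hle _ _ hmem.1 hmem.2).trans_eq ?_
    simp only [hz]
    rw [hc, div_mul_cancel₀ _ (sub_pos.2 ht₀').ne']
    ring
  have hpart : z (a, t) = (F t a).re + c / (t₁ - t₀) * (t - t₀) := rfl
  have htime : 0 ≤ c / (t₁ - t₀) * (t - t₀) := mul_nonneg hk.le (sub_nonneg.2 ht.1)
  have htlt : t₀ < t := by
    refine ht.1.lt_of_ne fun h => ?_
    subst h
    have h3 := (Complex.abs_re_le_norm (F t₀ a)).trans ((F t₀).norm_coe_le_norm a)
    have h4 := neg_abs_le (F t₀ a).re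
    linarith
  have halt : a < R := by
    refine ha.2.lt_of_ne fun h => ?_
    subst h
    have h3 : (F t a).re = (g t).re - (greenLim hν hm (G t) - greenOp hν hm (G t) a).re := by
      rw [h2, h1 t a]
      simp only [Complex.add_re, Complex.sub_re]
      ring
    have h4 := (Complex.re_le_norm _).trans (norm_greenLim_sub_le hν hm (G t) a)
    have h5 : ‖G t‖ * (totalMass m - majorant m a) ≤ C * (totalMass m - majorant m a) :=
      mul_le_mul_of_nonneg_right (hC t) (sub_nonneg.2 (majorant_le hm a.2))
    have h6 := hg t ht.2
    linarith
  have hder : (G t a).re ≤ -(c / (t₁ - t₀)) := by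
    have h3 : HasDerivAt (fun s => z (a, s)) ((G t a).re + c / (t₁ - t₀) * 1) t := by
      exact (hasDerivAt_re_apply (hF t) a).add (((hasDerivAt_id t).sub_const t₀).const_mul _)
    have := nonpos_of_hasDerivAt_of_le htlt h3 fun s hs =>
      hle a s ha ⟨hs.1.le, hs.2.le.trans ht.2⟩
    linarith
  have hspace : 0 ≤ reWeighted m (G t) a := by
    refine nonneg_of_radInv_le (ν := ν) (by linarith) (continuous_reWeighted _) a.2
      (NNReal.coe_lt_coe.2 halt) fun b hb => ?_
    lift b to ℝ≥0 using hb.1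
    have h3 := hle b t ⟨zero_le, hb.2⟩ ht
    simp only [hz, add_le_add_iff_right] at h3
    rw [h1 t a, h1 t b, Complex.add_re, Complex.add_re, add_le_add_iff_left, greenOp_apply,
      greenOp_apply, re_radInv_weighted (by linarith), re_radInv_weighted (by linarith)] at h3
    exact h3
  have h3 : reWeighted m (G t) a = rho m a * (G t a).re := by simp [reWeighted]
  rw [h3] at hspace
  have := nonneg_of_mul_nonneg_right hspace (rho_pos _)
  linarith

end MaximumPrinciple

open scoped SchwartzMap in
/-- A nonnegative smooth bump supported in positive times. -/
lemma exists_schwartz_bump : ∃ g : 𝓢(ℝ, ℂ), (∀ t, 0 ≤ (g t).re) ∧ (∀ t ≤ 0, (g t).re = 0) ∧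
    (g 1).re = 1 := by
  let φ : ContDiffBump (1 : ℝ) := ⟨1 / 4, 1 / 2, by norm_num, by norm_num⟩
  have h1 : HasCompactSupport fun t => (φ t : ℂ) :=
    φ.hasCompactSupport.comp_left (g := fun r : ℝ => (r : ℂ)) Complex.ofReal_zero
  refine ⟨h1.toSchwartzMap (Complex.ofRealCLM.contDiff.comp φ.contDiff), fun t => φ.nonneg,
    fun t ht => φ.zero_of_le_dist ?_, φ.one_of_mem_closedBall (by simp [φ])⟩
  rw [Real.dist_eq, abs_sub_comm, abs_of_nonneg (by linarith)]
  change 1 / 2 ≤ 1 - t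
  linarith

/-- for `d ≥ 3` and `m > 2` there is a nontrivial bounded nonnegative
classical solution of `v_t = (1+|x|)^m Δv` with zero initial data (equivalently, the
diffusion corresponding to `(1+|x|)^m Δ` explodes). -/
theorem stmt_12 {d : ℕ} (hd : 3 ≤ d) (m : ℝ) (hm : 2 < m) :
    ∃ v : EuclideanSpace ℝ (Fin d) → ℝ → ℝ,
      (∃ M : ℝ, ∀ x t, 0 ≤ t → |v x t| ≤ M) ∧
      ContinuousOn (fun q : EuclideanSpace ℝ (Fin d) × ℝ => v q.1 q.2)
        (univ ×ˢ Ici (0 : ℝ)) ∧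
      (∀ x t, 0 ≤ t → 0 ≤ v x t) ∧
      (∀ t : ℝ, 0 < t → ContDiff ℝ 2 (fun x => v x t)) ∧
      (∀ x, ContDiffOn ℝ 1 (fun s => v x s) (Ioi (0 : ℝ))) ∧
      (∀ x t, 0 < t →
        deriv (fun s => v x s) t =
          (1 + ‖x‖) ^ m * (∑ i, pd i (pd i (fun y => v y t)) x)) ∧
      (∀ x, v x 0 = 0) ∧
      (∃ x t, 0 ≤ t ∧ v x t ≠ 0) := by
  obtain ⟨ν, hdν⟩ : ∃ ν : ℝ, (d : ℝ) / 2 = ν + 1 := ⟨d / 2 - 1, by ring⟩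
  have hν : 1 / 2 ≤ ν := by
    have : (3 : ℝ) ≤ d := by exact_mod_cast hd
    linarith
  have hν0 : 0 ≤ ν := by linarith
  obtain ⟨g, hg, hg0, hg1⟩ := exists_schwartz_bump
  obtain ⟨F, G, C, hF, hG, hlim, hFC, hGC, h1, h2⟩ := exists_solution hν hm g
  have hFc : Continuous F := continuous_iff_continuousAt.2 fun t => (hF t).continuousAt
  have hpos (t : ℝ) (a : NNReal) : 0 ≤ (F t a).re :=
    re_nonneg_of_lateral_nonneg hν hm hF hlim hGC h1 h2 (fun s _ => hg s) a
  have hneg (a : NNReal) : (F 0 a).re ≤ 0 := by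
    have := re_nonneg_of_lateral_nonneg hν hm (F := fun t => -F t) (G := fun t => -G t) (C := C)
      (g := fun t => -g t) (t₁ := 0) (fun t => (hF t).neg) (by simpa using hlim.neg)
      (fun t => (norm_neg _).trans_le (hGC t))
      (fun t a => by
        rw [map_neg]
        change -F t a = -F t 0 + -greenOp hν hm (G t) a
        rw [h1 t a, neg_add])
      (fun t => by
        rw [map_neg]
        change -g t = -F t 0 + -greenLim hν hm (G t)
        rw [h2, neg_add])
      (fun t ht => by rw [Complex.neg_re, hg0 t ht, neg_zero]) a
    change 0 ≤ (-F 0 a).re at this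
    rw [Complex.neg_re] at this
    linarith
  have hvx (t : ℝ) : (fun x : EuclideanSpace ℝ (Fin d) => (F t (‖x‖ ^ 2).toNNReal).re) =
      fun x => (F t 0).re + radInv ν (reWeighted m (G t)) (‖x‖ ^ 2) := by
    funext x
    rw [h1 t, Complex.add_re, greenOp_apply, re_radInv_weighted hν0,
      Real.coe_toNNReal _ (by positivity)]
  have hvt (a : NNReal) (t : ℝ) : HasDerivAt (fun s => (F s a).re) (G t a).re t :=
    hasDerivAt_re_apply (hF t) a
  refine ⟨fun x t => (F t (‖x‖ ^ 2).toNNReal).re, ⟨C, fun x t _ => ?_⟩, ?_,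
    fun x t _ => hpos t _, fun t _ => ?_, fun x => ?_, fun x t _ => ?_,
    fun x => le_antisymm (hneg _) (hpos _ _), ?_⟩
  · exact (Complex.abs_re_le_norm _).trans (((F t).norm_coe_le_norm _).trans (hFC t))
  · have : Continuous fun q : EuclideanSpace ℝ (Fin d) × ℝ => F q.2 (‖q.1‖ ^ 2).toNNReal :=
      (hFc.comp continuous_snd).eval (by fun_prop)
    exact (Complex.continuous_re.comp this).continuousOn
  · rw [hvx]
    exact contDiff_radInv_norm_sq hν0 (continuous_reWeighted _) _
  · refine ContDiff.contDiffOn (contDiff_one_iff_deriv.2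
      ⟨fun t => (hvt _ t).differentiableAt, ?_⟩)
    have h : deriv (fun s => (F s (‖x‖ ^ 2).toNNReal).re) =
        fun t => (G t (‖x‖ ^ 2).toNNReal).re := funext fun t => (hvt _ t).deriv
    refine Continuous.congr ?_ fun t => (congrFun h t).symm
    exact Complex.continuous_re.comp (hG.eval_const _)
  · rw [(hvt _ t).deriv, hvx, sum_pd_pd_radInv_norm_sq hν0 hdν (continuous_reWeighted _),
      reWeighted, rho, Real.sqrt_sq (norm_nonneg x), ← mul_assoc,
      ← Real.rpow_add (by positivity), add_neg_cancel, Real.rpow_zero, one_mul]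
  · by_contra! hzero
    have h3 (n : ℕ) : (F 1 0 + greenOp hν hm (G 1) n).re = 0 := by
      have h4 := hzero (EuclideanSpace.single ⟨0, by lia⟩ (√n)) 1 zero_le_one
      rw [PiLp.norm_single, Real.norm_eq_abs, sq_abs, Real.sq_sqrt (by positivity),
        Real.toNNReal_natCast, h1] at h4
      exact h4
    have h4 := (Complex.continuous_re.tendsto _).comp
      ((tendsto_greenLim hν hm (G 1)).const_add (F 1 0))
    rw [← h2, hg1] at h4
    exact one_ne_zero (tendsto_nhds_unique (h4.congr h3) tendsto_const_nhds)
end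

section
/- Let d ≥ 2 and p > 1 with d < 2p/(p−1). Then there exists a function u : (ℝ^d ∖ {0}) × [0,∞) → ℝ, not identically zero, that is continuous, nonnegative, twice continuously differentiable in x and once in t on (ℝ^d ∖ {0}) × (0,∞), satisfies ∂u/∂t = (1/2)Δu − u^p on (ℝ^d ∖ {0}) × (0,∞), and satisfies u(x,0) = 0 for all x ∈ ℝ^d ∖ {0}. -/
open Set

open Filter Topology MeasureTheory
open scoped ENNReal

theorem ofReal_sub_le_lintegral_Ioc {H H' f : ℝ → ℝ} {a b : ℝ} (hab : a ≤ b)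
    (hH : ∀ x, HasDerivAt H (H' x) x) (hf : ContinuousOn f (Icc a b))
    (hf0 : ∀ x ∈ Icc a b, 0 ≤ f x) (hle : ∀ x ∈ Icc a b, H' x ≤ f x) :
    ENNReal.ofReal (H b - H a) ≤ ∫⁻ x in Ioc a b, ENNReal.ofReal (f x) := by
  have hi : IntegrableOn f (Ioc a b) := hf.integrableOn_Icc.mono_set Ioc_subset_Icc_self
  rw [← ofReal_integral_eq_lintegral_ofReal hi
    ((ae_restrict_iff' measurableSet_Ioc).2 (.of_forall fun x hx => hf0 x (Ioc_subset_Icc_self hx))),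
    ← intervalIntegral.integral_of_le hab]
  refine ENNReal.ofReal_le_ofReal ?_
  exact intervalIntegral.sub_le_integral_of_hasDeriv_right_of_le hab
    (fun x _ => (hH x).continuousAt.continuousWithinAt) (fun x _ => (hH x).hasDerivWithinAt)
    hf.integrableOn_Icc (fun x hx => hle x (Ioo_subset_Icc_self hx))

theorem ofReal_add_lintegral_Ioc_le {H H' f : ℝ → ℝ} {a b c : ℝ} (hab : a ≤ b)
    (hH : ∀ x, HasDerivAt H (H' x) x) (hf : ContinuousOn f (Icc a b))
    (hf0 : ∀ x ∈ Icc a b, 0 ≤ f x) (hle : ∀ x ∈ Icc a b, f x ≤ H' x) (hc : 0 ≤ c)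
    (hca : c ≤ H a) :
    ENNReal.ofReal c + ∫⁻ x in Ioc a b, ENNReal.ofReal (f x) ≤ ENNReal.ofReal (H b) := by
  have hi : IntegrableOn f (Ioc a b) := hf.integrableOn_Icc.mono_set Ioc_subset_Icc_self
  rw [← ofReal_integral_eq_lintegral_ofReal hi
    ((ae_restrict_iff' measurableSet_Ioc).2 (.of_forall fun x hx => hf0 x (Ioc_subset_Icc_self hx))),
    ← intervalIntegral.integral_of_le hab,
    ← ENNReal.ofReal_add hc (intervalIntegral.integral_nonneg hab hf0)]
  refine ENNReal.ofReal_le_ofReal ?_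
  have := intervalIntegral.integral_le_sub_of_hasDeriv_right_of_le hab
    (fun x _ => (hH x).continuousAt.continuousWithinAt) (fun x _ => (hH x).hasDerivWithinAt)
    hf.integrableOn_Icc (fun x hx => hle x (Ioo_subset_Icc_self hx))
  linarith

theorem lintegral_Iic_le_ofReal {H H' f : ℝ → ℝ} (b : ℝ)
    (hH : ∀ x, HasDerivAt H (H' x) x) (hf : Continuous f) (hf0 : ∀ x, 0 ≤ f x)
    (hle : ∀ x ≤ b, f x ≤ H' x) (hH0 : ∀ x, 0 ≤ H x) :
    ∫⁻ x in Iic b, ENNReal.ofReal (f x) ≤ ENNReal.ofReal (H b) := by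
  have hc : AECover (volume.restrict (Iic b)) atTop (fun n : ℝ => Ioi (-n)) :=
    aecover_Ioi tendsto_neg_atTop_atBot
  refine le_of_tendsto (hc.lintegral_tendsto_of_countably_generated
    (hf.measurable.ennreal_ofReal.aemeasurable)) ?_
  filter_upwards [eventually_ge_atTop (-b)] with n hn
  rw [Measure.restrict_restrict measurableSet_Ioi, Ioi_inter_Iic]
  simpa using ofReal_add_lintegral_Ioc_le (by linarith) hH hf.continuousOn (fun x _ => hf0 x)
    (fun x hx => hle x hx.2) le_rfl (hH0 (-n))

theorem lintegral_Ioi_le_ofReal {H H' f : ℝ → ℝ} (a : ℝ)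
    (hH : ∀ x, HasDerivAt H (H' x) x) (hf : Continuous f) (hf0 : ∀ x, 0 ≤ f x)
    (hle : ∀ x, a ≤ x → f x ≤ - H' x) (hH0 : ∀ x, 0 ≤ H x) :
    ∫⁻ x in Ioi a, ENNReal.ofReal (f x) ≤ ENNReal.ofReal (H a) := by
  have hc : AECover (volume.restrict (Ioi a)) atTop (fun n : ℝ => Iic n) :=
    aecover_Iic tendsto_id
  refine le_of_tendsto (hc.lintegral_tendsto_of_countably_generated
    (hf.measurable.ennreal_ofReal.aemeasurable)) ?_
  filter_upwards [eventually_ge_atTop a] with n hn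
  rw [Measure.restrict_restrict measurableSet_Iic, inter_comm, Ioi_inter_Iic]
  have h := ofReal_add_lintegral_Ioc_le hn (fun x => (hH x).const_sub (H a)) hf.continuousOn
    (fun x _ => hf0 x) (fun x hx => hle x hx.1) le_rfl (sub_self (H a)).ge
  rw [ENNReal.ofReal_zero, zero_add] at h
  exact h.trans (ENNReal.ofReal_le_ofReal (sub_le_self _ (hH0 n)))

theorem ofReal_le_lintegral_Iic {H H' f : ℝ → ℝ} (b : ℝ)
    (hH : ∀ x, HasDerivAt H (H' x) x) (hf : Continuous f)
    (hf0 : ∀ x ≤ b, 0 ≤ f x) (hle : ∀ x ≤ b, H' x ≤ f x) (hlim : Tendsto H atBot (𝓝 0)) :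
    ENNReal.ofReal (H b) ≤ ∫⁻ x in Iic b, ENNReal.ofReal (f x) := by
  have hl : Tendsto (fun a => ENNReal.ofReal (H b - H a)) atBot (𝓝 (ENNReal.ofReal (H b))) := by
    have := (tendsto_const_nhds (x := H b)).sub hlim
    rw [sub_zero] at this
    exact ENNReal.tendsto_ofReal this
  refine le_of_tendsto hl ?_
  filter_upwards [eventually_le_atBot b] with a ha
  exact (ofReal_sub_le_lintegral_Ioc ha hH hf.continuousOn (fun x hx => hf0 x hx.2)
    (fun x hx => hle x hx.2)).trans (lintegral_mono_set Ioc_subset_Iic_self)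

theorem continuous_integral_Iic {f : ℝ → ℝ} (hf : ∀ b, IntegrableOn f (Iic b)) :
    Continuous fun y => ∫ z in Iic y, f z := by
  have h : (fun y => ∫ z in Iic y, f z) = fun y => (∫ z in Iic 0, f z) + ∫ z in (0 : ℝ)..y, f z := by
    ext y
    rw [← intervalIntegral.integral_Iic_sub_Iic (hf 0) (hf y)]
    ring
  rw [h]
  refine continuous_const.add (intervalIntegral.continuous_primitive (fun a b => ?_) 0)
  exact ⟨(hf b).mono_set Ioc_subset_Iic_self, (hf a).mono_set Ioc_subset_Iic_self⟩

theorem hasDerivAt_integral_Iic {f : ℝ → ℝ} (hf : ∀ b, IntegrableOn f (Iic b))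
    (hc : Continuous f) (y : ℝ) : HasDerivAt (fun y => ∫ z in Iic y, f z) (f y) y := by
  have h : (fun y => ∫ z in Iic y, f z) = fun y => (∫ z in Iic 0, f z) + ∫ z in (0 : ℝ)..y, f z := by
    ext y
    rw [← intervalIntegral.integral_Iic_sub_Iic (hf 0) (hf y)]
    ring
  rw [h]
  exact (hc.integral_hasStrictDerivAt 0 y).hasDerivAt.const_add _

theorem hasDerivAt_integral_Ioi {f : ℝ → ℝ} (hf : ∀ b, IntegrableOn f (Ioi b))
    (hc : Continuous f) (y : ℝ) : HasDerivAt (fun y => ∫ z in Ioi y, f z) (-f y) y := by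
  have h : (fun y => ∫ z in Ioi y, f z) = fun y => (∫ z in Ioi 0, f z) - ∫ z in (0 : ℝ)..y, f z := by
    ext y
    rw [← intervalIntegral.integral_Ioi_sub_Ioi' (hf 0) (hf y)]
    ring
  rw [h]
  exact (hc.integral_hasStrictDerivAt 0 y).hasDerivAt.const_sub _

theorem exists_fixedPoint_between {α : Type*} [CompleteLattice α] {T : α → α} (hT : Monotone T)
    {x y : α} (hxy : x ≤ y) (hx : x ≤ T x) (hy : T y ≤ y) : ∃ z, T z = z ∧ x ≤ z ∧ z ≤ y := by
  let f : α →o α := ⟨fun z => x ⊔ T z, fun a b h => sup_le_sup_left (hT h) x⟩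
  have hf : x ⊔ T f.lfp = f.lfp := f.map_lfp
  have hxz : x ≤ f.lfp := hf ▸ le_sup_left
  refine ⟨f.lfp, ?_, hxz, f.lfp_le (sup_le hxy hy)⟩
  rwa [sup_eq_right.2 (hx.trans (hT hxz))] at hf

/-- The integrating weight `exp (ν z + eᶻ / 2)` of the profile equation. -/
noncomputable def expWeight (ν z : ℝ) : ℝ := Real.exp (ν * z + Real.exp z / 2)

/-- The right-hand side of the profile equation
`g'' + (eᶻ / 2 - κ) g' = A (g ^ p - g)` after the substitution `g = e^((κ + ν) z) w`, which is
monotone in the value `m` of `g` on `[0, 1]` once `A (p - 1) ≤ (κ + ν) ν`. -/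
noncomputable def source (p A κ ν z m : ℝ) : ℝ :=
  expWeight ν z * ((κ + ν) * (ν + Real.exp z / 2) * m + A * (m - m ^ p))

theorem expWeight_pos (ν z : ℝ) : 0 < expWeight ν z := Real.exp_pos _

theorem hasDerivAt_expWeight (ν z : ℝ) :
    HasDerivAt (expWeight ν) (expWeight ν z * (ν + Real.exp z / 2)) z := by
  have h := (((hasDerivAt_id z).const_mul ν).add ((Real.hasDerivAt_exp z).div_const 2)).exp
  exact h.congr_deriv (by simp [expWeight])

theorem continuous_expWeight (ν : ℝ) : Continuous (expWeight ν) := by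
  unfold expWeight; fun_prop

theorem continuous_source {p A κ ν : ℝ} (hp : 1 < p) {g : ℝ → ℝ} (hg : Continuous g) :
    Continuous fun z => source p A κ ν z (g z) := by
  unfold source
  have := continuous_expWeight ν
  have h2 : Continuous fun z => g z ^ p := hg.rpow_const fun _ => Or.inr (by linarith)
  fun_prop

theorem hasDerivAt_flux {p A κ ν θ g₂ : ℝ} {g g₁ : ℝ → ℝ} (hg : HasDerivAt g (g₁ θ) θ)
    (hg₁ : HasDerivAt g₁ g₂ θ) :
    HasDerivAt (fun z => expWeight ν z * ((κ + ν) * g z - g₁ z))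
      (source p A κ ν θ (g θ) - expWeight ν θ *
        (g₂ + (Real.exp θ / 2 - κ) * g₁ θ + A * (g θ - g θ ^ p))) θ := by
  refine ((hasDerivAt_expWeight ν θ).mul ((hg.const_mul (κ + ν)).sub hg₁)).congr_deriv ?_
  simp only [source, Pi.sub_apply]
  ring

theorem rpow_sub_rpow_le {p x y : ℝ} (hp : 1 < p) (hx : 0 ≤ x) (hxy : x ≤ y) (hy : y ≤ 1) :
    y ^ p - x ^ p ≤ p * (y - x) := by
  have hc : Continuous fun x : ℝ => x ^ p := continuous_id.rpow_const fun _ => Or.inr (by linarith)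
  have hd : ∀ z : ℝ, HasDerivAt (fun x : ℝ => x ^ p) (p * z ^ (p - 1)) z :=
    fun z => Real.hasDerivAt_rpow_const (Or.inr hp.le)
  refine (convex_Icc (0 : ℝ) 1).image_sub_le_mul_sub_of_deriv_le hc.continuousOn
    (fun z _ => (hd z).differentiableAt.differentiableWithinAt) (fun z hz => ?_) x
    ⟨hx, hxy.trans hy⟩ y ⟨hx.trans hxy, hy⟩ hxy
  rw [interior_Icc] at hz
  rw [(hd z).deriv]
  have := Real.rpow_le_one hz.1.le hz.2.le (by linarith : 0 ≤ p - 1)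
  nlinarith

theorem source_mono {p A κ ν z x y : ℝ} (hp : 1 < p) (hA : 0 < A) (hκ : 0 < κ) (hν : 0 < ν)
    (hAν : A * (p - 1) ≤ (κ + ν) * ν) (hx : 0 ≤ x) (hxy : x ≤ y) (hy : y ≤ 1) :
    source p A κ ν z x ≤ source p A κ ν z y := by
  refine mul_le_mul_of_nonneg_left ?_ (expWeight_pos ν z).le
  have h1 := mul_le_mul_of_nonneg_left (rpow_sub_rpow_le hp hx hxy hy) hA.le
  have h2 : A * (p - 1) ≤ (κ + ν) * (ν + Real.exp z / 2) := by
    have := Real.exp_pos z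
    have : 0 ≤ (κ + ν) * (Real.exp z / 2) := by positivity
    nlinarith
  have h3 := mul_le_mul_of_nonneg_right h2 (sub_nonneg.2 hxy)
  nlinarith

theorem source_zero {p A κ ν z : ℝ} (hp : 1 < p) : source p A κ ν z 0 = 0 := by
  simp [source, Real.zero_rpow (by linarith : p ≠ 0)]

theorem source_one {p A κ ν z : ℝ} :
    source p A κ ν z 1 = (κ + ν) * (expWeight ν z * (ν + Real.exp z / 2)) := by
  simp [source]; ring

theorem source_nonneg {p A κ ν z m : ℝ} (hp : 1 < p) (hA : 0 < A) (hκ : 0 < κ) (hν : 0 < ν)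
    (hAν : A * (p - 1) ≤ (κ + ν) * ν) (hm : 0 ≤ m) (hm1 : m ≤ 1) :
    0 ≤ source p A κ ν z m :=
  (source_zero hp).symm.le.trans (source_mono hp hA hκ hν hAν le_rfl hm hm1)

/-- The source term with the value of the profile cut off at `1`. -/
noncomputable def truncSource (p A κ ν z : ℝ) (m : ℝ≥0∞) : ℝ≥0∞ :=
  ENNReal.ofReal (source p A κ ν z (min m 1).toReal)

theorem min_one_toReal_le (m : ℝ≥0∞) : (min m 1).toReal ≤ 1 := by
  have := ENNReal.toReal_mono ENNReal.one_ne_top (min_le_right m 1)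
  simpa using this

theorem truncSource_mono {p A κ ν : ℝ} (hp : 1 < p) (hA : 0 < A) (hκ : 0 < κ) (hν : 0 < ν)
    (hAν : A * (p - 1) ≤ (κ + ν) * ν) (z : ℝ) : Monotone (truncSource p A κ ν z) := by
  intro m m' h
  refine ENNReal.ofReal_le_ofReal (source_mono hp hA hκ hν hAν ENNReal.toReal_nonneg ?_
    (min_one_toReal_le m'))
  exact ENNReal.toReal_mono (by simp) (min_le_min_right 1 h)

theorem truncSource_ofReal {p A κ ν z m : ℝ} (hm : 0 ≤ m) (hm1 : m ≤ 1) :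
    truncSource p A κ ν z (ENNReal.ofReal m) = ENNReal.ofReal (source p A κ ν z m) := by
  rw [truncSource, min_eq_left (by simpa using hm1), ENNReal.toReal_ofReal hm]

theorem truncSource_le {p A κ ν : ℝ} (hp : 1 < p) (hA : 0 < A) (hκ : 0 < κ) (hν : 0 < ν)
    (hAν : A * (p - 1) ≤ (κ + ν) * ν) (z : ℝ) (m : ℝ≥0∞) :
    truncSource p A κ ν z m ≤ ENNReal.ofReal (source p A κ ν z 1) :=
  ENNReal.ofReal_le_ofReal (source_mono hp hA hκ hν hAν ENNReal.toReal_nonneg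
    (min_one_toReal_le m) le_rfl)

/-- The monotone integral operator whose fixed points solve the profile equation. -/
noncomputable def profileOp (p A κ ν : ℝ) (W : ℝ → ℝ≥0∞) (θ : ℝ) : ℝ≥0∞ :=
  ENNReal.ofReal (Real.exp ((κ + ν) * θ)) *
    ∫⁻ y in Ioi θ, ENNReal.ofReal (Real.exp (-((κ + ν) * y)) / expWeight ν y) *
      ∫⁻ z in Iic y, truncSource p A κ ν z (W z)

theorem profileOp_mono {p A κ ν : ℝ} (hp : 1 < p) (hA : 0 < A) (hκ : 0 < κ) (hν : 0 < ν)
    (hAν : A * (p - 1) ≤ (κ + ν) * ν) : Monotone (profileOp p A κ ν) := by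
  intro W W' h θ
  refine mul_le_mul_right (lintegral_mono fun y => mul_le_mul_right (lintegral_mono fun z => ?_) _) _
  exact truncSource_mono hp hA hκ hν hAν z (h z)

theorem lintegral_truncSource_le {p A κ ν : ℝ} (hp : 1 < p) (hA : 0 < A) (hκ : 0 < κ) (hν : 0 < ν)
    (hAν : A * (p - 1) ≤ (κ + ν) * ν) (W : ℝ → ℝ≥0∞) (y : ℝ) :
    ∫⁻ z in Iic y, truncSource p A κ ν z (W z) ≤ ENNReal.ofReal ((κ + ν) * expWeight ν y) := by
  refine (lintegral_mono fun z => truncSource_le hp hA hκ hν hAν z (W z)).trans ?_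
  refine lintegral_Iic_le_ofReal (H := fun y => (κ + ν) * expWeight ν y) y
    (fun x => (hasDerivAt_expWeight ν x).const_mul _)
    (continuous_source hp continuous_const)
    (fun x => source_nonneg hp hA hκ hν hAν zero_le_one le_rfl)
    (fun x _ => source_one.le) (fun x => ?_)
  have := expWeight_pos ν x
  positivity

theorem profileOp_le_of_le_exp {p A κ ν c β θ : ℝ} (hc : 0 ≤ c) (hβ : 0 ≤ β)
    {W : ℝ → ℝ≥0∞} (hW : ∀ y, θ ≤ y → ∫⁻ z in Iic y, truncSource p A κ ν z (W z) ≤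
      ENNReal.ofReal (expWeight ν y * (c * (β * Real.exp ((κ + ν - β) * y))))) :
    profileOp p A κ ν W θ ≤ ENNReal.ofReal (c * Real.exp ((κ + ν - β) * θ)) := by
  have key : ∫⁻ y in Ioi θ, ENNReal.ofReal (Real.exp (-((κ + ν) * y)) / expWeight ν y) *
      ∫⁻ z in Iic y, truncSource p A κ ν z (W z) ≤ ENNReal.ofReal (c * Real.exp (-β * θ)) := by
    have h1 : ∫⁻ y in Ioi θ, ENNReal.ofReal (Real.exp (-((κ + ν) * y)) / expWeight ν y) *
        ∫⁻ z in Iic y, truncSource p A κ ν z (W z) ≤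
        ∫⁻ y in Ioi θ, ENNReal.ofReal (c * (β * Real.exp (-β * y))) := by
      refine setLIntegral_mono' measurableSet_Ioi fun y hy => ?_
      have hE := expWeight_pos ν y
      refine (mul_le_mul_right (hW y (le_of_lt hy)) _).trans ?_
      rw [← ENNReal.ofReal_mul (by positivity)]
      refine ENNReal.ofReal_le_ofReal (le_of_eq ?_)
      have : Real.exp (-β * y) = Real.exp (-((κ + ν) * y)) * Real.exp ((κ + ν - β) * y) := by
        rw [← Real.exp_add]; ring_nf
      rw [this]; field_simp
    refine h1.trans (lintegral_Ioi_le_ofReal (H := fun y => c * Real.exp (-β * y))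
      (H' := fun y => c * (Real.exp (-β * y) * (-β))) θ (fun x => ?_) (by fun_prop)
      (fun x => by positivity) (fun x _ => le_of_eq (by ring)) (fun x => by positivity))
    simpa using (((hasDerivAt_id x).const_mul (-β)).exp).const_mul c
  refine (mul_le_mul_right key _).trans ?_
  rw [← ENNReal.ofReal_mul (by positivity)]
  refine ENNReal.ofReal_le_ofReal (le_of_eq ?_)
  have : Real.exp ((κ + ν - β) * θ) = Real.exp ((κ + ν) * θ) * Real.exp (-β * θ) := by
    rw [← Real.exp_add]; ring_nf
  rw [this]; ring

theorem profileOp_le_one {p A κ ν : ℝ} (hp : 1 < p) (hA : 0 < A) (hκ : 0 < κ) (hν : 0 < ν)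
    (hAν : A * (p - 1) ≤ (κ + ν) * ν) (W : ℝ → ℝ≥0∞) (θ : ℝ) : profileOp p A κ ν W θ ≤ 1 := by
  have := profileOp_le_of_le_exp (p := p) (A := A) (κ := κ) (ν := ν) (θ := θ) (W := W)
    (c := 1) (β := κ + ν) zero_le_one (by positivity) (fun y _ => ?_)
  · simpa using this
  · refine (lintegral_truncSource_le hp hA hκ hν hAν W y).trans (le_of_eq ?_)
    simp [mul_comm]

theorem profileOp_supersolution {p A κ ν R : ℝ} (hp : 1 < p) (hA : 0 < A) (hκ : 0 < κ)
    (hν : 0 < ν) (hAν : A * (p - 1) ≤ (κ + ν) * ν) (hR : 2 * (1 + κ + A) ≤ Real.exp R) :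
    profileOp p A κ ν (fun θ => ENNReal.ofReal (Real.exp (R - θ))) ≤
      fun θ => ENNReal.ofReal (Real.exp (R - θ)) := by
  intro θ
  rcases le_total θ R with hθ | hθ
  · refine (profileOp_le_one hp hA hκ hν hAν _ θ).trans ?_
    rw [← ENNReal.ofReal_one]
    exact ENNReal.ofReal_le_ofReal (Real.one_le_exp (by linarith))
  have hexp : ∀ z, Real.exp (R - z) = Real.exp R * Real.exp ((κ + ν - (κ + ν + 1)) * z) := by
    intro z; rw [← Real.exp_add]; ring_nf
  have main := profileOp_le_of_le_exp (p := p) (A := A) (κ := κ) (ν := ν) (θ := θ)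
    (W := fun θ => ENNReal.ofReal (Real.exp (R - θ)))
    (c := Real.exp R) (β := κ + ν + 1) (by positivity) (by positivity) (fun y hy => ?_)
  · simpa only [← hexp] using main
  have hRy : R ≤ y := hθ.trans hy
  have hg : ∀ z, HasDerivAt (fun z => Real.exp (R - z)) (-Real.exp (R - z)) z := by
    intro z
    simpa using ((hasDerivAt_id z).const_sub R).exp
  have hg₁ : ∀ z, HasDerivAt (fun z => -Real.exp (R - z)) (Real.exp (R - z)) z := by
    intro z
    simpa only [neg_neg] using (hg z).fun_neg
  have hflux := fun z => hasDerivAt_flux (p := p) (A := A) (κ := κ) (ν := ν) (hg z) (hg₁ z)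
  rw [← Iic_union_Ioc_eq_Iic hRy,
    lintegral_union measurableSet_Ioc (Iic_disjoint_Ioc le_rfl)]
  have hle1 : ∀ z, R ≤ z → Real.exp (R - z) ≤ 1 := fun z hz => Real.exp_le_one_iff.2 (by linarith)
  refine (add_le_add_left (lintegral_truncSource_le hp hA hκ hν hAν _ R) _).trans ?_
  rw [setLIntegral_congr_fun measurableSet_Ioc
    (fun z hz => truncSource_ofReal (Real.exp_pos _).le (hle1 z hz.1.le))]
  have hER := expWeight_pos ν R
  refine (ofReal_add_lintegral_Ioc_le hRy hflux
    (continuous_source hp (by fun_prop)).continuousOn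
    (fun z hz => source_nonneg hp hA hκ hν hAν (Real.exp_pos _).le (hle1 z hz.1))
    (fun z hz => ?_) (by positivity) ?_).trans (le_of_eq ?_)
  · have hE := expWeight_pos ν z
    have hez : Real.exp R ≤ Real.exp z := Real.exp_le_exp.2 hz.1
    have hpos := Real.exp_pos (R - z)
    have hpow : 0 ≤ Real.exp (R - z) ^ p := by positivity
    have : Real.exp (R - z) + (Real.exp z / 2 - κ) * -Real.exp (R - z) +
        A * (Real.exp (R - z) - Real.exp (R - z) ^ p) ≤ 0 := by
      nlinarith
    nlinarith
  · rw [sub_self, Real.exp_zero]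
    nlinarith
  · rw [hexp y]
    ring_nf

theorem le_profileOp_subsolution {p A κ ν μ θ₁ : ℝ} (hp : 1 < p) (hA : 0 < A) (hκ : 0 < κ)
    (hν : 0 < ν) (hAν : A * (p - 1) ≤ (κ + ν) * ν) (hμ : 0 < μ)
    (hθ₁ : μ + Real.exp θ₁ / 2 ≤ κ) :
    (fun θ => ENNReal.ofReal (1 - Real.exp (μ * (θ - θ₁)))) ≤
      profileOp p A κ ν (fun θ => ENNReal.ofReal (1 - Real.exp (μ * (θ - θ₁)))) := by
  intro θ
  rcases le_total θ₁ θ with hθ | hθ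
  · have : 1 - Real.exp (μ * (θ - θ₁)) ≤ 0 :=
      sub_nonpos.2 (Real.one_le_exp (mul_nonneg hμ.le (sub_nonneg.2 hθ)))
    simp [ENNReal.ofReal_of_nonpos this]
  set q : ℝ → ℝ := fun θ => Real.exp (μ * (θ - θ₁)) with hq
  have hqpos : ∀ z, 0 < q z := fun z => Real.exp_pos _
  have hq1 : ∀ z, z ≤ θ₁ → q z ≤ 1 := fun z hz =>
    Real.exp_le_one_iff.2 (mul_nonpos_of_nonneg_of_nonpos hμ.le (sub_nonpos.2 hz))
  have hqc : Continuous q := by fun_prop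
  have hqd : ∀ z, HasDerivAt q (μ * q z) z := fun z =>
    ((((hasDerivAt_id z).sub_const θ₁).const_mul μ).exp).congr_deriv (by simp [hq, mul_comm])
  have hg : ∀ z, HasDerivAt (fun z => 1 - q z) (-(μ * q z)) z := fun z => (hqd z).const_sub 1
  have hg₁ : ∀ z, HasDerivAt (fun z => -(μ * q z)) (-(μ * (μ * q z))) z := fun z =>
    ((hqd z).const_mul μ).fun_neg
  have hflux := fun z => hasDerivAt_flux (p := p) (A := A) (κ := κ) (ν := ν) (hg z) (hg₁ z)
  have hlim : Tendsto (fun z => expWeight ν z * ((κ + ν) * (1 - q z) - -(μ * q z))) atBot (𝓝 0) := by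
    have h1 : Tendsto (expWeight ν) atBot (𝓝 0) := by
      refine Real.tendsto_exp_atBot.comp ?_
      exact (tendsto_id.const_mul_atBot hν).atBot_add (Real.tendsto_exp_atBot.div_const 2)
    have h2 : Tendsto q atBot (𝓝 0) := by
      refine Real.tendsto_exp_atBot.comp (Tendsto.const_mul_atBot hμ ?_)
      exact tendsto_atBot_add_const_right _ _ tendsto_id
    simpa using h1.mul (((h2.const_sub 1).const_mul (κ + ν)).sub ((h2.const_mul μ).neg))
  have hinner : ∀ y ≤ θ₁, ENNReal.ofReal (expWeight ν y * ((κ + ν) * (1 - q y) - -(μ * q y))) ≤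
      ∫⁻ z in Iic y, truncSource p A κ ν z (ENNReal.ofReal (1 - q z)) := by
    intro y hy
    have hm : ∀ z ≤ y, 0 ≤ 1 - q z ∧ 1 - q z ≤ 1 := fun z hz =>
      ⟨sub_nonneg.2 (hq1 z (hz.trans hy)), sub_le_self _ (hqpos z).le⟩
    rw [setLIntegral_congr_fun measurableSet_Iic
      (fun z hz => truncSource_ofReal (hm z hz).1 (hm z hz).2)]
    refine ofReal_le_lintegral_Iic y hflux (continuous_source hp (by fun_prop))
      (fun z hz => source_nonneg hp hA hκ hν hAν (hm z hz).1 (hm z hz).2) (fun z hz => ?_) hlim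
    refine sub_le_self _ (mul_nonneg (expWeight_pos ν z).le ?_)
    have hpow : (1 - q z) ^ p ≤ 1 - q z := by
      simpa using Real.rpow_le_rpow_of_exponent_ge' (hm z hz).1 (hm z hz).2 zero_le_one hp.le
    have hez : Real.exp z ≤ Real.exp θ₁ := Real.exp_le_exp.2 (hz.trans hy)
    have h1 : 0 ≤ A * (1 - q z - (1 - q z) ^ p) := mul_nonneg hA.le (sub_nonneg.2 hpow)
    have h2 : 0 ≤ μ * q z * (κ - μ - Real.exp z / 2) :=
      mul_nonneg (mul_pos hμ (hqpos z)).le (by linarith)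
    linarith
  have houter : ENNReal.ofReal (Real.exp (-((κ + ν) * θ)) * (1 - q θ)) ≤
      ∫⁻ y in Ioi θ, ENNReal.ofReal (Real.exp (-((κ + ν) * y)) / expWeight ν y) *
        ∫⁻ z in Iic y, truncSource p A κ ν z (ENNReal.ofReal (1 - q z)) := by
    have hd : ∀ y, HasDerivAt (fun y => -(Real.exp (-((κ + ν) * y)) * (1 - q y)))
        (Real.exp (-((κ + ν) * y)) * ((κ + ν) * (1 - q y) - -(μ * q y))) y := fun y =>
      ((((hasDerivAt_id y).const_mul (κ + ν)).fun_neg.exp).mul (hg y)).fun_neg.congr_deriv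
        (by simp; ring)
    have h := ofReal_sub_le_lintegral_Ioc hθ hd
      (f := fun y => Real.exp (-((κ + ν) * y)) * ((κ + ν) * (1 - q y) - -(μ * q y)))
      (by fun_prop) (fun y hy => ?_) (fun y _ => le_rfl)
    · refine le_trans (le_of_eq ?_) (h.trans
        ((setLIntegral_mono' measurableSet_Ioc fun y hy => ?_).trans
          (lintegral_mono_set Ioc_subset_Ioi_self)))
      · have : q θ₁ = 1 := by simp [hq]
        simp [this]
      · refine le_trans (le_of_eq ?_) (mul_le_mul_right (hinner y hy.2) _)
        have hE := expWeight_pos ν y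
        rw [← ENNReal.ofReal_mul (by positivity)]
        congr 1
        field_simp
    · have h1 := hq1 y hy.2
      have h2 := hqpos y
      have h3 : 0 ≤ 1 - q y := sub_nonneg.2 h1
      rw [sub_neg_eq_add]
      positivity
  refine le_trans (le_of_eq ?_) (mul_le_mul_right houter _)
  rw [← ENNReal.ofReal_mul (Real.exp_pos _).le, ← mul_assoc, ← Real.exp_add]
  simp [hq]

theorem measurable_of_profileOp_eq {p A κ ν : ℝ} {W : ℝ → ℝ≥0∞} (hW : profileOp p A κ ν W = W) :
    Measurable W := by
  rw [← hW]
  refine Measurable.mul (by fun_prop) (Antitone.measurable fun a b h => ?_)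
  exact lintegral_mono_set (Ioi_subset_Ioi h)

theorem hasDerivAt_of_profileOp_eq {p A κ ν : ℝ} (hp : 1 < p) (hA : 0 < A) (hκ : 0 < κ)
    (hν : 0 < ν) (hAν : A * (p - 1) ≤ (κ + ν) * ν) {W : ℝ → ℝ≥0∞}
    (hW : profileOp p A κ ν W = W) :
    ∃ g₁ : ℝ → ℝ, (∀ θ, HasDerivAt (fun θ => (W θ).toReal) (g₁ θ) θ) ∧
      ∀ θ, HasDerivAt g₁ (A * ((W θ).toReal ^ p - (W θ).toReal) -
        (Real.exp θ / 2 - κ) * g₁ θ) θ := by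
  have hW1 : ∀ θ, W θ ≤ 1 := fun θ => by
    have := profileOp_le_one hp hA hκ hν hAν W θ
    rwa [hW] at this
  set g : ℝ → ℝ := fun θ => (W θ).toReal with hg
  have hWg : ∀ θ, W θ = ENNReal.ofReal (g θ) := fun θ =>
    (ENNReal.ofReal_toReal ((hW1 θ).trans_lt ENNReal.one_lt_top).ne).symm
  have hg0 : ∀ θ, 0 ≤ g θ := fun θ => ENNReal.toReal_nonneg
  have hg1 : ∀ θ, g θ ≤ 1 := fun θ => by
    simpa using ENNReal.toReal_mono ENNReal.one_ne_top (hW1 θ)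
  have hgm : Measurable g := (measurable_of_profileOp_eq hW).ennreal_toReal
  set f : ℝ → ℝ := fun z => source p A κ ν z (g z) with hf
  have hEc := continuous_expWeight ν
  have hE := expWeight_pos ν
  have hf0 : ∀ z, 0 ≤ f z := fun z => source_nonneg hp hA hκ hν hAν (hg0 z) (hg1 z)
  have hfm : Measurable f := by
    have := hEc.measurable
    unfold f source
    fun_prop
  have hkf : ∀ z, truncSource p A κ ν z (W z) = ENNReal.ofReal (f z) := fun z => by
    rw [hWg, truncSource_ofReal (hg0 z) (hg1 z)]
  have hfi : ∀ b, IntegrableOn f (Iic b) := fun b => by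
    refine ⟨hfm.aestronglyMeasurable, ?_⟩
    rw [hasFiniteIntegral_iff_ofReal (.of_forall hf0)]
    simp_rw [← hkf]
    exact (lintegral_truncSource_le hp hA hκ hν hAν W b).trans_lt ENNReal.ofReal_lt_top
  set J : ℝ → ℝ := fun y => ∫ z in Iic y, f z with hJ
  have hJ0 : ∀ y, 0 ≤ J y := fun y => integral_nonneg hf0
  have hJc : Continuous J := continuous_integral_Iic hfi
  have hkJ : ∀ y, ∫⁻ z in Iic y, truncSource p A κ ν z (W z) = ENNReal.ofReal (J y) := fun y => by
    simp_rw [hkf]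
    exact (ofReal_integral_eq_lintegral_ofReal (hfi y) (.of_forall hf0)).symm
  set h : ℝ → ℝ := fun y => Real.exp (-((κ + ν) * y)) / expWeight ν y * J y with hh
  have hhc : Continuous h :=
    (Continuous.div (by fun_prop) hEc fun y => (hE y).ne').mul hJc
  have hh0 : ∀ y, 0 ≤ h y := fun y => by have := hE y; have := hJ0 y; positivity
  have hWh : ∀ θ, W θ = ENNReal.ofReal (Real.exp ((κ + ν) * θ)) *
      ∫⁻ y in Ioi θ, ENNReal.ofReal (h y) := fun θ => by
    conv_lhs => rw [← hW, profileOp]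
    congr 2
    ext y
    rw [hkJ, ← ENNReal.ofReal_mul (by have := hE y; positivity)]
  have hhi : ∀ b, IntegrableOn h (Ioi b) := fun b => by
    refine ⟨hhc.aestronglyMeasurable, ?_⟩
    rw [hasFiniteIntegral_iff_ofReal (.of_forall hh0)]
    have h1 : ENNReal.ofReal (Real.exp ((κ + ν) * b)) *
      ∫⁻ y in Ioi b, ENNReal.ofReal (h y) < ⊤ := hWh b ▸ (hW1 b).trans_lt ENNReal.one_lt_top
    refine ENNReal.lt_top_of_mul_ne_top_right h1.ne ?_
    simp [Real.exp_pos]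
  have hgh : g = fun θ => Real.exp ((κ + ν) * θ) * ∫ y in Ioi θ, h y := by
    ext θ
    rw [hg]
    beta_reduce
    rw [hWh, ← ofReal_integral_eq_lintegral_ofReal (hhi θ) (.of_forall hh0),
      ENNReal.toReal_mul, ENNReal.toReal_ofReal (Real.exp_pos _).le,
      ENNReal.toReal_ofReal (integral_nonneg hh0)]
  have hexp : ∀ θ, Real.exp ((κ + ν) * θ) * Real.exp (-((κ + ν) * θ)) = 1 := fun θ => by
    rw [← Real.exp_add]; simp
  have hgd : ∀ θ, HasDerivAt g ((κ + ν) * g θ - J θ / expWeight ν θ) θ := fun θ => by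
    have hd := (((hasDerivAt_id θ).const_mul (κ + ν)).exp).fun_mul (hasDerivAt_integral_Ioi hhi hhc θ)
    have hgθ : g θ = Real.exp ((κ + ν) * θ) * ∫ y in Ioi θ, h y := congrFun hgh θ
    rw [hgθ, hgh]
    refine hd.congr_deriv ?_
    simp only [id, hh, mul_one]
    linear_combination (-(J θ / expWeight ν θ)) * hexp θ
  have hgc : Continuous g := continuous_iff_continuousAt.2 fun θ => (hgd θ).continuousAt
  have hfc : Continuous f := continuous_source hp hgc
  refine ⟨_, hgd, fun θ => ?_⟩
  refine (((hgd θ).const_mul (κ + ν)).sub ((hasDerivAt_integral_Iic hfi hfc θ).div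
    (hasDerivAt_expWeight ν θ) (hE θ).ne')).congr_deriv ?_
  have hE' := (hE θ).ne'
  have hfθ : f θ = expWeight ν θ * ((κ + ν) * (ν + Real.exp θ / 2) * g θ + A * (g θ - g θ ^ p)) := rfl
  change (κ + ν) * ((κ + ν) * g θ - J θ / expWeight ν θ) - (f θ * expWeight ν θ -
    J θ * (expWeight ν θ * (ν + Real.exp θ / 2))) / expWeight ν θ ^ 2 = A * (g θ ^ p - g θ) -
    (Real.exp θ / 2 - κ) * ((κ + ν) * g θ - J θ / expWeight ν θ)
  rw [hfθ]
  generalize J θ = j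
  generalize g θ ^ p = gp
  field_simp
  ring

theorem exists_decaying_profile {p A κ : ℝ} (hp : 1 < p) (hA : 0 < A) (hκ : 0 < κ) :
    ∃ g g₁ : ℝ → ℝ, (∀ θ, HasDerivAt g (g₁ θ) θ) ∧
      (∀ θ, HasDerivAt g₁ (A * (g θ ^ p - g θ) - (Real.exp θ / 2 - κ) * g₁ θ) θ) ∧
      (∀ θ, 0 ≤ g θ) ∧ (∃ C, 0 ≤ C ∧ ∀ θ, g θ ≤ C * Real.exp (-θ)) ∧ ∃ θ, g θ ≠ 0 := by
  set ν := A * (p - 1) / κ with hνdef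
  have hp1 : 0 < p - 1 := sub_pos.2 hp
  have hν : 0 < ν := by positivity
  have hAν : A * (p - 1) ≤ (κ + ν) * ν := by
    have : κ * ν = A * (p - 1) := by rw [hνdef]; field_simp
    nlinarith
  set R := Real.log (2 * (1 + κ + A)) with hR
  have hRexp : Real.exp R = 2 * (1 + κ + A) := Real.exp_log (by positivity)
  set θ₁ := Real.log κ with hθ₁
  have hθexp : Real.exp θ₁ = κ := Real.exp_log hκ
  have hθR : θ₁ ≤ R := Real.log_le_log hκ (by linarith)
  obtain ⟨W, hW, hsub, hsup⟩ := exists_fixedPoint_between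
    (profileOp_mono hp hA hκ hν hAν)
    (x := fun θ => ENNReal.ofReal (1 - Real.exp (κ / 2 * (θ - θ₁))))
    (y := fun θ => ENNReal.ofReal (Real.exp (R - θ)))
    (fun θ => by
      refine ENNReal.ofReal_le_ofReal ?_
      rcases le_total θ R with h | h
      · linarith [Real.one_le_exp (sub_nonneg.2 h), Real.exp_pos (κ / 2 * (θ - θ₁))]
      · have : 1 ≤ Real.exp (κ / 2 * (θ - θ₁)) :=
          Real.one_le_exp (mul_nonneg (by positivity) (by linarith))
        linarith [Real.exp_pos (R - θ)])
    (le_profileOp_subsolution hp hA hκ hν hAν (by positivity) (by rw [hθexp]; linarith))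
    (profileOp_supersolution hp hA hκ hν hAν hRexp.ge)
  obtain ⟨g₁, hg, hg₁⟩ := hasDerivAt_of_profileOp_eq hp hA hκ hν hAν hW
  refine ⟨_, g₁, hg, hg₁, fun θ => ENNReal.toReal_nonneg, ⟨Real.exp R, by positivity, fun θ => ?_⟩,
    θ₁ - 1, ?_⟩
  · refine (ENNReal.toReal_mono ENNReal.ofReal_ne_top (hsup θ)).trans (le_of_eq ?_)
    rw [ENNReal.toReal_ofReal (by positivity), ← Real.exp_add, sub_eq_add_neg]
  · refine (ENNReal.toReal_pos (ne_of_gt (lt_of_lt_of_le ?_ (hsub (θ₁ - 1))))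
      (ne_top_of_le_ne_top ENNReal.ofReal_ne_top (hsup _))).ne'
    rw [ENNReal.ofReal_pos, sub_pos, Real.exp_lt_one_iff]
    linarith

theorem hasFDerivAt_log_norm_sq {d : ℕ} {x : EuclideanSpace ℝ (Fin d)} (hx : x ≠ 0) :
    HasFDerivAt (fun y : EuclideanSpace ℝ (Fin d) => Real.log (‖y‖ ^ 2))
      ((‖x‖ ^ 2)⁻¹ • (2 • innerSL ℝ x)) x :=
  (hasStrictFDerivAt_norm_sq x).hasFDerivAt.log (by positivity)

theorem pd_comp_log_norm_sq {d : ℕ} {Q : ℝ → ℝ} {Q' : ℝ} {x : EuclideanSpace ℝ (Fin d)}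
    (hx : x ≠ 0) (hQ : HasDerivAt Q Q' (Real.log (‖x‖ ^ 2))) (i : Fin d) :
    pd i (fun y => Q (Real.log (‖y‖ ^ 2))) x = Q' * (2 * x i / ‖x‖ ^ 2) := by
  have h : HasFDerivAt (fun y => Q (Real.log (‖y‖ ^ 2))) _ x :=
    hQ.comp_hasFDerivAt x (hasFDerivAt_log_norm_sq hx)
  have hi : innerSL ℝ x (EuclideanSpace.single i 1) = x i := by
    simp [EuclideanSpace.inner_single_right]
  rw [pd, h.fderiv]
  simp only [smul_apply, hi, smul_eq_mul, nsmul_eq_mul, Nat.cast_ofNat]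
  ring

theorem pd_pd_comp_log_norm_sq {d : ℕ} {Q Q₁ : ℝ → ℝ} {Q₂ : ℝ} {x : EuclideanSpace ℝ (Fin d)}
    (hx : x ≠ 0) (hQ : ∀ s, HasDerivAt Q (Q₁ s) s)
    (hQ₁ : HasDerivAt Q₁ Q₂ (Real.log (‖x‖ ^ 2))) (i : Fin d) :
    pd i (pd i (fun y => Q (Real.log (‖y‖ ^ 2)))) x =
      Q₂ * (2 * x i / ‖x‖ ^ 2) ^ 2 +
        Q₁ (Real.log (‖x‖ ^ 2)) * (2 / ‖x‖ ^ 2 - (2 * x i / ‖x‖ ^ 2) ^ 2) := by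
  have hev : pd i (fun y => Q (Real.log (‖y‖ ^ 2))) =ᶠ[𝓝 x]
      fun y => Q₁ (Real.log (‖y‖ ^ 2)) * (2 * y i * (‖y‖ ^ 2)⁻¹) := by
    filter_upwards [isOpen_compl_singleton.mem_nhds hx] with y hy
    rw [pd_comp_log_norm_sq hy (hQ _), div_eq_mul_inv]
  have hn : ‖x‖ ^ 2 ≠ 0 := by positivity
  have h1 := hQ₁.comp_hasFDerivAt x (hasFDerivAt_log_norm_sq hx)
  have h2 : HasFDerivAt (fun y : EuclideanSpace ℝ (Fin d) => y i)
      (EuclideanSpace.proj i : EuclideanSpace ℝ (Fin d) →L[ℝ] ℝ) x :=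
    (EuclideanSpace.proj i : EuclideanSpace ℝ (Fin d) →L[ℝ] ℝ).hasFDerivAt
  have h3 := (hasDerivAt_inv hn).comp_hasFDerivAt x (hasStrictFDerivAt_norm_sq x).hasFDerivAt
  have h := h1.mul ((h2.const_mul 2).mul h3)
  have h' : HasFDerivAt (fun y => Q₁ (Real.log (‖y‖ ^ 2)) * (2 * y i * (‖y‖ ^ 2)⁻¹)) _ x := h
  rw [pd, hev.fderiv_eq, h'.fderiv]
  simp [EuclideanSpace.inner_single_right]
  field_simp
  ring

theorem sum_pd_pd_comp_log_norm_sq {d : ℕ} {Q Q₁ : ℝ → ℝ} {Q₂ : ℝ} {x : EuclideanSpace ℝ (Fin d)}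
    (hx : x ≠ 0) (hQ : ∀ s, HasDerivAt Q (Q₁ s) s)
    (hQ₁ : HasDerivAt Q₁ Q₂ (Real.log (‖x‖ ^ 2))) :
    ∑ i, pd i (pd i (fun y => Q (Real.log (‖y‖ ^ 2)))) x =
      (4 * Q₂ + (2 * d - 4) * Q₁ (Real.log (‖x‖ ^ 2))) / ‖x‖ ^ 2 := by
  have hn : ‖x‖ ^ 2 ≠ 0 := by positivity
  have hs : ∑ i, (2 * x i / ‖x‖ ^ 2) ^ 2 = 4 / ‖x‖ ^ 2 := by
    have h : ∑ i, x i ^ 2 = ‖x‖ ^ 2 := by simp [EuclideanSpace.norm_sq_eq]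
    simp_rw [div_pow, mul_pow]
    rw [← Finset.sum_div, ← Finset.mul_sum, h]
    field_simp
    norm_num
  simp_rw [pd_pd_comp_log_norm_sq hx hQ hQ₁]
  rw [Finset.sum_add_distrib, ← Finset.mul_sum, ← Finset.mul_sum, Finset.sum_sub_distrib, hs]
  simp
  field_simp

theorem contDiff_two_of_hasDerivAt {g g₁ g₂ : ℝ → ℝ} (hg : ∀ θ, HasDerivAt g (g₁ θ) θ)
    (hg₁ : ∀ θ, HasDerivAt g₁ (g₂ θ) θ) (hc : Continuous g₂) : ContDiff ℝ 2 g := by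
  have h1 : ContDiff ℝ 1 g₁ := contDiff_one_iff_deriv.2
    ⟨fun θ => (hg₁ θ).differentiableAt, by rwa [funext fun θ => (hg₁ θ).deriv]⟩
  rw [← one_add_one_eq_two, contDiff_succ_iff_deriv]
  refine ⟨fun θ => (hg θ).differentiableAt, by simp, ?_⟩
  rwa [funext fun θ => (hg θ).deriv]

/-- Theorem BP, part (1): for `d ≥ 2`, `p > 1` with `d < 2p/(p−1)`,
there is a nontrivial nonnegative classical solution of `u_t = (1/2)Δu − u^p`
on the punctured space `ℝ^d ∖ {0}` with zero initial data. -/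
theorem stmt_14 {d : ℕ} (hd : 2 ≤ d) (p : ℝ) (hp : 1 < p)
    (hdim : (d : ℝ) < 2 * p / (p - 1)) :
    ∃ u : EuclideanSpace ℝ (Fin d) → ℝ → ℝ,
      ContinuousOn (fun q : EuclideanSpace ℝ (Fin d) × ℝ => u q.1 q.2)
        (({0}ᶜ : Set (EuclideanSpace ℝ (Fin d))) ×ˢ Ici (0 : ℝ)) ∧
      (∀ x : EuclideanSpace ℝ (Fin d), x ≠ 0 → ∀ t, 0 ≤ t → 0 ≤ u x t) ∧
      (∀ t : ℝ, 0 < t →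
        ContDiffOn ℝ 2 (fun x => u x t) ({0}ᶜ : Set (EuclideanSpace ℝ (Fin d)))) ∧
      (∀ x : EuclideanSpace ℝ (Fin d), x ≠ 0 →
        ContDiffOn ℝ 1 (fun s => u x s) (Ioi (0 : ℝ))) ∧
      (∀ x : EuclideanSpace ℝ (Fin d), x ≠ 0 → ∀ t, 0 < t →
        deriv (fun s => u x s) t =
          (1 / 2) * (∑ i, pd i (pd i (fun y => u y t)) x) - u x t ^ p) ∧
      (∀ x : EuclideanSpace ℝ (Fin d), x ≠ 0 → u x 0 = 0) ∧
      (∃ x : EuclideanSpace ℝ (Fin d), x ≠ 0 ∧ ∃ t, 0 ≤ t ∧ u x t ≠ 0) := by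
  have hp1 : 0 < p - 1 := sub_pos.2 hp
  set a : ℝ := 1 / (p - 1) with ha
  have ha0 : 0 < a := by positivity
  have hap : a * p = a + 1 := by rw [ha]; field_simp; ring
  have hda : (d : ℝ) < 2 * a + 2 := by
    convert hdim using 1
    rw [ha]; field_simp; ring
  have hb : 0 < 2 * a + 2 - d := by linarith
  set A : ℝ := a * (2 * a + 2 - d) / 2 with hA
  have hA0 : 0 < A := by positivity
  set κ : ℝ := (4 * a - d + 2) / 2 with hκ
  have hκ0 : 0 < κ := by rw [hκ]; linarith
  obtain ⟨g, g₁, hg, hg₁, hg0, ⟨C, hC0, hC⟩, θ₀, hθ₀⟩ := exists_decaying_profile hp hA0 hκ0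
  set g₂ : ℝ → ℝ := fun θ => A * (g θ ^ p - g θ) - (Real.exp θ / 2 - κ) * g₁ θ with hg₂
  have hgc : Continuous g := continuous_iff_continuousAt.2 fun θ => (hg θ).continuousAt
  have hg₁c : Continuous g₁ := continuous_iff_continuousAt.2 fun θ => (hg₁ θ).continuousAt
  have hgC2 : ContDiff ℝ 2 g := by
    refine contDiff_two_of_hasDerivAt hg hg₁ ?_
    have : Continuous fun θ => g θ ^ p := hgc.rpow_const fun _ => Or.inr (by linarith)
    fun_prop
  set c : ℝ := (2 * A) ^ a with hc
  have hc0 : 0 < c := by positivity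
  have hcp : c ^ p = c * (2 * A) := by
    rw [hc, ← Real.rpow_mul (by positivity), hap, Real.rpow_add (by positivity), Real.rpow_one]
  set v : EuclideanSpace ℝ (Fin d) → ℝ → ℝ := fun x t =>
    c * Real.exp (-(a * Real.log (‖x‖ ^ 2))) * g (Real.log (‖x‖ ^ 2) - Real.log t) with hv
  set u : EuclideanSpace ℝ (Fin d) → ℝ → ℝ := fun x t => if t ≤ 0 then 0 else v x t with hu
  have hv0 : ∀ x t, 0 ≤ v x t := fun x t => by have := hg0 (Real.log (‖x‖ ^ 2) - Real.log t); positivity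
  have huv : ∀ x t, 0 < t → u x t = v x t := fun x t ht => by simp [hu, ht]
  have hu0 : ∀ x t, t ≤ 0 → u x t = 0 := fun x t ht => by simp [hu, ht]
  have hunn : ∀ x t, 0 ≤ u x t := fun x t => by
    rcases le_or_gt t 0 with h | h
    · rw [hu0 x t h]
    · rw [huv x t h]; exact hv0 x t
  have hbound : ∀ x : EuclideanSpace ℝ (Fin d), ∀ t,
      u x t ≤ c * C * Real.exp (-((a + 1) * Real.log (‖x‖ ^ 2))) * |t| := by
    intro x t
    rcases le_or_gt t 0 with h | h
    · rw [hu0 x t h]; positivity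
    · rw [huv x t h, hv, abs_of_pos h]
      refine (mul_le_mul_of_nonneg_left (hC _) (by positivity)).trans (le_of_eq ?_)
      have h1 : Real.exp (-(Real.log (‖x‖ ^ 2) - Real.log t)) =
          Real.exp (-Real.log (‖x‖ ^ 2)) * t := by
        rw [neg_sub, sub_eq_neg_add, Real.exp_add, Real.exp_log h]
      have h2 : Real.exp (-((a + 1) * Real.log (‖x‖ ^ 2))) =
          Real.exp (-(a * Real.log (‖x‖ ^ 2))) * Real.exp (-Real.log (‖x‖ ^ 2)) := by
        rw [← Real.exp_add]; ring_nf
      rw [h1, h2]; ring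
  refine ⟨u, ?_, fun x _ t _ => hunn x t, ?_, ?_, ?_, fun x _ => hu0 x 0 le_rfl, ?_⟩
  · rintro ⟨x, t⟩ ⟨hx, ht⟩
    have hx : x ≠ 0 := hx
    refine ContinuousAt.continuousWithinAt ?_
    have hL : ContinuousAt (fun q : EuclideanSpace ℝ (Fin d) × ℝ => Real.log (‖q.1‖ ^ 2)) (x, t) :=
      ContinuousAt.log (by fun_prop) (by simpa using hx)
    rcases (mem_Ici.1 ht).eq_or_lt with rfl | ht
    · have hB : ContinuousAt (fun q : EuclideanSpace ℝ (Fin d) × ℝ =>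
          c * C * Real.exp (-((a + 1) * Real.log (‖q.1‖ ^ 2))) * |q.2|) (x, 0) := by fun_prop
      have hB' := hB.tendsto
      simp only [abs_zero, mul_zero] at hB'
      have := squeeze_zero (fun q : EuclideanSpace ℝ (Fin d) × ℝ => hunn q.1 q.2)
        (fun q => hbound q.1 q.2) hB'
      rwa [ContinuousAt, hu0 x 0 le_rfl]
    · have hev : (fun q : EuclideanSpace ℝ (Fin d) × ℝ => u q.1 q.2) =ᶠ[𝓝 (x, t)]
          fun q => v q.1 q.2 := by
        filter_upwards [continuous_snd.continuousAt.eventually (lt_mem_nhds ht)] with q hq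
        exact huv _ _ hq
      refine ContinuousAt.congr ?_ hev.symm
      have hT : ContinuousAt (fun q : EuclideanSpace ℝ (Fin d) × ℝ => Real.log q.2) (x, t) :=
        ContinuousAt.log (by fun_prop) ht.ne'
      have hgL := hgc.continuousAt.comp (hL.sub hT)
      exact ((hL.const_mul a).neg.rexp.const_mul c).mul hgL
  · intro t ht
    refine ContDiffOn.congr (f := fun x => v x t) ?_ fun x _ => huv x t ht
    have hL : ContDiffOn ℝ 2 (fun x : EuclideanSpace ℝ (Fin d) => Real.log (‖x‖ ^ 2)) {0}ᶜ :=
      ((contDiff_norm_sq ℝ).contDiffOn).log fun x hx => by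
        have : x ≠ 0 := hx
        positivity
    exact (contDiffOn_const.mul (contDiffOn_const.mul hL).neg.exp).mul
      (hgC2.comp_contDiffOn (hL.sub contDiffOn_const))
  · intro x hx
    refine ContDiffOn.congr (f := fun t => v x t) ?_ fun t ht => huv x t ht
    have hT : ContDiffOn ℝ 1 Real.log (Ioi 0) :=
      contDiffOn_id.log fun t ht => ne_of_gt ht
    exact contDiffOn_const.mul
      ((hgC2.of_le one_le_two).comp_contDiffOn (contDiffOn_const.sub hT))
  · intro x hx t ht
    have hn : 0 < ‖x‖ ^ 2 := by positivity
    set L := Real.log (‖x‖ ^ 2) with hL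
    have heL : Real.exp L = ‖x‖ ^ 2 := Real.exp_log hn
    set τ := Real.log t with hτ
    have hdt : HasDerivAt (fun s => u x s)
        (c * Real.exp (-(a * L)) * (g₁ (L - τ) * -t⁻¹)) t := by
      have h1 : HasDerivAt (fun s => v x s) _ t :=
        ((hg (L - τ)).comp t ((Real.hasDerivAt_log ht.ne').const_sub L)).const_mul
          (c * Real.exp (-(a * L)))
      refine h1.congr_of_eventuallyEq ?_
      filter_upwards [lt_mem_nhds ht] with s hs
      exact huv x s hs
    have hQ₀ : ∀ G G' : ℝ → ℝ, (∀ θ, HasDerivAt G (G' θ) θ) → ∀ s,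
        HasDerivAt (fun s => c * Real.exp (-(a * s)) * G (s - τ))
          (c * Real.exp (-(a * s)) * (G' (s - τ) - a * G (s - τ))) s := by
      intro G G' hG s
      have h1 : HasDerivAt (fun s => c * Real.exp (-(a * s)))
          (c * (Real.exp (-(a * s)) * -a)) s := by
        simpa using (((hasDerivAt_id s).const_mul a).fun_neg.exp).const_mul c
      have h2 : HasDerivAt (fun s => G (s - τ)) (G' (s - τ)) s := (hG _).comp_sub_const s τ
      exact (h1.mul h2).congr_deriv (by ring)
    have hQ := hQ₀ g g₁ hg
    have hQ₁ := hQ₀ (fun θ => g₁ θ - a * g θ) (fun θ => g₂ θ - a * g₁ θ)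
      (fun θ => (hg₁ θ).sub ((hg θ).const_mul a))
    have huL : (fun y => u y t) =
        fun y => (fun s => c * Real.exp (-(a * s)) * g (s - τ)) (Real.log (‖y‖ ^ 2)) :=
      funext fun y => huv y t ht
    have hlap := sum_pd_pd_comp_log_norm_sq hx hQ (hQ₁ L)
    rw [hdt.deriv, huL, hlap, huv x t ht]
    have hpow : v x t ^ p = c * (2 * A) * (Real.exp (-(a * L)) * (‖x‖ ^ 2)⁻¹) * g (L - τ) ^ p := by
      have hvx : v x t = c * Real.exp (-(a * L)) * g (L - τ) := rfl
      have he : -(a * L) * p = -(a * L) + -L := by linear_combination (-L) * hap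
      rw [hvx, Real.mul_rpow (by positivity) (hg0 _), Real.mul_rpow hc0.le (Real.exp_pos _).le, hcp,
        ← Real.exp_mul, he, Real.exp_add, Real.exp_neg L, heL]
    have heτ : Real.exp (L - τ) = ‖x‖ ^ 2 / t := by
      rw [Real.exp_sub, heL, hτ, Real.exp_log ht]
    rw [hpow, ← hL]
    simp only [hg₂, heτ]
    rw [hA, hκ]
    field_simp
    ring
  · have : Nontrivial (EuclideanSpace ℝ (Fin d)) := by
      have : Nonempty (Fin d) := ⟨⟨0, by omega⟩⟩
      infer_instance
    obtain ⟨x, hx⟩ := exists_ne (0 : EuclideanSpace ℝ (Fin d))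
    have ht : 0 < Real.exp (Real.log (‖x‖ ^ 2) - θ₀) := Real.exp_pos _
    refine ⟨x, hx, _, ht.le, ?_⟩
    rw [huv x _ ht, hv]
    beta_reduce
    rw [Real.log_exp, sub_sub_cancel]
    have := Real.exp_pos (-(a * Real.log (‖x‖ ^ 2)))
    positivity
end

section
/- Let d ≥ 2 and p > 1 with d ≥ 2p/(p−1). Then the only function u : (ℝ^d ∖ {0}) × [0,∞) → ℝ that is continuous, nonnegative, twice continuously differentiable in x and once in t on (ℝ^d ∖ {0}) × (0,∞), satisfies ∂u/∂t = (1/2)Δu − u^p on (ℝ^d ∖ {0}) × (0,∞), and satisfies u(x,0) = 0 for all x ∈ ℝ^d ∖ {0}, is u ≡ 0. -/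
open Set

open Filter Topology

theorem second_deriv_nonpos_of_isLocalMax {g g' : ℝ → ℝ} {a c : ℝ}
    (hg : ∀ᶠ s in 𝓝 a, HasDerivAt g (g' s) s) (hg' : HasDerivAt g' c a)
    (hmax : IsLocalMax g a) : c ≤ 0 := by
  by_contra! hc
  have hderiv : deriv g =ᶠ[𝓝 a] g' := hg.mono fun s hs => hs.deriv
  have hc' : deriv (deriv g) a = c := hderiv.deriv_eq.trans hg'.deriv
  have hmin : IsLocalMin g a := isLocalMin_of_deriv_deriv_pos (by rwa [hc'])
    hmax.deriv_eq_zero hg.self_of_nhds.continuousAt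
  have hconst : g =ᶠ[𝓝 a] fun _ => g a := by
    filter_upwards [hmax, hmin] with s h1 h2 using le_antisymm h1 h2
  have h0 : deriv g =ᶠ[𝓝 a] fun _ => 0 := by
    simpa using hconst.deriv
  have := h0.deriv_eq
  simp [hc'] at this
  exact hc.ne' this

theorem deriv_nonneg_of_le_left {g : ℝ → ℝ} {t c : ℝ} (ht : 0 < t) (hg : HasDerivAt g c t)
    (hle : ∀ s ∈ Icc 0 t, g s ≤ g t) : 0 ≤ c := by
  have h := (hasDerivAt_iff_tendsto_slope.1 hg).mono_left
    (nhdsWithin_mono t (fun s (hs : s ∈ Iio t) => ne_of_lt hs))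
  refine ge_of_tendsto h ?_
  filter_upwards [Ioo_mem_nhdsLT ht] with s hs
  rw [slope_def_field]
  exact div_nonneg_of_nonpos (by linarith [hle s ⟨hs.1.le, hs.2.le⟩]) (by linarith [hs.2])

theorem hasDerivAt_line {d : ℕ} {f : EuclideanSpace ℝ (Fin d) → ℝ}
    {x : EuclideanSpace ℝ (Fin d)} {τ : ℝ} (i : Fin d)
    (hf : DifferentiableAt ℝ f (x + τ • EuclideanSpace.single i (1 : ℝ))) :
    HasDerivAt (fun s : ℝ => f (x + s • EuclideanSpace.single i (1 : ℝ)))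
      (pd i f (x + τ • EuclideanSpace.single i (1 : ℝ))) τ := by
  have h : HasDerivAt (fun s : ℝ => x + s • EuclideanSpace.single i (1 : ℝ))
      (EuclideanSpace.single i (1 : ℝ)) τ := by
    simpa using ((hasDerivAt_id τ).smul_const (EuclideanSpace.single i (1 : ℝ))).const_add x
  exact hf.hasFDerivAt.comp_hasDerivAt τ h

theorem norm_sq_line {d : ℕ} (x : EuclideanSpace ℝ (Fin d)) (i : Fin d) (s : ℝ) :
    ‖x + s • EuclideanSpace.single i (1 : ℝ)‖ ^ 2 = ‖x‖ ^ 2 + 2 * s * x i + s ^ 2 := by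
  rw [norm_add_sq_real, inner_smul_right, norm_smul]
  simp [EuclideanSpace.inner_single_right]
  ring

/-- At an interior maximum of `f - G(‖·‖²)` the Laplacian of `f` is at most that of `G(‖·‖²)`. -/
theorem laplacian_le_of_isLocalMax_sub_radial {d : ℕ} {f : EuclideanSpace ℝ (Fin d) → ℝ}
    {G G' : ℝ → ℝ} {c : ℝ} {x : EuclideanSpace ℝ (Fin d)}
    (hf : ContDiffAt ℝ 2 f x)
    (hG : ∀ᶠ ρ in 𝓝 (‖x‖ ^ 2), HasDerivAt G (G' ρ) ρ) (hG' : HasDerivAt G' c (‖x‖ ^ 2))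
    (hmax : IsLocalMax (fun y => f y - G (‖y‖ ^ 2)) x) :
    ∑ i, pd i (pd i f) x ≤ 2 * d * G' (‖x‖ ^ 2) + 4 * ‖x‖ ^ 2 * c := by
  have key : ∀ i, pd i (pd i f) x ≤ 2 * G' (‖x‖ ^ 2) + 4 * x i ^ 2 * c := by
    intro i
    have hline : Tendsto (fun s : ℝ => x + s • EuclideanSpace.single i (1 : ℝ)) (𝓝 0) (𝓝 x) := by
      have : Continuous (fun s : ℝ => x + s • EuclideanSpace.single i (1 : ℝ)) := by fun_prop
      simpa using this.tendsto 0
    have hq : ∀ s : ℝ, HasDerivAt (fun s : ℝ => ‖x‖ ^ 2 + 2 * s * x i + s ^ 2)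
        (2 * x i + 2 * s) s := by
      intro s
      have := ((((hasDerivAt_id s).const_mul 2).mul_const (x i)).const_add (‖x‖ ^ 2)).add
        ((hasDerivAt_id s).pow 2)
      exact this.congr_deriv (by simp)
    have hqt : Tendsto (fun s : ℝ => ‖x‖ ^ 2 + 2 * s * x i + s ^ 2) (𝓝 0) (𝓝 (‖x‖ ^ 2)) := by
      simpa using (hq 0).continuousAt.tendsto
    have hfd : ∀ᶠ y in 𝓝 x, DifferentiableAt ℝ f y :=
      (hf.eventually (by simp)).mono fun y hy => hy.differentiableAt (by simp)
    have hpd : DifferentiableAt ℝ (pd i f) x := by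
      have : DifferentiableAt ℝ (fderiv ℝ f) x :=
        (hf.fderiv_right (m := 1) (by norm_num)).differentiableAt (by simp)
      exact this.clm_apply (differentiableAt_const _)
    have h := second_deriv_nonpos_of_isLocalMax (a := 0)
      (c := pd i (pd i f) x - (2 * G' (‖x‖ ^ 2) + 4 * x i ^ 2 * c))
      (g := fun s : ℝ => f (x + s • EuclideanSpace.single i (1 : ℝ))
        - G (‖x‖ ^ 2 + 2 * s * x i + s ^ 2))
      (g' := fun s : ℝ => pd i f (x + s • EuclideanSpace.single i (1 : ℝ))
        - G' (‖x‖ ^ 2 + 2 * s * x i + s ^ 2) * (2 * x i + 2 * s)) ?_ ?_ ?_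
    · linarith
    · filter_upwards [hline.eventually hfd, hqt.eventually hG] with s h1 h2
      exact (hasDerivAt_line i h1).sub (h2.comp s (hq s))
    · have h1 := hasDerivAt_line (τ := 0) (x := x) (f := pd i f) i (by simpa using hpd)
      have h2 : HasDerivAt (fun s : ℝ => G' (‖x‖ ^ 2 + 2 * s * x i + s ^ 2))
          (c * (2 * x i + 2 * 0)) 0 := by
        refine HasDerivAt.comp 0 ?_ (hq 0)
        simpa using hG'
      have h3 : HasDerivAt (fun s : ℝ => 2 * x i + 2 * s) 2 0 := by
        simpa using ((hasDerivAt_id (0 : ℝ)).const_mul 2).const_add (2 * x i)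
      refine (h1.sub (h2.mul h3)).congr_deriv ?_
      simp only [zero_smul, add_zero, mul_zero, zero_mul, ne_eq, OfNat.ofNat_ne_zero,
        not_false_eq_true, zero_pow]
      ring
    · have := hline.eventually hmax
      refine this.mono fun s hs => ?_
      simpa [norm_sq_line] using hs
  calc ∑ i, pd i (pd i f) x ≤ ∑ i, (2 * G' (‖x‖ ^ 2) + 4 * x i ^ 2 * c) :=
        Finset.sum_le_sum fun i _ => key i
    _ = 2 * d * G' (‖x‖ ^ 2) + 4 * ‖x‖ ^ 2 * c := by
        rw [EuclideanSpace.real_norm_sq_eq, Finset.sum_add_distrib, Finset.mul_sum,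
          Finset.sum_mul]
        simp
        ring

theorem le_of_radial_supersolution {d : ℕ} {p : ℝ} (hp : 1 < p)
    {u : EuclideanSpace ℝ (Fin d) → ℝ → ℝ}
    (hu_cont : ContinuousOn (fun q : EuclideanSpace ℝ (Fin d) × ℝ => u q.1 q.2)
      (({0}ᶜ : Set (EuclideanSpace ℝ (Fin d))) ×ˢ Ici (0 : ℝ)))
    (hu_x : ∀ t : ℝ, 0 < t →
      ContDiffOn ℝ 2 (fun x => u x t) ({0}ᶜ : Set (EuclideanSpace ℝ (Fin d))))
    (hu_t : ∀ x : EuclideanSpace ℝ (Fin d), x ≠ 0 →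
      ContDiffOn ℝ 1 (fun s => u x s) (Ioi (0 : ℝ)))
    (hpde : ∀ x : EuclideanSpace ℝ (Fin d), x ≠ 0 → ∀ t, 0 < t →
      deriv (fun s => u x s) t =
        (1 / 2) * (∑ i, pd i (pd i (fun y => u y t)) x) - u x t ^ p)
    (hinit : ∀ x : EuclideanSpace ℝ (Fin d), x ≠ 0 → u x 0 = 0)
    {e S : ℝ} (he : 0 < e) {G G' G'' : ℝ → ℝ}
    (hG : ∀ ρ ∈ Ioo e S, HasDerivAt G (G' ρ) ρ)
    (hG' : ∀ ρ ∈ Ioo e S, HasDerivAt G' (G'' ρ) ρ)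
    (hG0 : ∀ ρ ∈ Ioo e S, 0 ≤ G ρ)
    (hsuper : ∀ ρ ∈ Ioo e S, d * G' ρ + 2 * ρ * G'' ρ ≤ G ρ ^ p)
    (hGe : Tendsto G (𝓝[>] e) atTop) (hGS : Tendsto G (𝓝[<] S) atTop)
    {x : EuclideanSpace ℝ (Fin d)} (hx : ‖x‖ ^ 2 ∈ Ioo e S) {t : ℝ} (ht : 0 ≤ t) :
    u x t ≤ G (‖x‖ ^ 2) := by
  by_contra! hlt
  have hne : ∀ {y : EuclideanSpace ℝ (Fin d)}, 0 < ‖y‖ ^ 2 → y ≠ 0 := by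
    rintro y hy rfl
    simp at hy
  have hcompact : ∀ b c : ℝ, IsCompact {y : EuclideanSpace ℝ (Fin d) | ‖y‖ ^ 2 ∈ Icc b c} := by
    intro b c
    refine (isCompact_closedBall (0 : EuclideanSpace ℝ (Fin d)) (|c| + 1)).of_isClosed_subset
      (isClosed_Icc.preimage (by fun_prop)) ?_
    intro y hy
    have h1 : ‖y‖ ^ 2 ≤ c := hy.2
    rw [mem_closedBall_zero_iff]
    nlinarith [norm_nonneg y, le_abs_self c, abs_nonneg c, sq_nonneg (‖y‖ - 1)]
  have hcontK : ∀ b c : ℝ, 0 < b →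
      ContinuousOn (fun q : EuclideanSpace ℝ (Fin d) × ℝ => u q.1 q.2)
        ({y : EuclideanSpace ℝ (Fin d) | ‖y‖ ^ 2 ∈ Icc b c} ×ˢ Icc 0 t) := by
    intro b c hb
    exact hu_cont.mono (prod_mono (fun y hy => hne (hb.trans_le hy.1)) fun s hs => hs.1)
  obtain ⟨M, hM⟩ := ((hcompact e S).prod isCompact_Icc).bddAbove_image (hcontK e S he)
  have hM' : ∀ y : EuclideanSpace ℝ (Fin d), ‖y‖ ^ 2 ∈ Icc e S → ∀ s ∈ Icc 0 t, u y s ≤ M :=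
    fun y hy s hs => hM (mem_image_of_mem (fun q : EuclideanSpace ℝ (Fin d) × ℝ => u q.1 q.2)
      (mk_mem_prod hy hs : (y, s) ∈ _ ×ˢ _))
  obtain ⟨b, hbM, hb⟩ := ((hGe.eventually_gt_atTop M).and (Ioo_mem_nhdsGT hx.1)).exists
  obtain ⟨c, hcM, hc⟩ := ((hGS.eventually_gt_atTop M).and (Ioo_mem_nhdsLT hx.2)).exists
  have hsub : Icc b c ⊆ Ioo e S := fun r hr => ⟨hb.1.trans_le hr.1, hr.2.trans_lt hc.2⟩
  have hcont : ContinuousOn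
      (fun q : EuclideanSpace ℝ (Fin d) × ℝ => u q.1 q.2 - G (‖q.1‖ ^ 2))
      ({y : EuclideanSpace ℝ (Fin d) | ‖y‖ ^ 2 ∈ Icc b c} ×ˢ Icc 0 t) := by
    refine (hcontK b c (he.trans hb.1)).sub ?_
    have hGc : ContinuousOn G (Icc b c) :=
      fun r hr => (hG r (hsub hr)).continuousAt.continuousWithinAt
    exact hGc.comp (f := fun q : EuclideanSpace ℝ (Fin d) × ℝ => ‖q.1‖ ^ 2)
      (by fun_prop) fun q hq => hq.1
  have hxK : (x, t) ∈ {y : EuclideanSpace ℝ (Fin d) | ‖y‖ ^ 2 ∈ Icc b c} ×ˢ Icc 0 t :=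
    ⟨⟨hb.2.le, hc.1.le⟩, ⟨ht, le_rfl⟩⟩
  obtain ⟨⟨y, s⟩, ⟨hy, hs⟩, hmax⟩ :=
    ((hcompact b c).prod isCompact_Icc).exists_isMaxOn ⟨_, hxK⟩ hcont
  simp only [mem_ofPred_eq] at hy hs
  have hpos : G (‖y‖ ^ 2) < u y s := by
    have : u x t - G (‖x‖ ^ 2) ≤ u y s - G (‖y‖ ^ 2) := hmax hxK
    linarith
  have hyI := hsub hy
  have huM := hM' y (Ioo_subset_Icc_self hyI) s hs
  have hyb : ‖y‖ ^ 2 ∈ Ioo b c := by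
    refine ⟨lt_of_le_of_ne hy.1 fun h => ?_, lt_of_le_of_ne hy.2 fun h => ?_⟩
    · rw [← h] at hpos; linarith
    · rw [h] at hpos; linarith
  have hy0 : y ≠ 0 := hne (he.trans hyI.1)
  have hs0 : 0 < s := by
    refine lt_of_le_of_ne hs.1 fun h => ?_
    rw [← h, hinit y hy0] at hpos
    linarith [hG0 _ hyI]
  have htime : 0 ≤ deriv (fun s => u y s) s := by
    refine deriv_nonneg_of_le_left hs0 (((hu_t y hy0).differentiableOn (by simp)).differentiableAt
      (Ioi_mem_nhds hs0)).hasDerivAt fun r hr => ?_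
    have : u y r - G (‖y‖ ^ 2) ≤ u y s - G (‖y‖ ^ 2) :=
      hmax (a := (y, r)) ⟨hy, hr.1, hr.2.trans hs.2⟩
    linarith
  have hspace := laplacian_le_of_isLocalMax_sub_radial (f := fun z => u z s) (x := y)
    ((hu_x s hs0).contDiffAt (isOpen_compl_singleton.mem_nhds hy0))
    (by filter_upwards [isOpen_Ioo.mem_nhds hyI] with r hr using hG r hr) (hG' _ hyI)
    (by
      have hcn : Continuous fun z : EuclideanSpace ℝ (Fin d) => ‖z‖ ^ 2 := by fun_prop
      filter_upwards [hcn.continuousAt.preimage_mem_nhds (isOpen_Ioo.mem_nhds hyb)] with z hz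
      exact hmax (a := (z, s)) ⟨Ioo_subset_Icc_self hz, hs⟩)
  have hpow : G (‖y‖ ^ 2) ^ p < u y s ^ p :=
    Real.rpow_lt_rpow (hG0 _ hyI) hpos (by linarith)
  rw [hpde y hy0 s hs0] at htime
  linarith [hsuper _ hyI]

theorem tendsto_rpow_neg_atTop_of_tendsto_zero {ι : Type*} {l : Filter ι} {f : ι → ℝ} {s : ℝ}
    (hs : s < 0) (hf : Tendsto f l (𝓝 0)) (hpos : ∀ᶠ i in l, 0 < f i) :
    Tendsto (fun i => f i ^ s) l atTop :=
  (tendsto_rpow_neg_nhdsGT_zero hs).comp (tendsto_nhdsWithin_iff.2 ⟨hf, hpos⟩)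

/-- The radial supersolution (as a function of `ρ = ‖x‖²`) blowing up on the sphere `ρ = S`. -/
noncomputable def outerBarrier (C a S ρ : ℝ) : ℝ := C * S ^ a * (S - ρ) ^ (-2 * a)

noncomputable def outerBarrierDeriv (C a S ρ : ℝ) : ℝ :=
  C * S ^ a * (2 * a) * (S - ρ) ^ (-2 * a - 1)

noncomputable def outerBarrierDeriv2 (C a S ρ : ℝ) : ℝ :=
  C * S ^ a * (2 * a) * (2 * a + 1) * (S - ρ) ^ (-2 * a - 1 - 1)

theorem hasDerivAt_sub_rpow {S ρ : ℝ} (h : ρ < S) (s : ℝ) :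
    HasDerivAt (fun r => (S - r) ^ s) (-s * (S - ρ) ^ (s - 1)) ρ :=
  (((hasDerivAt_id ρ).const_sub S).rpow_const (p := s)
    (Or.inl (sub_pos.2 h).ne')).congr_deriv (by simp)

theorem hasDerivAt_outerBarrier {C a S ρ : ℝ} (h : ρ < S) :
    HasDerivAt (outerBarrier C a S) (outerBarrierDeriv C a S ρ) ρ :=
  ((hasDerivAt_sub_rpow h _).const_mul _).congr_deriv (by rw [outerBarrierDeriv]; ring)

theorem hasDerivAt_outerBarrierDeriv {C a S ρ : ℝ} (h : ρ < S) :
    HasDerivAt (outerBarrierDeriv C a S) (outerBarrierDeriv2 C a S ρ) ρ :=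
  ((hasDerivAt_sub_rpow h _).const_mul _).congr_deriv (by rw [outerBarrierDeriv2]; ring)

theorem outerBarrier_nonneg {C a S ρ : ℝ} (hC : 0 ≤ C) (hS : 0 ≤ S) (h : ρ ≤ S) :
    0 ≤ outerBarrier C a S ρ :=
  mul_nonneg (mul_nonneg hC (Real.rpow_nonneg hS _)) (Real.rpow_nonneg (sub_nonneg.2 h) _)

theorem outerBarrier_supersolution {C a S ρ p D : ℝ} (hC : 0 < C) (ha : 0 < a) (hD : 0 ≤ D)
    (hap : a * p = a + 1) (hCp : C * (2 * a * D + 4 * a * (2 * a + 1)) ≤ C ^ p)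
    (hρ : ρ ∈ Ioo 0 S) :
    D * outerBarrierDeriv C a S ρ + 2 * ρ * outerBarrierDeriv2 C a S ρ
      ≤ outerBarrier C a S ρ ^ p := by
  obtain ⟨h0, h1⟩ := hρ
  have hS : 0 < S := h0.trans h1
  have hg : 0 < S - ρ := sub_pos.2 h1
  have hpow : outerBarrier C a S ρ ^ p
      = C ^ p * (S ^ a * S * (S - ρ) ^ (-2 * a - 1 - 1)) := by
    rw [outerBarrier, Real.mul_rpow (by positivity) (by positivity),
      Real.mul_rpow (by positivity) (by positivity), ← Real.rpow_mul hS.le,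
      ← Real.rpow_mul hg.le, hap, Real.rpow_add_one hS.ne',
      show -2 * a * p = -2 * a - 1 - 1 by linear_combination -2 * hap]
    ring
  have hstep : (S - ρ) ^ (-2 * a - 1) = (S - ρ) ^ (-2 * a - 1 - 1) * (S - ρ) := by
    rw [← Real.rpow_add_one hg.ne', sub_add_cancel]
  rw [hpow, outerBarrierDeriv, outerBarrierDeriv2, hstep]
  set X := (S - ρ) ^ (-2 * a - 1 - 1)
  have hX : 0 < X := by positivity
  have hY : 0 < S ^ a := by positivity
  calc _ = C * S ^ a * X * (2 * a * D * (S - ρ) + 4 * a * (2 * a + 1) * ρ) := by ring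
    _ ≤ C * S ^ a * X * (2 * a * D * S + 4 * a * (2 * a + 1) * S) := by
        gcongr
        linarith
    _ = C * (2 * a * D + 4 * a * (2 * a + 1)) * (S ^ a * S * X) := by ring
    _ ≤ _ := by gcongr

theorem tendsto_outerBarrier_nhdsLT {C a S : ℝ} (hC : 0 < C) (ha : 0 < a) (hS : 0 < S) :
    Tendsto (outerBarrier C a S) (𝓝[<] S) atTop := by
  refine (tendsto_rpow_neg_atTop_of_tendsto_zero (f := fun r => S - r)
    (by linarith) ?_ ?_).const_mul_atTop (by positivity)
  · have : Continuous fun r : ℝ => S - r := by fun_prop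
    simpa using (this.tendsto S).mono_left nhdsWithin_le_nhds
  · filter_upwards [self_mem_nhdsWithin] with r hr using sub_pos.2 hr

theorem tendsto_outerBarrier_atTop {C a ρ : ℝ} (ha : 0 < a) :
    Tendsto (fun S => outerBarrier C a S ρ) atTop (𝓝 0) := by
  have hsub : Tendsto (fun S : ℝ => S - ρ) atTop atTop :=
    tendsto_atTop_add_const_right _ _ tendsto_id
  have hratio : Tendsto (fun S : ℝ => 1 + ρ * (S - ρ)⁻¹) atTop (𝓝 1) := by
    simpa using ((tendsto_inv_atTop_zero.comp hsub).const_mul ρ).const_add 1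
  have h1 := (hratio.rpow_const (p := a) (Or.inl one_ne_zero)).mul
    ((tendsto_rpow_neg_atTop ha).comp hsub)
  have h2 := h1.const_mul C
  simp only [Real.one_rpow, mul_zero] at h2
  refine h2.congr' ?_
  filter_upwards [eventually_gt_atTop ρ, eventually_gt_atTop 0] with S hS hS0
  have hg : 0 < S - ρ := sub_pos.2 hS
  have : 1 + ρ * (S - ρ)⁻¹ = S / (S - ρ) := by field_simp; ring
  simp only [Function.comp, outerBarrier]
  rw [this, Real.div_rpow hS0.le hg.le, show -2 * a = -a + -a by ring, Real.rpow_add hg,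
    Real.rpow_neg hg.le]
  ring

/-- The radial supersolution (as a function of `ρ = ‖x‖²`) blowing up on the sphere `ρ = e`. -/
noncomputable def innerBarrier (A a e ρ : ℝ) : ℝ :=
  A * (ρ ^ (-a) * ((Real.log ρ - Real.log e) ^ (-a) + (Real.log ρ - Real.log e) ^ (-2 * a)))

noncomputable def innerBarrierDeriv (A a e ρ : ℝ) : ℝ :=
  A * (ρ ^ (-a - 1) * (-a * (Real.log ρ - Real.log e) ^ (-a - 1)
    - 2 * a * (Real.log ρ - Real.log e) ^ (-2 * a - 1)
    - a * ((Real.log ρ - Real.log e) ^ (-a) + (Real.log ρ - Real.log e) ^ (-2 * a))))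

noncomputable def innerBarrierDeriv2 (A a e ρ : ℝ) : ℝ :=
  A * (ρ ^ (-a - 1 - 1) * (a * (a + 1) * (Real.log ρ - Real.log e) ^ (-a - 1 - 1)
    + 2 * a * (2 * a + 1) * (Real.log ρ - Real.log e) ^ (-2 * a - 1 - 1)
    + (2 * a + 1) * (a * (Real.log ρ - Real.log e) ^ (-a - 1)
      + 2 * a * (Real.log ρ - Real.log e) ^ (-2 * a - 1))
    + a * (a + 1) * ((Real.log ρ - Real.log e) ^ (-a) + (Real.log ρ - Real.log e) ^ (-2 * a))))

theorem hasDerivAt_log_sub_rpow {e ρ : ℝ} (he : 0 < e) (h : e < ρ) (s : ℝ) :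
    HasDerivAt (fun r => (Real.log r - Real.log e) ^ s)
      (ρ⁻¹ * s * (Real.log ρ - Real.log e) ^ (s - 1)) ρ :=
  ((Real.hasDerivAt_log (he.trans h).ne').sub_const (Real.log e)).rpow_const (p := s)
    (Or.inl (sub_pos.2 (Real.log_lt_log he h)).ne')

theorem hasDerivAt_innerBarrier {A a e ρ : ℝ} (he : 0 < e) (h : e < ρ) :
    HasDerivAt (innerBarrier A a e) (innerBarrierDeriv A a e ρ) ρ := by
  have hρ : 0 < ρ := he.trans h
  refine (((Real.hasDerivAt_rpow_const (p := -a) (Or.inl hρ.ne')).mul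
    ((hasDerivAt_log_sub_rpow he h (-a)).add
      (hasDerivAt_log_sub_rpow he h (-2 * a)))).const_mul A).congr_deriv ?_
  simp only [innerBarrierDeriv, Pi.add_apply, Real.rpow_sub_one hρ.ne']
  ring

theorem hasDerivAt_innerBarrierDeriv {A a e ρ : ℝ} (he : 0 < e) (h : e < ρ) :
    HasDerivAt (innerBarrierDeriv A a e) (innerBarrierDeriv2 A a e ρ) ρ := by
  have hρ : 0 < ρ := he.trans h
  have hl := hasDerivAt_log_sub_rpow he h
  refine (((Real.hasDerivAt_rpow_const (p := -a - 1) (Or.inl hρ.ne')).mul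
    ((((hl (-a - 1)).const_mul (-a)).sub ((hl (-2 * a - 1)).const_mul (2 * a))).sub
      (((hl (-a)).add (hl (-2 * a))).const_mul a))).const_mul A).congr_deriv ?_
  simp only [innerBarrierDeriv2, Pi.add_apply, Pi.sub_apply, Real.rpow_sub_one hρ.ne']
  ring

theorem innerBarrier_nonneg {A a e ρ : ℝ} (hA : 0 ≤ A) (he : 0 < e) (h : e < ρ) :
    0 ≤ innerBarrier A a e ρ := by
  have hρ : 0 < ρ := he.trans h
  have hl : 0 < Real.log ρ - Real.log e := sub_pos.2 (Real.log_lt_log he h)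
  rw [innerBarrier]
  positivity

theorem rpow_le_rpow_add_rpow {L r s t : ℝ} (hL : 0 < L) (hrs : r ≤ s) (hst : s ≤ t) :
    L ^ s ≤ L ^ r + L ^ t := by
  have hr : 0 < L ^ r := by positivity
  have ht : 0 < L ^ t := by positivity
  rcases le_total L 1 with h | h
  · linarith [Real.rpow_le_rpow_of_exponent_ge hL h hrs]
  · linarith [Real.rpow_le_rpow_of_exponent_le h hst]

theorem innerBarrier_supersolution {A a e ρ p D : ℝ} (hA : 0 < A) (ha : 0 < a) (hp : 1 ≤ p)
    (hD : 2 * a + 2 ≤ D) (hap : a * p = a + 1)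
    (hAp : A * (2 * a * (a + 1) + 4 * a * (2 * a + 1) + 6 * a ^ 2) ≤ A ^ p)
    (he : 0 < e) (h : e < ρ) :
    D * innerBarrierDeriv A a e ρ + 2 * ρ * innerBarrierDeriv2 A a e ρ
      ≤ innerBarrier A a e ρ ^ p := by
  have hρ : 0 < ρ := he.trans h
  have hl : 0 < Real.log ρ - Real.log e := sub_pos.2 (Real.log_lt_log he h)
  rw [innerBarrier, innerBarrierDeriv, innerBarrierDeriv2]
  set L := Real.log ρ - Real.log e
  have hpow : A ^ p * (ρ ^ (-a - 1) * (L ^ (-a - 1) + L ^ (-2 * a - 1 - 1)))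
      ≤ (A * (ρ ^ (-a) * (L ^ (-a) + L ^ (-2 * a)))) ^ p := by
    rw [Real.mul_rpow (by positivity) (by positivity),
      Real.mul_rpow (by positivity) (by positivity), ← Real.rpow_mul hρ.le,
      show -a * p = -a - 1 by linear_combination -hap]
    have := Real.add_rpow_le_rpow_add (a := L ^ (-a)) (b := L ^ (-2 * a)) (by positivity)
      (by positivity) hp
    rw [← Real.rpow_mul hl.le, ← Real.rpow_mul hl.le,
      show -a * p = -a - 1 by linear_combination -hap,
      show -2 * a * p = -2 * a - 1 - 1 by linear_combination -2 * hap] at this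
    gcongr
  refine le_trans ?_ hpow
  have h1 : L ^ (-a - 1 - 1) ≤ L ^ (-2 * a - 1 - 1) + L ^ (-a - 1) :=
    rpow_le_rpow_add_rpow hl (by linarith) (by linarith)
  have h2 : L ^ (-2 * a - 1) ≤ L ^ (-2 * a - 1 - 1) + L ^ (-a - 1) :=
    rpow_le_rpow_add_rpow hl (by linarith) (by linarith)
  have hstep : ρ ^ (-a - 1) = ρ ^ (-a - 1 - 1) * ρ := by
    rw [← Real.rpow_add_one hρ.ne', sub_add_cancel]
  rw [hstep]
  have hR : 0 < ρ ^ (-a - 1 - 1) * ρ := by positivity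
  set R := ρ ^ (-a - 1 - 1)
  have p0 : 0 < L ^ (-a) + L ^ (-2 * a) := by positivity
  have p1 : 0 < L ^ (-a - 1) := by positivity
  have p2 : 0 < L ^ (-2 * a - 1) := by positivity
  have p3 : 0 < L ^ (-2 * a - 1 - 1) := by positivity
  generalize L ^ (-a) + L ^ (-2 * a) = φ at *
  generalize L ^ (-a - 1) = α at *
  generalize L ^ (-2 * a - 1) = β at *
  generalize L ^ (-2 * a - 1 - 1) = γ at *
  generalize L ^ (-a - 1 - 1) = δ at *
  have hmain : D * (-a * α - 2 * a * β - a * φ)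
      + 2 * (a * (a + 1) * δ + 2 * a * (2 * a + 1) * γ + (2 * a + 1) * (a * α + 2 * a * β)
        + a * (a + 1) * φ)
      ≤ (2 * a * (a + 1) + 4 * a * (2 * a + 1) + 6 * a ^ 2) * (α + γ) := by
    have e1 : 0 ≤ (D - (2 * a + 2)) * (a * α + 2 * a * β + a * φ) := by
      have : 0 ≤ D - (2 * a + 2) := by linarith
      positivity
    have e2 : 0 ≤ 2 * a * (a + 1) * (γ + α - δ) := by
      have : 0 ≤ γ + α - δ := by linarith
      positivity
    have e3 : 0 ≤ 4 * a ^ 2 * (γ + α - β) := by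
      have : 0 ≤ γ + α - β := by linarith
      positivity
    have e4 : 0 ≤ 4 * a * (2 * a + 1) * α := by positivity
    have e5 : 0 ≤ a ^ 2 * γ := by positivity
    nlinarith
  calc _ = A * (R * ρ) * (D * (-a * α - 2 * a * β - a * φ)
      + 2 * (a * (a + 1) * δ + 2 * a * (2 * a + 1) * γ + (2 * a + 1) * (a * α + 2 * a * β)
        + a * (a + 1) * φ)) := by ring
    _ ≤ A * (R * ρ) * ((2 * a * (a + 1) + 4 * a * (2 * a + 1) + 6 * a ^ 2) * (α + γ)) := by
        gcongr
    _ = A * (2 * a * (a + 1) + 4 * a * (2 * a + 1) + 6 * a ^ 2) * (R * ρ * (α + γ)) := by ring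
    _ ≤ _ := by gcongr

theorem tendsto_innerBarrier_nhdsGT {A a e : ℝ} (hA : 0 < A) (ha : 0 < a) (he : 0 < e) :
    Tendsto (innerBarrier A a e) (𝓝[>] e) atTop := by
  have hlog : Tendsto (fun r => Real.log r - Real.log e) (𝓝[>] e) (𝓝 0) := by
    simpa using ((Real.continuousAt_log he.ne').tendsto.sub_const (Real.log e)).mono_left
      nhdsWithin_le_nhds
  have hpos : ∀ᶠ r in 𝓝[>] e, 0 < Real.log r - Real.log e := by
    filter_upwards [self_mem_nhdsWithin] with r hr using sub_pos.2 (Real.log_lt_log he hr)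
  have h1 := tendsto_rpow_neg_atTop_of_tendsto_zero (s := -a) (by linarith) hlog hpos
  have h2 := tendsto_rpow_neg_atTop_of_tendsto_zero (s := -2 * a) (by linarith) hlog hpos
  have h3 : Tendsto (fun r : ℝ => r ^ (-a)) (𝓝[>] e) (𝓝 (e ^ (-a))) :=
    (Real.continuousAt_rpow_const e (-a) (Or.inl he.ne')).tendsto.mono_left nhdsWithin_le_nhds
  exact (h3.pos_mul_atTop (by positivity) (h1.atTop_add_atTop h2)).const_mul_atTop hA

theorem tendsto_innerBarrier_zero {A a ρ : ℝ} (ha : 0 < a) :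
    Tendsto (fun e => innerBarrier A a e ρ) (𝓝[>] 0) (𝓝 0) := by
  have hlog : Tendsto (fun e => Real.log ρ - Real.log e) (𝓝[>] 0) atTop := by
    simpa [sub_eq_add_neg] using tendsto_atTop_add_const_left _ (Real.log ρ)
      (tendsto_neg_atBot_atTop.comp Real.tendsto_log_nhdsGT_zero)
  have h1 := (tendsto_rpow_neg_atTop ha).comp hlog
  have h2 := (tendsto_rpow_neg_atTop (y := 2 * a) (by linarith)).comp hlog
  simpa [innerBarrier] using ((h1.add h2).const_mul (ρ ^ (-a))).const_mul A

theorem rpow_mul_le_of_mul_eq {K a p : ℝ} (hK : 0 < K) (hap : a * p = a + 1) :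
    K ^ a * K ≤ (K ^ a) ^ p := by
  rw [← Real.rpow_mul hK.le, hap, Real.rpow_add_one hK.ne']

/-- Theorem BP, part (2): for `d ≥ 2`, `p > 1` with `d ≥ 2p/(p−1)`,
the only nonnegative classical solution of `u_t = (1/2)Δu − u^p` on the punctured
space `ℝ^d ∖ {0}` with zero initial data is `u ≡ 0`. -/
theorem stmt_15 {d : ℕ} (hd : 2 ≤ d) (p : ℝ) (hp : 1 < p)
    (hdim : 2 * p / (p - 1) ≤ (d : ℝ))
    (u : EuclideanSpace ℝ (Fin d) → ℝ → ℝ)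
    (hu_cont : ContinuousOn (fun q : EuclideanSpace ℝ (Fin d) × ℝ => u q.1 q.2)
      (({0}ᶜ : Set (EuclideanSpace ℝ (Fin d))) ×ˢ Ici (0 : ℝ)))
    (hu_nonneg : ∀ x : EuclideanSpace ℝ (Fin d), x ≠ 0 → ∀ t, 0 ≤ t → 0 ≤ u x t)
    (hu_x : ∀ t : ℝ, 0 < t →
      ContDiffOn ℝ 2 (fun x => u x t) ({0}ᶜ : Set (EuclideanSpace ℝ (Fin d))))
    (hu_t : ∀ x : EuclideanSpace ℝ (Fin d), x ≠ 0 →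
      ContDiffOn ℝ 1 (fun s => u x s) (Ioi (0 : ℝ)))
    (hpde : ∀ x : EuclideanSpace ℝ (Fin d), x ≠ 0 → ∀ t, 0 < t →
      deriv (fun s => u x s) t =
        (1 / 2) * (∑ i, pd i (pd i (fun y => u y t)) x) - u x t ^ p)
    (hinit : ∀ x : EuclideanSpace ℝ (Fin d), x ≠ 0 → u x 0 = 0) :
    ∀ x : EuclideanSpace ℝ (Fin d), x ≠ 0 → ∀ t, 0 ≤ t → u x t = 0 := by
  intro x hx t ht
  refine le_antisymm ?_ (hu_nonneg x hx t ht)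
  obtain ⟨a, ha, hap, had⟩ : ∃ a : ℝ, 0 < a ∧ a * p = a + 1 ∧ 2 * a + 2 ≤ d := by
    have hp1 : 0 < p - 1 := sub_pos.2 hp
    refine ⟨1 / (p - 1), by positivity, by field_simp; ring, ?_⟩
    have : 2 * (1 / (p - 1)) + 2 = 2 * p / (p - 1) := by field_simp; ring
    rwa [this]
  obtain ⟨A, hA, hAp⟩ : ∃ A : ℝ, 0 < A ∧
      A * (2 * a * (a + 1) + 4 * a * (2 * a + 1) + 6 * a ^ 2) ≤ A ^ p :=
    ⟨_, Real.rpow_pos_of_pos (by positivity) a, rpow_mul_le_of_mul_eq (by positivity) hap⟩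
  obtain ⟨C, hC, hCp⟩ : ∃ C : ℝ, 0 < C ∧
      C * (2 * a * d + 4 * a * (2 * a + 1)) ≤ C ^ p :=
    ⟨_, Real.rpow_pos_of_pos (by positivity) a, rpow_mul_le_of_mul_eq (by positivity) hap⟩
  have hρ : 0 < ‖x‖ ^ 2 := by positivity
  have hbound : ∀ e S : ℝ, 0 < e → e < ‖x‖ ^ 2 → ‖x‖ ^ 2 < S →
      u x t ≤ innerBarrier A a e (‖x‖ ^ 2) + outerBarrier C a S (‖x‖ ^ 2) := by
    intro e S he heρ hρS
    have hS : 0 < S := hρ.trans hρS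
    have heS : e < S := heρ.trans hρS
    refine le_of_radial_supersolution hp hu_cont hu_x hu_t hpde hinit he
      (G := fun ρ => innerBarrier A a e ρ + outerBarrier C a S ρ)
      (fun ρ h => (hasDerivAt_innerBarrier he h.1).add (hasDerivAt_outerBarrier h.2))
      (fun ρ h => (hasDerivAt_innerBarrierDeriv he h.1).add (hasDerivAt_outerBarrierDeriv h.2))
      (fun ρ h => add_nonneg (innerBarrier_nonneg hA.le he h.1)
        (outerBarrier_nonneg hC.le hS.le h.2.le))
      (fun ρ h => ?_) ?_ ?_ ⟨heρ, hρS⟩ ht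
    · have h1 := innerBarrier_supersolution hA ha hp.le had hap hAp he h.1
      have h2 := outerBarrier_supersolution hC ha (Nat.cast_nonneg d) hap hCp
        ⟨he.trans h.1, h.2⟩
      have h3 := Real.add_rpow_le_rpow_add (innerBarrier_nonneg (a := a) hA.le he h.1)
        (outerBarrier_nonneg (a := a) hC.le hS.le h.2.le) hp.le
      linarith
    · exact (tendsto_innerBarrier_nhdsGT hA ha he).atTop_add
        ((hasDerivAt_outerBarrier heS).continuousAt.tendsto.mono_left nhdsWithin_le_nhds)
    · exact ((hasDerivAt_innerBarrier he heS).continuousAt.tendsto.mono_left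
        nhdsWithin_le_nhds).add_atTop (tendsto_outerBarrier_nhdsLT hC ha hS)
  have hinner : ∀ e, 0 < e → e < ‖x‖ ^ 2 → u x t ≤ innerBarrier A a e (‖x‖ ^ 2) := by
    intro e he heρ
    have h := (tendsto_outerBarrier_atTop (C := C) (ρ := ‖x‖ ^ 2) ha).const_add
      (innerBarrier A a e (‖x‖ ^ 2))
    rw [add_zero] at h
    refine ge_of_tendsto h ?_
    filter_upwards [eventually_gt_atTop (‖x‖ ^ 2)] with S hS using hbound e S he heρ hS
  refine ge_of_tendsto (tendsto_innerBarrier_zero (A := A) (ρ := ‖x‖ ^ 2) ha) ?_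
  filter_upwards [Ioo_mem_nhdsGT hρ] with e he using hinner e he.1 he.2
end

section
/- Let d ≥ 2 and p > 1 with d < 2p/(p−1), and set β₀ = (d(p−1) − 2p)/(p−1)². Let β : ℝ^d ∖ {0} → ℝ be locally Hölder continuous, bounded from above, with limsup_{x→0} |x|² β(x) < β₀. Then the only function u : (ℝ^d ∖ {0}) × [0,∞) → ℝ that is continuous, nonnegative, twice continuously differentiable in x and once in t on (ℝ^d ∖ {0}) × (0,∞), satisfies ∂u/∂t = (1/2)Δu + β(x)u − u^p on (ℝ^d ∖ {0}) × (0,∞), and satisfies u(x,0) = 0 for all x ∈ ℝ^d ∖ {0}, is u ≡ 0. -/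
open Set

/-- `f` is locally Hölder continuous on the set `S`. -/
def LocHolderOn {d : ℕ} (f : EuclideanSpace ℝ (Fin d) → ℝ)
    (S : Set (EuclideanSpace ℝ (Fin d))) : Prop :=
  ∀ K : Set (EuclideanSpace ℝ (Fin d)), K ⊆ S → IsCompact K →
    ∃ κ C : ℝ, 0 < κ ∧ κ ≤ 1 ∧ 0 ≤ C ∧
      ∀ x ∈ K, ∀ y ∈ K, |f x - f y| ≤ C * ‖x - y‖ ^ κ

/-- `h` is a strict radial supersolution at `s = ‖x‖²`: `h1`, `h2` are its first two derivatives. -/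
structure IsRadialSupersol (d : ℕ) (c p : ℝ) (h h1 h2 : ℝ → ℝ) (s : ℝ) : Prop where
  hasDerivAt : HasDerivAt h (h1 s) s
  hasDerivAt_deriv : HasDerivAt h1 (h2 s) s
  pos : 0 < h s
  lt_zero : 2 * s * h2 s + d * h1 s + c / s * h s - h s ^ p < 0

lemma IsRadialSupersol.add {d : ℕ} {c p : ℝ} (hp : 1 ≤ p) {f f1 f2 g g1 g2 : ℝ → ℝ} {s : ℝ}
    (hf : IsRadialSupersol d c p f f1 f2 s) (hg : IsRadialSupersol d c p g g1 g2 s) :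
    IsRadialSupersol d c p (fun s => f s + g s) (fun s => f1 s + g1 s) (fun s => f2 s + g2 s) s where
  hasDerivAt := hf.hasDerivAt.add hg.hasDerivAt
  hasDerivAt_deriv := hf.hasDerivAt_deriv.add hg.hasDerivAt_deriv
  pos := add_pos hf.pos hg.pos
  lt_zero := by
    have := Real.add_rpow_le_rpow_add hf.pos.le hg.pos.le hp
    have := hf.lt_zero
    have := hg.lt_zero
    linarith

lemma exists_quadratic_lt_rpow {a b e q k : ℝ} (hq : 0 ≤ q) (hk : 0 < k) (h1 : a + b + e < 0) :
    ∃ A : ℝ, 0 < A ∧ ∀ z : ℝ, 1 < z →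
      a * z ^ 2 + b * z + e < A ^ k * z ^ 2 * (1 - 1 / z) ^ q := by
  have hc : ContinuousAt (fun z : ℝ => a * z ^ 2 + b * z + e) 1 := by fun_prop
  have hev := hc.eventually (gt_mem_nhds (show a * 1 ^ 2 + b * 1 + e < (0 : ℝ) by linarith))
  obtain ⟨ε, hε, hball⟩ := Metric.eventually_nhds_iff.1 hev
  set e0 : ℝ := 1 - 1 / (1 + ε) with he0
  have he0pos : 0 < e0 := by
    have : 1 / (1 + ε) < 1 := by rw [div_lt_one (by linarith)]; linarith
    linarith
  set L : ℝ := (|a| + |b| + |e| + 1) / e0 ^ q with hL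
  have hLpos : 0 < L := by positivity
  refine ⟨L ^ k⁻¹, by positivity, fun z hz => ?_⟩
  rw [← Real.rpow_mul hLpos.le, inv_mul_cancel₀ hk.ne', Real.rpow_one]
  have h1z : 1 / z < 1 := by rw [div_lt_one (by linarith)]; exact hz
  rcases lt_or_ge z (1 + ε) with hzε | hzε
  · refine (hball (y := z) ?_).trans_le ?_
    · rw [Real.dist_eq, abs_of_pos] <;> linarith
    · have : 0 ≤ 1 - 1 / z := by linarith
      positivity
  · have hle : e0 ≤ 1 - 1 / z := by
      have : 1 / z ≤ 1 / (1 + ε) := one_div_le_one_div_of_le (by linarith) hzε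
      linarith
    have hr : e0 ^ q ≤ (1 - 1 / z) ^ q := Real.rpow_le_rpow he0pos.le hle hq
    have hpos : 0 < e0 ^ q := by positivity
    calc a * z ^ 2 + b * z + e < (|a| + |b| + |e| + 1) * z ^ 2 := by
          nlinarith [le_abs_self a, le_abs_self b, le_abs_self e, abs_nonneg b, abs_nonneg e,
            mul_nonneg (abs_nonneg b) (mul_nonneg (by linarith : 0 ≤ z) (by linarith : 0 ≤ z - 1)),
            mul_nonneg (abs_nonneg e) (by nlinarith : 0 ≤ z ^ 2 - 1),
            mul_nonneg (sub_nonneg.2 (le_abs_self a)) (sq_nonneg z),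
            mul_nonneg (sub_nonneg.2 (le_abs_self b)) (by linarith : 0 ≤ z)]
      _ = L * z ^ 2 * e0 ^ q := by rw [hL]; field_simp
      _ ≤ _ := by gcongr

lemma hasDerivAt_mul_logDeriv {h l l1 : ℝ → ℝ} {s : ℝ} (hh : HasDerivAt h (h s * l s) s)
    (hl : HasDerivAt l (l1 s) s) :
    HasDerivAt (fun s => h s * l s) (h s * (l s ^ 2 + l1 s)) s := by
  exact (hh.mul hl).congr_deriv (by ring)

/-- Dividing by `h > 0`, the supersolution inequality becomes one for the logarithmic derivative. -/
lemma IsRadialSupersol.of_logDeriv {d : ℕ} {c p : ℝ} {h l l1 : ℝ → ℝ} {s : ℝ} (hs : 0 < s)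
    (hpos : 0 < h s) (hh : HasDerivAt h (h s * l s) s) (hl : HasDerivAt l (l1 s) s)
    (hlt : 2 * s ^ 2 * (l s ^ 2 + l1 s) + d * (s * l s) + c < s * h s ^ (p - 1)) :
    IsRadialSupersol d c p h (fun s => h s * l s) (fun s => h s * (l s ^ 2 + l1 s)) s where
  hasDerivAt := hh
  hasDerivAt_deriv := hasDerivAt_mul_logDeriv hh hl
  pos := hpos
  lt_zero := by
    have hpow : h s ^ p = h s * h s ^ (p - 1) := by
      rw [Real.rpow_sub_one hpos.ne']; field_simp
    have : 2 * s * (h s * (l s ^ 2 + l1 s)) + d * (h s * l s) + c / s * h s - h s ^ p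
        = (h s / s) * (2 * s ^ 2 * (l s ^ 2 + l1 s) + d * (s * l s) + c - s * h s ^ (p - 1)) := by
      rw [hpow]; field_simp
    rw [this]
    exact mul_neg_of_pos_of_neg (by positivity) (by linarith)

lemma exists_inner_barrier (d : ℕ) {c p : ℝ} (hp : 1 < p)
    (hc : c < ((d : ℝ) * (p - 1) - 2 * p) / (p - 1) ^ 2) {s₀ ε : ℝ} (hs₀ : 0 < s₀) (hε : 0 < ε) :
    ∃ η, 0 < η ∧ η < s₀ ∧ ∃ h h1 h2 : ℝ → ℝ,
      (∀ s, η < s → IsRadialSupersol d c p h h1 h2 s) ∧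
      Filter.Tendsto h (nhdsWithin η (Ioi η)) Filter.atTop ∧ h s₀ < ε := by
  have hp1 : 0 < p - 1 := by linarith
  set α : ℝ := 2 / (p - 1) with hα
  have hαpos : 0 < α := by positivity
  obtain ⟨g, hg, hgc⟩ : ∃ g : ℝ, 0 < g ∧
      2 * ((α / 2 - g - α) ^ 2 - (α / 2 - g) + α) + d * (α / 2 - g - α) + c < 0 := by
    have hcont : ContinuousAt (fun g : ℝ =>
      2 * ((α / 2 - g - α) ^ 2 - (α / 2 - g) + α) + d * (α / 2 - g - α) + c) 0 := by fun_prop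
    have h0 : 2 * ((α / 2 - 0 - α) ^ 2 - (α / 2 - 0) + α) + d * (α / 2 - 0 - α) + c < 0 := by
      have : 2 * ((α / 2 - 0 - α) ^ 2 - (α / 2 - 0) + α) + d * (α / 2 - 0 - α)
          = -(((d : ℝ) * (p - 1) - 2 * p) / (p - 1) ^ 2) := by
        rw [hα]; field_simp; ring
      linarith
    have hev := (hcont.eventually (gt_mem_nhds h0)).filter_mono
      (nhdsWithin_le_nhds (s := Ioi (0 : ℝ)))
    obtain ⟨g, h1, h2⟩ := (hev.and self_mem_nhdsWithin).exists
    exact ⟨g, h2, h1⟩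
  set m : ℝ := α / 2 - g with hm
  obtain ⟨A, hA, hAz⟩ := exists_quadratic_lt_rpow (a := 2 * α ^ 2 + 2 * α)
    (b := -(4 * m * α) - d * α) (e := 2 * m ^ 2 - 2 * m + d * m + c)
    (q := g * (p - 1)) (k := p - 1) (by positivity) hp1 (by linarith)
  have hη : ∀ᶠ η in nhdsWithin (0 : ℝ) (Ioi 0), A * η ^ g * s₀ ^ m * (s₀ - η) ^ (-α) < ε := by
    have hcont : ContinuousAt (fun η : ℝ => A * η ^ g * s₀ ^ m * (s₀ - η) ^ (-α)) 0 := by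
      have h1 : ContinuousAt (fun η : ℝ => η ^ g) 0 :=
        continuousAt_id.rpow_const (Or.inr hg.le)
      have h2 : ContinuousAt (fun η : ℝ => (s₀ - η) ^ (-α)) 0 :=
        ContinuousAt.rpow_const (by fun_prop) (Or.inl (by simpa using hs₀.ne'))
      exact ((continuousAt_const.mul h1).mul continuousAt_const).mul h2
    refine (hcont.eventually (gt_mem_nhds ?_)).filter_mono nhdsWithin_le_nhds
    simpa [Real.zero_rpow hg.ne'] using hε
  obtain ⟨η, ⟨hηε, hηpos⟩, hηs⟩ := ((hη.and self_mem_nhdsWithin).and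
    ((gt_mem_nhds hs₀).filter_mono nhdsWithin_le_nhds)).exists
  have hηpos : 0 < η := hηpos
  refine ⟨η, hηpos, hηs, fun s => A * η ^ g * s ^ m * (s - η) ^ (-α), _, _,
    fun s hs => IsRadialSupersol.of_logDeriv (l := fun s => m / s - α / (s - η))
      (l1 := fun s => -m / s ^ 2 + α / (s - η) ^ 2) (hηpos.trans hs) ?_ ?_ ?_ ?_, ?_, hηε⟩
  all_goals try (have hs' : 0 < s := hηpos.trans hs)
  all_goals try (have hsη : 0 < s - η := by linarith)
  · positivity
  · have h1 : HasDerivAt (fun s : ℝ => s ^ m) (m * s ^ (m - 1)) s :=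
      Real.hasDerivAt_rpow_const (Or.inl hs'.ne')
    have h2 : HasDerivAt (fun s : ℝ => (s - η) ^ (-α)) (1 * (-α) * (s - η) ^ (-α - 1)) s :=
      ((hasDerivAt_id s).sub_const η).rpow_const (Or.inl hsη.ne')
    refine ((h1.const_mul (A * η ^ g)).mul h2).congr_deriv ?_
    rw [Real.rpow_sub_one hs'.ne', Real.rpow_sub_one hsη.ne']
    field_simp
    ring
  · have h1 := (hasDerivAt_inv hs'.ne').const_mul m
    have h2 := (((hasDerivAt_id s).sub_const η).inv hsη.ne').const_mul α
    refine (h1.sub h2).congr_deriv ?_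
    simp only [id]
    field_simp
    ring
  · have hz : 1 < s / (s - η) := by rw [one_lt_div hsη]; linarith
    have hq := hAz _ hz
    have e1 : 1 - 1 / (s / (s - η)) = η / s := by field_simp; ring
    have e2 : s * (A * η ^ g * s ^ m * (s - η) ^ (-α)) ^ (p - 1)
        = A ^ (p - 1) * (s / (s - η)) ^ 2 * (η / s) ^ (g * (p - 1)) := by
      rw [Real.mul_rpow (by positivity) (by positivity),
        Real.mul_rpow (by positivity) (by positivity),
        Real.mul_rpow (by positivity) (by positivity), ← Real.rpow_mul hηpos.le,
        ← Real.rpow_mul hs'.le, ← Real.rpow_mul hsη.le,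
        Real.div_rpow hηpos.le hs'.le]
      have e3 : m * (p - 1) = 1 - g * (p - 1) := by rw [hm, hα]; field_simp
      have e4 : -α * (p - 1) = -(2 : ℕ) := by rw [hα]; field_simp; norm_num
      rw [e3, e4, Real.rpow_sub hs', Real.rpow_one, Real.rpow_neg hsη.le, Real.rpow_natCast]
      field_simp
    rw [e1, ← e2] at hq
    refine lt_of_eq_of_lt ?_ hq
    field_simp
    ring
  · have h1 : Filter.Tendsto (fun s : ℝ => A * η ^ g * s ^ m) (nhdsWithin η (Ioi η))
        (nhds (A * η ^ g * η ^ m)) :=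
      (continuousAt_const.mul (continuousAt_id.rpow_const (Or.inl hηpos.ne'))).tendsto.mono_left
        nhdsWithin_le_nhds
    have h2 : Filter.Tendsto (fun s : ℝ => (s - η) ^ (-α)) (nhdsWithin η (Ioi η))
        Filter.atTop := by
      refine (tendsto_rpow_neg_nhdsGT_zero (neg_lt_zero.2 hαpos)).comp ?_
      refine tendsto_nhdsWithin_iff.2 ⟨?_, ?_⟩
      · have : ContinuousAt (fun s : ℝ => s - η) η := by fun_prop
        simpa using this.tendsto.mono_left nhdsWithin_le_nhds
      · filter_upwards [self_mem_nhdsWithin] with s hs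
        exact sub_pos.2 (mem_Ioi.1 hs)
    exact h1.pos_mul_atTop (by positivity) h2

lemma exists_outer_barrier (d : ℕ) {c p : ℝ} (hp : 1 < p)
    (hc : c < 0) {s₀ ε : ℝ} (hs₀ : 0 < s₀) (hε : 0 < ε) :
    ∃ R, s₀ < R ∧ ∃ h h1 h2 : ℝ → ℝ,
      (∀ s, 0 < s → s < R → IsRadialSupersol d c p h h1 h2 s) ∧
      Filter.Tendsto h (nhdsWithin R (Iio R)) Filter.atTop ∧ h s₀ < ε := by
  have hp1 : 0 < p - 1 := by linarith
  set α : ℝ := 2 / (p - 1) with hα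
  have hαpos : 0 < α := by positivity
  set L : ℝ := 2 * α * (α + 1) + d * α with hL
  have hLpos : 0 < L := by positivity
  set B : ℝ := L ^ (p - 1)⁻¹ with hB
  have hBpos : 0 < B := by positivity
  have hBp : B ^ (p - 1) = L := by
    rw [hB, ← Real.rpow_mul hLpos.le, inv_mul_cancel₀ hp1.ne', Real.rpow_one]
  have hlim : Filter.Tendsto (fun R : ℝ => B * 2 ^ α * R ^ (-(α / 2))) Filter.atTop (nhds 0) := by
    simpa using (tendsto_rpow_neg_atTop (half_pos hαpos)).const_mul (B * 2 ^ α)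
  obtain ⟨R, hRε, hR⟩ := ((hlim.eventually (gt_mem_nhds hε)).and
    (Filter.eventually_ge_atTop (2 * s₀))).exists
  have hRpos : 0 < R := by linarith
  refine ⟨R, by linarith, fun s => B * R ^ (α / 2) * (R - s) ^ (-α), _, _,
    fun s hs hsR => IsRadialSupersol.of_logDeriv (l := fun s => α / (R - s))
      (l1 := fun s => α / (R - s) ^ 2) hs ?_ ?_ ?_ ?_, ?_, ?_⟩
  all_goals try (have hRs : 0 < R - s := by linarith)
  · positivity
  · have h2 : HasDerivAt (fun s : ℝ => (R - s) ^ (-α)) (-1 * (-α) * (R - s) ^ (-α - 1)) s :=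
      ((hasDerivAt_id s).const_sub R).rpow_const (Or.inl hRs.ne')
    refine (h2.const_mul (B * R ^ (α / 2))).congr_deriv ?_
    rw [Real.rpow_sub_one hRs.ne']
    field_simp
  · have h2 := (((hasDerivAt_id s).const_sub R).inv hRs.ne').const_mul α
    refine h2.congr_deriv ?_
    simp only [id]
    field_simp
  · have e2 : s * (B * R ^ (α / 2) * (R - s) ^ (-α)) ^ (p - 1) = L * (s * R / (R - s) ^ 2) := by
      rw [Real.mul_rpow (by positivity) (by positivity),
        Real.mul_rpow (by positivity) (by positivity), ← Real.rpow_mul hRpos.le,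
        ← Real.rpow_mul hRs.le, hBp]
      have e3 : α / 2 * (p - 1) = 1 := by rw [hα]; field_simp
      have e4 : -α * (p - 1) = -(2 : ℕ) := by rw [hα]; field_simp; norm_num
      rw [e3, e4, Real.rpow_one, Real.rpow_neg hRs.le, Real.rpow_natCast]
      field_simp
    rw [e2]
    have e5 : 2 * s ^ 2 * ((α / (R - s)) ^ 2 + α / (R - s) ^ 2) + d * (s * (α / (R - s)))
        = (2 * α * (α + 1) * s ^ 2 + d * α * (s * (R - s))) / (R - s) ^ 2 := by
      field_simp
    have e6 : (2 * α * (α + 1) * s ^ 2 + d * α * (s * (R - s))) / (R - s) ^ 2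
        ≤ L * (s * R / (R - s) ^ 2) := by
      rw [show L * (s * R / (R - s) ^ 2)
        = (2 * α * (α + 1) * (s * R) + d * α * (s * R)) / (R - s) ^ 2 by rw [hL]; ring]
      refine div_le_div_of_nonneg_right (add_le_add ?_ ?_) (sq_nonneg (R - s))
      · exact mul_le_mul_of_nonneg_left (by nlinarith) (by positivity)
      · exact mul_le_mul_of_nonneg_left (by nlinarith) (by positivity)
    linarith
  · have h2 : Filter.Tendsto (fun s : ℝ => (R - s) ^ (-α)) (nhdsWithin R (Iio R))
        Filter.atTop := by
      refine (tendsto_rpow_neg_nhdsGT_zero (neg_lt_zero.2 hαpos)).comp ?_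
      refine tendsto_nhdsWithin_iff.2 ⟨?_, ?_⟩
      · have : ContinuousAt (fun s : ℝ => R - s) R := by fun_prop
        simpa using this.tendsto.mono_left nhdsWithin_le_nhds
      · filter_upwards [self_mem_nhdsWithin] with s hs
        exact sub_pos.2 (mem_Iio.1 hs)
    exact h2.const_mul_atTop (by positivity)
  · refine lt_of_le_of_lt ?_ hRε
    have h1 : (R - s₀) ^ (-α) ≤ (R / 2) ^ (-α) :=
      Real.rpow_le_rpow_of_nonpos (by positivity) (by linarith) (by linarith)
    have h2 : R ^ (α / 2) * (R / 2) ^ (-α) = 2 ^ α * R ^ (-(α / 2)) := by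
      rw [Real.div_rpow hRpos.le zero_le_two, Real.rpow_neg zero_le_two, div_inv_eq_mul,
        ← mul_assoc, ← Real.rpow_add hRpos, mul_comm]
      ring_nf
    calc B * R ^ (α / 2) * (R - s₀) ^ (-α) ≤ B * (R ^ (α / 2) * (R / 2) ^ (-α)) := by
          rw [mul_assoc]; gcongr
      _ = _ := by rw [h2]; ring

lemma deriv_deriv_nonpos_of_isLocalMax {f : ℝ → ℝ} {x : ℝ} (h : IsLocalMax f x)
    (hc : ContinuousAt f x) : deriv (deriv f) x ≤ 0 := by
  by_contra! hpos
  have hmin := isLocalMin_of_deriv_deriv_pos hpos h.deriv_eq_zero hc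
  have hconst : f =ᶠ[nhds x] fun _ => f x := by
    filter_upwards [h, hmin] with y h1 h2 using le_antisymm h1 h2
  have : deriv (deriv f) x = 0 := by
    rw [hconst.deriv.deriv_eq]; simp
  linarith

section Laplacian

variable {d : ℕ}

local notation "E" => EuclideanSpace ℝ (Fin d)

lemma deriv_comp_line {f : E → ℝ} (i : Fin d) {y : E} {s : ℝ}
    (hf : DifferentiableAt ℝ f (y + s • EuclideanSpace.single i 1)) :
    HasDerivAt (fun s : ℝ => f (y + s • EuclideanSpace.single i 1))
      (pd i f (y + s • EuclideanSpace.single i 1)) s := by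
  have h1 : HasDerivAt (fun s : ℝ => y + s • (EuclideanSpace.single i (1 : ℝ) : E))
      (EuclideanSpace.single i 1) s := by
    simpa using ((hasDerivAt_id s).smul_const (EuclideanSpace.single i (1 : ℝ) : E)).const_add y
  exact hf.hasFDerivAt.comp_hasDerivAt s h1

lemma pd_pd_nonpos_of_isLocalMax {f : E → ℝ} {x : E} (i : Fin d)
    (hf : ∀ᶠ y in nhds x, DifferentiableAt ℝ f y) (hf' : DifferentiableAt ℝ (pd i f) x)
    (hmax : IsLocalMax f x) : pd i (pd i f) x ≤ 0 := by
  have hline : ContinuousAt (fun s : ℝ => x + s • (EuclideanSpace.single i (1 : ℝ) : E)) 0 := by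
    fun_prop
  have hx : x + (0 : ℝ) • (EuclideanSpace.single i (1 : ℝ) : E) = x := by simp
  have htend : Filter.Tendsto (fun s : ℝ => x + s • (EuclideanSpace.single i (1 : ℝ) : E))
      (nhds 0) (nhds x) := by simpa using hline.tendsto
  have h1 : deriv (fun s : ℝ => f (x + s • EuclideanSpace.single i 1)) =ᶠ[nhds 0]
      fun s => pd i f (x + s • EuclideanSpace.single i 1) := by
    filter_upwards [htend.eventually hf] with s hs using (deriv_comp_line i hs).deriv
  have h2 := (deriv_comp_line (f := pd i f) i (y := x) (s := 0) (by rwa [hx])).deriv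
  rw [hx] at h2
  rw [← h2, ← h1.deriv_eq]
  refine deriv_deriv_nonpos_of_isLocalMax ?_ ?_
  · have : ∀ᶠ s in nhds (0 : ℝ), f (x + s • EuclideanSpace.single i 1) ≤ f x := htend.eventually hmax
    simpa [IsLocalMax, IsMaxFilter] using this
  · exact (deriv_comp_line i (y := x) (s := 0) (by rw [hx]; exact hf.self_of_nhds)).continuousAt

lemma pd_const_mul_sub {f g : E → ℝ} {x : E} (a : ℝ) (i : Fin d)
    (hf : DifferentiableAt ℝ f x) (hg : DifferentiableAt ℝ g x) :
    pd i (fun y => a * f y - g y) x = a * pd i f x - pd i g x := by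
  have : HasFDerivAt (fun y => a * f y - g y) (a • fderiv ℝ f x - fderiv ℝ g x) x :=
    (hf.hasFDerivAt.const_mul a).sub hg.hasFDerivAt
  simp [pd, this.fderiv]

lemma mul_pd_pd_le_of_isLocalMax_sub {f g : E → ℝ} {x : E} (a : ℝ) (i : Fin d)
    (hf : ∀ᶠ y in nhds x, DifferentiableAt ℝ f y) (hf' : DifferentiableAt ℝ (pd i f) x)
    (hg : ∀ᶠ y in nhds x, DifferentiableAt ℝ g y) (hg' : DifferentiableAt ℝ (pd i g) x)
    (hmax : IsLocalMax (fun y => a * f y - g y) x) :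
    a * pd i (pd i f) x ≤ pd i (pd i g) x := by
  have h1 : pd i (fun y => a * f y - g y) =ᶠ[nhds x] fun y => a * pd i f y - pd i g y := by
    filter_upwards [hf, hg] with y h1 h2 using pd_const_mul_sub a i h1 h2
  have h2 : pd i (pd i (fun y => a * f y - g y)) x = a * pd i (pd i f) x - pd i (pd i g) x := by
    rw [← pd_const_mul_sub a i hf' hg']
    simp only [pd] at h1 ⊢
    rw [Filter.EventuallyEq.fderiv_eq h1]
  have h3 := pd_pd_nonpos_of_isLocalMax i
    (by filter_upwards [hf, hg] with y h1 h2 using (h1.const_mul a).sub h2)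
    (((hf'.const_mul a).sub hg').congr_of_eventuallyEq h1) hmax
  linarith

lemma differentiableAt_pd {f : E → ℝ} {x : E} (i : Fin d) (hf : ContDiffAt ℝ 2 f x) :
    DifferentiableAt ℝ (pd i f) x := by
  have h1 : ContDiffAt ℝ 1 (fderiv ℝ f) x := hf.fderiv_right (by norm_num)
  exact (h1.differentiableAt (by norm_num)).clm_apply (differentiableAt_const _)

lemma hasFDerivAt_comp_norm_sq {h : ℝ → ℝ} {h' : ℝ} {x : E}
    (hh : HasDerivAt h h' (‖x‖ ^ 2)) :
    HasFDerivAt (fun y : E => h (‖y‖ ^ 2)) (h' • (2 • innerSL ℝ x)) x :=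
  hh.comp_hasFDerivAt x (hasStrictFDerivAt_norm_sq x).hasFDerivAt

lemma pd_comp_norm_sq {h : ℝ → ℝ} {h' : ℝ} {x : E} (i : Fin d)
    (hh : HasDerivAt h h' (‖x‖ ^ 2)) : pd i (fun y : E => h (‖y‖ ^ 2)) x = h' * (2 * x i) := by
  simp [pd, (hasFDerivAt_comp_norm_sq hh).fderiv, EuclideanSpace.inner_single_right]

lemma tendsto_norm_sq (x : E) : Filter.Tendsto (fun y : E => ‖y‖ ^ 2) (nhds x) (nhds (‖x‖ ^ 2)) :=
  (continuous_norm.pow 2).tendsto x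

lemma hasFDerivAt_pd_comp_norm_sq {h h1 : ℝ → ℝ} {h2 : ℝ} {x : E} (i : Fin d)
    (hh : ∀ᶠ s in nhds (‖x‖ ^ 2), HasDerivAt h (h1 s) s) (hh' : HasDerivAt h1 h2 (‖x‖ ^ 2)) :
    HasFDerivAt (pd i (fun y : E => h (‖y‖ ^ 2)))
      (h1 (‖x‖ ^ 2) • (2 : ℝ) • (EuclideanSpace.proj i : E →L[ℝ] ℝ)
        + (2 * x i) • h2 • (2 • innerSL ℝ x)) x := by
  have heq : pd i (fun y : E => h (‖y‖ ^ 2)) =ᶠ[nhds x] fun y => h1 (‖y‖ ^ 2) * (2 * y i) := by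
    filter_upwards [(tendsto_norm_sq x).eventually hh] with y hy using pd_comp_norm_sq i hy
  have hproj : HasFDerivAt (fun y : E => 2 * y i)
      ((2 : ℝ) • (EuclideanSpace.proj i : E →L[ℝ] ℝ)) x :=
    (EuclideanSpace.proj i : E →L[ℝ] ℝ).hasFDerivAt.const_mul 2
  exact ((hasFDerivAt_comp_norm_sq hh').mul hproj).congr_of_eventuallyEq heq

lemma sum_pd_pd_comp_norm_sq {h h1 : ℝ → ℝ} {h2 : ℝ} {x : E}
    (hh : ∀ᶠ s in nhds (‖x‖ ^ 2), HasDerivAt h (h1 s) s) (hh' : HasDerivAt h1 h2 (‖x‖ ^ 2)) :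
    ∑ i, pd i (pd i (fun y : E => h (‖y‖ ^ 2))) x
      = 4 * ‖x‖ ^ 2 * h2 + 2 * d * h1 (‖x‖ ^ 2) := by
  have hi : ∀ i, pd i (pd i (fun y : E => h (‖y‖ ^ 2))) x
      = 4 * h2 * x i ^ 2 + 2 * h1 (‖x‖ ^ 2) := by
    intro i
    conv_lhs => rw [pd, (hasFDerivAt_pd_comp_norm_sq i hh hh').fderiv]
    simp [EuclideanSpace.inner_single_right]
    ring
  simp only [hi, Finset.sum_add_distrib, ← Finset.mul_sum, ← EuclideanSpace.real_norm_sq_eq]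
  simp only [Finset.sum_const, Finset.card_univ, Fintype.card_fin, nsmul_eq_mul]
  ring

end Laplacian

lemma HasDerivAt.nonneg_of_le_left {g : ℝ → ℝ} {g' a t : ℝ} (hg : HasDerivAt g g' t) (hat : a < t)
    (hle : ∀ s ∈ Ioo a t, g s ≤ g t) : 0 ≤ g' := by
  have h1 : Filter.Tendsto (slope g t) (nhdsWithin t (Iio t)) (nhds g') :=
    (hasDerivAt_iff_tendsto_slope.1 hg).mono_left
      (nhdsWithin_mono t fun s (hs : s < t) => hs.ne)
  refine ge_of_tendsto h1 ?_
  filter_upwards [Ioo_mem_nhdsLT hat] with s hs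
  rw [slope_def_field]
  exact div_nonneg_of_nonpos (sub_nonpos.2 (hle s hs)) (by linarith [hs.2])

lemma isCompact_annulus {d : ℕ} (a b : ℝ) :
    IsCompact {x : EuclideanSpace ℝ (Fin d) | ‖x‖ ^ 2 ∈ Icc a b} := by
  refine Metric.isCompact_of_isClosed_isBounded
    (isClosed_Icc.preimage (continuous_norm.pow 2)) ?_
  refine (Metric.isBounded_closedBall (x := 0) (r := Real.sqrt b)).subset fun x hx => ?_
  rw [mem_closedBall_zero_iff]
  exact Real.le_sqrt_of_sq_le hx.2

lemma ne_zero_of_mem_annulus {d : ℕ} {a b : ℝ} (ha : 0 < a) {x : EuclideanSpace ℝ (Fin d)}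
    (hx : ‖x‖ ^ 2 ∈ Icc a b) : x ≠ 0 := by
  rintro rfl
  have := hx.1
  simp at this
  linarith

/-- Parabolic comparison on an annulus with a stationary radial strict supersolution. -/
lemma exp_mul_le_of_isRadialSupersol {d : ℕ} {c p K : ℝ} (hp : 1 < p) (hc : c < 0) (hK : 0 ≤ K)
    {β : EuclideanSpace ℝ (Fin d) → ℝ} (hβ : ∀ x, x ≠ 0 → β x - K ≤ c / ‖x‖ ^ 2)
    {u : EuclideanSpace ℝ (Fin d) → ℝ → ℝ}
    (hu_cont : ContinuousOn (fun q : EuclideanSpace ℝ (Fin d) × ℝ => u q.1 q.2)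
      (({0}ᶜ : Set (EuclideanSpace ℝ (Fin d))) ×ˢ Ici (0 : ℝ)))
    (hu_nonneg : ∀ x : EuclideanSpace ℝ (Fin d), x ≠ 0 → ∀ t, 0 ≤ t → 0 ≤ u x t)
    (hu_x : ∀ t : ℝ, 0 < t →
      ContDiffOn ℝ 2 (fun x => u x t) ({0}ᶜ : Set (EuclideanSpace ℝ (Fin d))))
    (hu_t : ∀ x : EuclideanSpace ℝ (Fin d), x ≠ 0 →
      ContDiffOn ℝ 1 (fun s => u x s) (Ioi (0 : ℝ)))
    (hpde : ∀ x : EuclideanSpace ℝ (Fin d), x ≠ 0 → ∀ t, 0 < t →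
      deriv (fun s => u x s) t =
        (1 / 2) * (∑ i, pd i (pd i (fun y => u y t)) x)
          + β x * u x t - u x t ^ p)
    (hinit : ∀ x : EuclideanSpace ℝ (Fin d), x ≠ 0 → u x 0 = 0)
    {a b T : ℝ} (ha : 0 < a) {h h1 h2 : ℝ → ℝ}
    (hsup : ∀ s ∈ Icc a b, IsRadialSupersol d c p h h1 h2 s)
    (hbdry : ∀ x, (‖x‖ ^ 2 = a ∨ ‖x‖ ^ 2 = b) → ∀ t ∈ Icc 0 T, u x t ≤ h (‖x‖ ^ 2))
    {x₀ : EuclideanSpace ℝ (Fin d)} (hx₀ : ‖x₀‖ ^ 2 ∈ Icc a b) {t₀ : ℝ} (ht₀ : t₀ ∈ Icc 0 T) :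
    Real.exp (-K * t₀) * u x₀ t₀ ≤ h (‖x₀‖ ^ 2) := by
  by_contra! hlt
  set S : Set (EuclideanSpace ℝ (Fin d)) := {x | ‖x‖ ^ 2 ∈ Icc a b} with hS
  set F : EuclideanSpace ℝ (Fin d) × ℝ → ℝ :=
    fun q => Real.exp (-K * q.2) * u q.1 q.2 - h (‖q.1‖ ^ 2) with hF
  have hhcont : ContinuousOn h (Icc a b) := fun s hs =>
    (hsup s hs).hasDerivAt.continuousAt.continuousWithinAt
  have hFcont : ContinuousOn F (S ×ˢ Icc 0 T) := by
    refine ContinuousOn.sub (ContinuousOn.mul (by fun_prop) (hu_cont.mono ?_)) ?_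
    · exact prod_mono (fun x hx => ne_zero_of_mem_annulus ha hx) Icc_subset_Ici_self
    · exact hhcont.comp (by fun_prop) fun q hq => hq.1
  obtain ⟨⟨x, t⟩, ⟨hxS, htT⟩, hmax⟩ := ((isCompact_annulus a b).prod isCompact_Icc).exists_isMaxOn
    ⟨(x₀, t₀), hx₀, ht₀⟩ hFcont
  simp only at hxS htT
  have hFpos : h (‖x‖ ^ 2) < Real.exp (-K * t) * u x t := by
    have h1 : F (x₀, t₀) ≤ F (x, t) := hmax ⟨hx₀, ht₀⟩
    simp only [hF] at h1
    linarith
  have hx : x ≠ 0 := ne_zero_of_mem_annulus ha hxS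
  have hsx := hsup _ hxS
  have hu0 := hu_nonneg x hx t htT.1
  have hexp : Real.exp (-K * t) ≤ 1 := Real.exp_le_one_iff.2 (by nlinarith [htT.1])
  have hexp0 := Real.exp_pos (-K * t)
  have hxne : ∀ r, (r = a ∨ r = b) → ‖x‖ ^ 2 ≠ r := by
    rintro r hr rfl
    have := hbdry x hr t htT
    nlinarith
  have ht : 0 < t := by
    refine htT.1.lt_of_ne fun h0 => ?_
    rw [← h0, hinit x hx] at hFpos
    have := hsx.pos
    simp at hFpos
    linarith
  have hxIoo : ‖x‖ ^ 2 ∈ Ioo a b :=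
    ⟨hxS.1.lt_of_ne (hxne a (Or.inl rfl)).symm, hxS.2.lt_of_ne (hxne b (Or.inr rfl))⟩
  have hIoo : ∀ᶠ s in nhds (‖x‖ ^ 2), s ∈ Ioo a b := isOpen_Ioo.mem_nhds hxIoo
  have hhev : ∀ᶠ s in nhds (‖x‖ ^ 2), HasDerivAt h (h1 s) s := by
    filter_upwards [hIoo] with s hs using (hsup s (Ioo_subset_Icc_self hs)).hasDerivAt
  -- the spatial second-order condition
  have hlap : Real.exp (-K * t) * ∑ i, pd i (pd i (fun y => u y t)) x
      ≤ 4 * ‖x‖ ^ 2 * h2 (‖x‖ ^ 2) + 2 * d * h1 (‖x‖ ^ 2) := by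
    rw [← sum_pd_pd_comp_norm_sq hhev hsx.hasDerivAt_deriv, Finset.mul_sum]
    refine Finset.sum_le_sum fun i _ => ?_
    have hne : ∀ᶠ y in nhds x, y ≠ 0 := isOpen_ne.mem_nhds hx
    have hC : ∀ y, y ≠ 0 → ContDiffAt ℝ 2 (fun y => u y t) y := fun y hy =>
      (hu_x t ht).contDiffAt (isOpen_ne.mem_nhds hy)
    refine mul_pd_pd_le_of_isLocalMax_sub _ i ?_ (differentiableAt_pd i (hC x hx)) ?_
      (hasFDerivAt_pd_comp_norm_sq i hhev hsx.hasDerivAt_deriv).differentiableAt ?_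
    · filter_upwards [hne] with y hy using (hC y hy).differentiableAt (by norm_num)
    · filter_upwards [(tendsto_norm_sq x).eventually hhev] with y hy using
        (hasFDerivAt_comp_norm_sq hy).differentiableAt
    · filter_upwards [(tendsto_norm_sq x).eventually hIoo] with y hy
      exact hmax (show (y, t) ∈ S ×ˢ Icc 0 T from ⟨Ioo_subset_Icc_self hy, htT⟩)
  -- the first-order condition in time
  have htime : 0 ≤ Real.exp (-K * t) * (-K) * u x t
      + Real.exp (-K * t) * deriv (fun s => u x s) t := by
    have hd1 : HasDerivAt (fun s => u x s) (deriv (fun s => u x s) t) t :=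
      (((hu_t x hx).contDiffAt (Ioi_mem_nhds ht)).differentiableAt (by norm_num)).hasDerivAt
    have hd2 : HasDerivAt (fun s : ℝ => Real.exp (-K * s)) (Real.exp (-K * t) * (-K)) t := by
      simpa using ((hasDerivAt_id t).const_mul (-K)).exp
    refine (hd2.mul hd1).nonneg_of_le_left ht fun s hs => ?_
    have h1 : F (x, s) ≤ F (x, t) := hmax ⟨hxS, hs.1.le, hs.2.le.trans htT.2⟩
    simpa [hF] using h1
  rw [hpde x hx t ht] at htime
  set v : ℝ := Real.exp (-K * t) * u x t with hv
  have hpow : h (‖x‖ ^ 2) ^ p ≤ Real.exp (-K * t) * u x t ^ p := by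
    calc h (‖x‖ ^ 2) ^ p ≤ v ^ p := Real.rpow_le_rpow hsx.pos.le hFpos.le (by linarith)
      _ = Real.exp (-K * t) ^ p * u x t ^ p := Real.mul_rpow hexp0.le hu0
      _ ≤ _ := by
        gcongr
        simpa using Real.rpow_le_rpow_of_exponent_ge hexp0 hexp hp.le
  have hpot : (β x - K) * v ≤ c / ‖x‖ ^ 2 * h (‖x‖ ^ 2) := by
    have hcn : c / ‖x‖ ^ 2 < 0 := div_neg_of_neg_of_pos hc (by positivity)
    have h3 := mul_le_mul_of_nonneg_right (hβ x hx) (hsx.pos.le.trans hFpos.le)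
    nlinarith
  have := hsx.lt_zero
  nlinarith

/-- Theorem 4, part (2): for `d ≥ 2`, `p > 1` with `d < 2p/(p−1)`,
`β₀ = (d(p−1) − 2p)/(p−1)²` and `limsup_{x→0} |x|²β(x) < β₀`, the only nonnegative
classical solution of `u_t = (1/2)Δu + βu − u^p` on the punctured space `ℝ^d ∖ {0}`
with zero initial data is `u ≡ 0`. -/
theorem stmt_17 {d : ℕ} (hd : 2 ≤ d) (p : ℝ) (hp : 1 < p)
    (hdim : (d : ℝ) < 2 * p / (p - 1))
    (β₀ : ℝ) (hβ₀ : β₀ = ((d : ℝ) * (p - 1) - 2 * p) / (p - 1) ^ 2)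
    (β : EuclideanSpace ℝ (Fin d) → ℝ)
    (hβ_holder : LocHolderOn β ({0}ᶜ : Set (EuclideanSpace ℝ (Fin d))))
    (hβ_bdd : ∃ M : ℝ, ∀ x : EuclideanSpace ℝ (Fin d), x ≠ 0 → β x ≤ M)
    (hβ_limsup : ∃ c : ℝ, c < β₀ ∧ ∃ r : ℝ, 0 < r ∧
      ∀ x : EuclideanSpace ℝ (Fin d), x ≠ 0 → ‖x‖ ≤ r → ‖x‖ ^ 2 * β x ≤ c)
    (u : EuclideanSpace ℝ (Fin d) → ℝ → ℝ)
    (hu_cont : ContinuousOn (fun q : EuclideanSpace ℝ (Fin d) × ℝ => u q.1 q.2)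
      (({0}ᶜ : Set (EuclideanSpace ℝ (Fin d))) ×ˢ Ici (0 : ℝ)))
    (hu_nonneg : ∀ x : EuclideanSpace ℝ (Fin d), x ≠ 0 → ∀ t, 0 ≤ t → 0 ≤ u x t)
    (hu_x : ∀ t : ℝ, 0 < t →
      ContDiffOn ℝ 2 (fun x => u x t) ({0}ᶜ : Set (EuclideanSpace ℝ (Fin d))))
    (hu_t : ∀ x : EuclideanSpace ℝ (Fin d), x ≠ 0 →
      ContDiffOn ℝ 1 (fun s => u x s) (Ioi (0 : ℝ)))
    (hpde : ∀ x : EuclideanSpace ℝ (Fin d), x ≠ 0 → ∀ t, 0 < t →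
      deriv (fun s => u x s) t =
        (1 / 2) * (∑ i, pd i (pd i (fun y => u y t)) x)
          + β x * u x t - u x t ^ p)
    (hinit : ∀ x : EuclideanSpace ℝ (Fin d), x ≠ 0 → u x 0 = 0) :
    ∀ x : EuclideanSpace ℝ (Fin d), x ≠ 0 → ∀ t, 0 ≤ t → u x t = 0 := by
  have hp1 : 0 < p - 1 := by linarith
  have hβ₀neg : β₀ < 0 := by
    rw [lt_div_iff₀ hp1] at hdim
    rw [hβ₀]
    exact div_neg_of_neg_of_pos (by linarith) (by positivity)
  obtain ⟨M, hM⟩ := hβ_bdd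
  obtain ⟨c, hcβ, r, hr, hcr⟩ := hβ_limsup
  have hc : c < 0 := hcβ.trans hβ₀neg
  set K : ℝ := |M| - c / r ^ 2 with hKdef
  have hcr0 : c / r ^ 2 < 0 := div_neg_of_neg_of_pos hc (by positivity)
  have hK : 0 ≤ K := by have := abs_nonneg M; linarith
  have hβ : ∀ x, x ≠ 0 → β x - K ≤ c / ‖x‖ ^ 2 := by
    intro x hx
    have hx2 : 0 < ‖x‖ ^ 2 := by positivity
    rcases le_total ‖x‖ r with hxr | hxr
    · have : β x ≤ c / ‖x‖ ^ 2 := by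
        rw [le_div_iff₀ hx2, mul_comm]; exact hcr x hx hxr
      linarith
    · have h1 := hM x hx
      have h2 := le_abs_self M
      have h3 : c / r ^ 2 ≤ c / ‖x‖ ^ 2 := by
        rw [div_le_div_iff₀ (by positivity) hx2]
        exact mul_le_mul_of_nonpos_left (by gcongr) hc.le
      linarith
  intro x₀ hx₀ t₀ ht₀
  have hs₀ : 0 < ‖x₀‖ ^ 2 := by positivity
  suffices hle : Real.exp (-K * t₀) * u x₀ t₀ ≤ 0 from
    le_antisymm (nonpos_of_mul_nonpos_right hle (Real.exp_pos _)) (hu_nonneg x₀ hx₀ t₀ ht₀)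
  refine le_of_forall_pos_le_add fun ε hε => ?_
  obtain ⟨η, hη, hηs, f, f1, f2, hf, hftop, hfε⟩ :=
    exists_inner_barrier d hp (hβ₀ ▸ hcβ) hs₀ (half_pos hε)
  obtain ⟨R, hsR, g, g1, g2, hg, hgtop, hgε⟩ := exists_outer_barrier d hp hc hs₀ (half_pos hε)
  obtain ⟨N, hN⟩ := (((isCompact_annulus (d := d) η R).prod
    (isCompact_Icc (a := (0 : ℝ)) (b := t₀))).bddAbove_image (hu_cont.mono
      (prod_mono (fun x hx => ne_zero_of_mem_annulus hη hx) Icc_subset_Ici_self)))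
  have hN' : ∀ x : EuclideanSpace ℝ (Fin d), ‖x‖ ^ 2 ∈ Icc η R → ∀ t ∈ Icc 0 t₀, u x t ≤ N :=
    fun x hx t ht => hN ⟨(x, t), ⟨hx, ht⟩, rfl⟩
  obtain ⟨a, hNa, hηa, has⟩ := ((hftop.eventually_ge_atTop N).and (Ioo_mem_nhdsGT hηs)).exists
  obtain ⟨b, hNb, hsb, hbR⟩ := ((hgtop.eventually_ge_atTop N).and (Ioo_mem_nhdsLT hsR)).exists
  have ha : 0 < a := hη.trans hηa
  have hab : a < b := has.trans hsb
  have hmain := exp_mul_le_of_isRadialSupersol (T := t₀) hp hc hK hβ hu_cont hu_nonneg hu_x hu_t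
    hpde hinit ha
    (fun s hs => (hf s (hηa.trans_le hs.1)).add hp.le
      (hg s (ha.trans_le hs.1) (hs.2.trans_lt hbR)))
    (fun x hx t ht => ?_) (x₀ := x₀) ⟨has.le, hsb.le⟩ ⟨ht₀, le_rfl⟩
  · linarith
  · rcases hx with hx | hx
    · have h1 := hN' x (by rw [hx]; exact ⟨hηa.le, (hab.trans hbR).le⟩) t ht
      have h2 := (hg a ha (hab.trans hbR)).pos
      rw [hx]
      linarith
    · have h1 := hN' x (by rw [hx]; exact ⟨(hηa.trans hab).le, hbR.le⟩) t ht
      have h2 := (hf b (hηa.trans hab)).pos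
      rw [hx]
      linarith
end
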